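/- arXiv:2401.10992 — 2 statements merged into one kernel-verified Lean document; each statement's English description precedes it below -/
import Mathlib

section
/- Let p ∈ (0,∞) and let S ⊂ ℝ² be a symmetric convex polytope with exactly 2m extreme points, where 2m > 4. Then there exists a symmetric convex polytope S' ⊂ ℝ² with exactly 2m−2 extreme points such that |S'| = |S| and M_p(S') ≤ M_p(S). -/
open MeasureTheory Set

/-- The `L^p`-support function of a body `K ⊆ ℝ²`. -/
noncomputable def suppFn (p : ℝ) (K : Set (ℝ × ℝ)) (y : ℝ × ℝ) : ℝ :=
  (1 / p) * Real.log ((∫ x in K, Real.exp (p * (x.1 * y.1 + x.2 * y.2))) / (volume K).toReal)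

/-- The `L^p`-Mahler volume of `K ⊆ ℝ²`. -/
noncomputable def mahlerVol (p : ℝ) (K : Set (ℝ × ℝ)) : ℝ :=
  (volume K).toReal * ∫ y, Real.exp (-(suppFn p K y))

/-- The near norm of the `L^p`-polar body, for `n = 2`. -/
noncomputable def nearNorm (p : ℝ) (K : Set (ℝ × ℝ)) (y : ℝ × ℝ) : ℝ :=
  if y = 0 then 0
  else (∫ r in Set.Ioi (0 : ℝ), r * Real.exp (-(suppFn p K (r • y)))) ^ (-(1 / 2 : ℝ))

/-- The `L^p`-polar body of `K ⊆ ℝ²`. -/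
noncomputable def lpPolar (p : ℝ) (K : Set (ℝ × ℝ)) : Set (ℝ × ℝ) :=
  {y | nearNorm p K y ≤ 1}

/-- A convex polytope in `ℝ²` with exactly `k` extreme points. -/
def IsPolytopeWith (k : ℕ) (Q : Set (ℝ × ℝ)) : Prop :=
  IsCompact Q ∧ Convex ℝ Q ∧ (interior Q).Nonempty ∧
    (∃ F : Finset (ℝ × ℝ), Q = convexHull ℝ (F : Set (ℝ × ℝ))) ∧
    (Set.extremePoints ℝ Q).ncard = k

open scoped ENNReal Pointwise in
theorem volume_add_le_of_isCompact {A B : Set ℝ} (hA : IsCompact A) (hB : IsCompact B)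
    (hA' : A.Nonempty) (hB' : B.Nonempty) : volume A + volume B ≤ volume (A + B) := by
  have hmA := hA.sSup_mem hA'
  have hmB := hB.sInf_mem hB'
  set M := sSup A
  set m := sInf B
  have h1 : volume A = volume ((fun x => x + m) '' A) := by
    simp
  have h2 : volume B = volume ((fun x => M + x) '' B) := by
    simp
  rw [h1, h2]
  have hd : AEDisjoint volume ((fun x => x + m) '' A) ((fun x => M + x) '' B) := by
    refine measure_mono_null (t := {M + m}) ?_ (by simp)
    rintro _ ⟨⟨x, hx, rfl⟩, y, hy, hxy⟩
    have h3 : x ≤ M := le_csSup hA.bddAbove hx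
    have h4 : m ≤ y := csInf_le hB.bddBelow hy
    simp only at hxy
    simp only [mem_singleton_iff]
    linarith
  rw [← measure_union₀ ((hB.image (by fun_prop)).measurableSet.nullMeasurableSet) hd]
  refine measure_mono ?_
  rintro _ (⟨x, hx, rfl⟩ | ⟨y, hy, rfl⟩)
  · exact Set.add_mem_add hx hmB
  · exact Set.add_mem_add hmA hy

open scoped ENNReal Pointwise in
/-- The one-dimensional Brunn–Minkowski inequality. -/
theorem volume_add_le_of_measurableSet {A B : Set ℝ} (hA : MeasurableSet A) (hB : MeasurableSet B)
    (hA' : A.Nonempty) (hB' : B.Nonempty) : volume A + volume B ≤ volume (A + B) := by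
  have key : ∀ K ⊆ A, IsCompact K → ∀ L ⊆ B, IsCompact L →
      volume K + volume L ≤ volume (A + B) := by
    intro K hKA hK L hLB hL
    obtain ⟨x, hx⟩ := hA'
    obtain ⟨y, hy⟩ := hB'
    calc volume K + volume L ≤ volume (insert x K) + volume (insert y L) :=
          add_le_add (measure_mono (subset_insert _ _)) (measure_mono (subset_insert _ _))
      _ ≤ volume (insert x K + insert y L) :=
          volume_add_le_of_isCompact (hK.insert x) (hL.insert y) (insert_nonempty _ _)
            (insert_nonempty _ _)
      _ ≤ _ := measure_mono (Set.add_subset_add (insert_subset hx hKA) (insert_subset hy hLB))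
  rw [hA.measure_eq_iSup_isCompact, hB.measure_eq_iSup_isCompact]
  simp only [iSup_and']
  refine ENNReal.biSup_add_biSup_le' (p := fun K => K ⊆ A ∧ IsCompact K)
    (q := fun L => L ⊆ B ∧ IsCompact L) ⟨∅, empty_subset _, isCompact_empty⟩
    ⟨∅, empty_subset _, isCompact_empty⟩ ?_
  rintro K ⟨h1, h2⟩ L ⟨h3, h4⟩
  exact key K h1 h2 L h3 h4

open scoped Pointwise in
/-- The one-dimensional Prékopa–Leindler inequality in its quasi-concave form. -/
theorem lintegral_add_le_of_min_le {a b : ℝ} (ha : 0 < a) (hb : 0 < b) {f f₀ f₁ : ℝ → ℝ}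
    (hf : Measurable f) (hf₀ : Measurable f₀) (hf₁ : Measurable f₁)
    (hn : ∀ x, 0 ≤ f x) (hn₀ : ∀ x, 0 ≤ f₀ x) (hn₁ : ∀ x, 0 ≤ f₁ x)
    (hs₀ : ∀ x, f₀ x ≤ 1) (hs₁ : ∀ x, f₁ x ≤ 1)
    (hl₀ : ∀ τ < 1, ∃ x, τ < f₀ x) (hl₁ : ∀ τ < 1, ∃ x, τ < f₁ x)
    (h : ∀ x y, min (f₀ x) (f₁ y) ≤ f (a * x + b * y)) :
    ENNReal.ofReal a * (∫⁻ x, ENNReal.ofReal (f₀ x)) + ENNReal.ofReal b *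
      (∫⁻ x, ENNReal.ofReal (f₁ x)) ≤ ∫⁻ x, ENNReal.ofReal (f x) := by
  rw [lintegral_eq_lintegral_meas_lt _ (Filter.Eventually.of_forall hn) hf.aemeasurable,
    lintegral_eq_lintegral_meas_lt _ (Filter.Eventually.of_forall hn₀) hf₀.aemeasurable,
    lintegral_eq_lintegral_meas_lt _ (Filter.Eventually.of_forall hn₁) hf₁.aemeasurable]
  rw [← lintegral_const_mul' _ _ ENNReal.ofReal_ne_top,
    ← lintegral_const_mul' _ _ ENNReal.ofReal_ne_top, ← lintegral_add_left]
  swap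
  · have : Antitone fun τ => ENNReal.ofReal a * volume {x | τ < f₀ x} := by
      intro s t hst
      dsimp only
      gcongr
    exact this.measurable
  refine lintegral_mono fun τ => ?_
  dsimp only
  by_cases hτ : τ < 1
  · have e₀ : ENNReal.ofReal a * volume {x | τ < f₀ x} = volume (a • {x | τ < f₀ x}) := by
      simp [Measure.addHaar_smul, abs_of_pos ha]
    have e₁ : ENNReal.ofReal b * volume {x | τ < f₁ x} = volume (b • {x | τ < f₁ x}) := by
      simp [Measure.addHaar_smul, abs_of_pos hb]
    rw [e₀, e₁]
    refine (volume_add_le_of_measurableSet ?_ ?_ ?_ ?_).trans (measure_mono ?_)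
    · exact (measurableSet_lt measurable_const hf₀).const_smul₀ a
    · exact (measurableSet_lt measurable_const hf₁).const_smul₀ b
    · exact Set.Nonempty.smul_set (hl₀ τ hτ)
    · exact Set.Nonempty.smul_set (hl₁ τ hτ)
    · rintro _ ⟨_, ⟨x, hx, rfl⟩, _, ⟨y, hy, rfl⟩, rfl⟩
      exact (lt_min hx hy).trans_le (h x y)
  · have e₀ : {x | τ < f₀ x} = ∅ := by
      ext x; simpa using (hs₀ x).trans (not_lt.1 hτ)
    have e₁ : {x | τ < f₁ x} = ∅ := by
      ext x; simpa using (hs₁ x).trans (not_lt.1 hτ)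
    simp [e₀, e₁]

/-- The weighted power mean estimate behind the Borell–Brascamp–Lieb inequality. -/
theorem one_le_mul_pow_of_inv_mean {a b s₀ s₁ σ X₀ X₁ : ℝ} (n : ℕ) (ha : 0 < a) (hb : 0 < b)
    (hs₀ : 0 < s₀) (hs₁ : 0 < s₁) (hσ : 0 < σ) (hX₀ : 0 < X₀) (hX₁ : 0 < X₁)
    (h : σ⁻¹ = a * s₀⁻¹ + b * s₁⁻¹) :
    ((a * X₀ + b * X₁) ^ n)⁻¹ ≤
      σ ^ (n + 1) * (a * ((X₀ ^ n)⁻¹ / s₀ ^ (n + 1)) + b * ((X₁ ^ n)⁻¹ / s₁ ^ (n + 1))) := by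
  set X := a * X₀ + b * X₁ with hX
  have hXp : 0 < X := by positivity
  have hj := (convexOn_pow (𝕜 := ℝ) (n + 1)).2
    (Set.mem_Ici.2 (show (0 : ℝ) ≤ (X₀ * s₀)⁻¹ by positivity))
    (Set.mem_Ici.2 (show (0 : ℝ) ≤ (X₁ * s₁)⁻¹ by positivity))
    (show 0 ≤ a * X₀ / X by positivity) (show 0 ≤ b * X₁ / X by positivity)
    (by field_simp; exact hX.symm)
  simp only [smul_eq_mul] at hj
  have e1 : a * X₀ / X * (X₀ * s₀)⁻¹ + b * X₁ / X * (X₁ * s₁)⁻¹ = (σ * X)⁻¹ := by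
    rw [mul_inv σ X, h]; field_simp
  rw [e1] at hj
  have e2 : σ ^ (n + 1) * X * ((σ * X)⁻¹) ^ (n + 1) = (X ^ n)⁻¹ := by
    rw [inv_pow, mul_pow]; field_simp; ring
  rw [← e2]
  refine (mul_le_mul_of_nonneg_left hj (by positivity)).trans_eq ?_
  rw [inv_pow, inv_pow, mul_pow, mul_pow]
  field_simp
  ring

open scoped ENNReal in
theorem lintegral_pow_rpow_le_of_bounded {a b : ℝ} (n : ℕ) (hn : n ≠ 0) (ha : 0 < a) (hb : 0 < b)
    {U U₀ U₁ : ℝ → ℝ}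
    (hU : Measurable U) (hU₀ : Measurable U₀) (hU₁ : Measurable U₁)
    (hp : ∀ x, 0 ≤ U x) (hp₀ : ∀ x, 0 ≤ U₀ x) (hp₁ : ∀ x, 0 ≤ U₁ x)
    (hb₀ : BddAbove (range U₀)) (hb₁ : BddAbove (range U₁))
    (hi₀ : ∫⁻ x, ENNReal.ofReal (U₀ x ^ (n + 1)) ≠ ⊤)
    (hi₁ : ∫⁻ x, ENNReal.ofReal (U₁ x ^ (n + 1)) ≠ ⊤)
    (h : ∀ x y, 0 < U₀ x → 0 < U₁ y → 0 < U (a * x + b * y) ∧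
      (U (a * x + b * y))⁻¹ ≤ a * (U₀ x)⁻¹ + b * (U₁ y)⁻¹) :
    (∫⁻ x, ENNReal.ofReal (U x ^ (n + 1))) ^ (-(1 / n : ℝ)) ≤
      ENNReal.ofReal a * (∫⁻ x, ENNReal.ofReal (U₀ x ^ (n + 1))) ^ (-(1 / n : ℝ)) +
      ENNReal.ofReal b * (∫⁻ x, ENNReal.ofReal (U₁ x ^ (n + 1))) ^ (-(1 / n : ℝ)) := by
  have hn' : (0 : ℝ) < n := by positivity
  have hneg : -(1 / n : ℝ) < 0 := by simp [hn']
  set A₀ := ∫⁻ x, ENNReal.ofReal (U₀ x ^ (n + 1)) with hA₀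
  set A₁ := ∫⁻ x, ENNReal.ofReal (U₁ x ^ (n + 1)) with hA₁
  rcases eq_or_ne A₀ 0 with h0 | h0
  · rw [h0, ENNReal.zero_rpow_of_neg hneg, ENNReal.mul_top (by simpa using ha), top_add]
    exact le_top
  rcases eq_or_ne A₁ 0 with h1 | h1
  · rw [h1, ENNReal.zero_rpow_of_neg hneg, ENNReal.mul_top (by simpa using hb), add_top]
    exact le_top
  have pos_sup : ∀ V : ℝ → ℝ, BddAbove (range V) → (∀ x, 0 ≤ V x) →
      ∫⁻ x, ENNReal.ofReal (V x ^ (n + 1)) ≠ 0 → 0 < ⨆ x, V x := by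
    intro V hV hV0 hne
    by_contra hcon
    apply hne
    have : ∀ x, V x = 0 := fun x =>
      le_antisymm ((le_ciSup hV x).trans (not_lt.1 hcon)) (hV0 x)
    simp [this]
  have hs₀ := pos_sup U₀ hb₀ hp₀ h0
  have hs₁ := pos_sup U₁ hb₁ hp₁ h1
  set s₀ := ⨆ x, U₀ x
  set s₁ := ⨆ x, U₁ x
  obtain ⟨σ, hσ, hσe⟩ : ∃ σ : ℝ, 0 < σ ∧ σ⁻¹ = a * s₀⁻¹ + b * s₁⁻¹ :=
    ⟨(a * s₀⁻¹ + b * s₁⁻¹)⁻¹, by positivity, by rw [inv_inv]⟩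
  have scale : ∀ (V : ℝ → ℝ) (s : ℝ), 0 < s → (∀ x, 0 ≤ V x) →
      ∫⁻ x, ENNReal.ofReal ((V x / s) ^ (n + 1)) =
        ENNReal.ofReal ((s ^ (n + 1))⁻¹) * ∫⁻ x, ENNReal.ofReal (V x ^ (n + 1)) := by
    intro V s hs hV
    rw [← lintegral_const_mul' _ _ ENNReal.ofReal_ne_top]
    refine lintegral_congr fun x => ?_
    rw [← ENNReal.ofReal_mul (by positivity), div_pow, div_eq_inv_mul]
  have approx : ∀ V : ℝ → ℝ, 0 < (⨆ x, V x) → (∀ x, 0 ≤ V x) → ∀ τ < 1,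
      ∃ x, τ < (V x / ⨆ x, V x) ^ (n + 1) := by
    intro V hs hV τ hτ
    rcases lt_or_ge τ 0 with h | h
    · exact ⟨0, h.trans_le (by have := hV 0; positivity)⟩
    · have hr : τ ^ ((1 : ℝ) / (n + 1 : ℕ)) < 1 := Real.rpow_lt_one h hτ (by positivity)
      obtain ⟨x, hx⟩ := exists_lt_of_lt_ciSup
        (show τ ^ ((1 : ℝ) / (n + 1 : ℕ)) * (⨆ x, V x) < ⨆ x, V x by nlinarith)
      refine ⟨x, ?_⟩
      rw [← lt_div_iff₀ hs] at hx
      calc τ = (τ ^ ((1 : ℝ) / (n + 1 : ℕ))) ^ (n + 1) := by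
            rw [one_div, Real.rpow_inv_natCast_pow h (by omega)]
        _ < _ := pow_lt_pow_left₀ hx (by positivity) (by omega)
  have key := lintegral_add_le_of_min_le ha hb
    (f := fun x => (U x / σ) ^ (n + 1)) (f₀ := fun x => (U₀ x / s₀) ^ (n + 1))
    (f₁ := fun x => (U₁ x / s₁) ^ (n + 1))
    (by fun_prop) (by fun_prop) (by fun_prop)
    (fun x => by have := hp x; positivity) (fun x => by have := hp₀ x; positivity)
    (fun x => by have := hp₁ x; positivity)
    (fun x => pow_le_one₀ (by have := hp₀ x; positivity)
      (div_le_one_of_le₀ (le_ciSup hb₀ x) hs₀.le))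
    (fun x => pow_le_one₀ (by have := hp₁ x; positivity)
      (div_le_one_of_le₀ (le_ciSup hb₁ x) hs₁.le))
    (approx U₀ hs₀ hp₀) (approx U₁ hs₁ hp₁) (by
      intro x y
      rcases (hp₀ x).eq_or_lt with hx | hx
      · have := hp (a * x + b * y)
        exact (min_le_left _ _).trans (by rw [← hx]; simp; positivity)
      rcases (hp₁ y).eq_or_lt with hy | hy
      · have := hp (a * x + b * y)
        exact (min_le_right _ _).trans (by rw [← hy]; simp; positivity)
      obtain ⟨h2, h3⟩ := h x y hx hy
      set ρ := min (U₀ x / s₀) (U₁ y / s₁) with hρ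
      have hρp : 0 < ρ := lt_min (by positivity) (by positivity)
      have hρ₀ : ρ * s₀ ≤ U₀ x := (le_div_iff₀ hs₀).1 (min_le_left _ _)
      have hρ₁ : ρ * s₁ ≤ U₁ y := (le_div_iff₀ hs₁).1 (min_le_right _ _)
      have h4 : ρ ≤ U (a * x + b * y) / σ := by
        rw [le_div_iff₀ hσ, ← inv_le_inv₀ h2 (by positivity)]
        refine h3.trans ?_
        calc a * (U₀ x)⁻¹ + b * (U₁ y)⁻¹ ≤ a * (ρ * s₀)⁻¹ + b * (ρ * s₁)⁻¹ := by gcongr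
          _ = (ρ * σ)⁻¹ := by rw [mul_inv ρ σ, hσe]; field_simp
      have h5 : min ((U₀ x / s₀) ^ (n + 1)) ((U₁ y / s₁) ^ (n + 1)) ≤ ρ ^ (n + 1) := by
        rcases min_cases (U₀ x / s₀) (U₁ y / s₁) with ⟨h6, -⟩ | ⟨h6, -⟩
        · rw [hρ, h6]; exact min_le_left _ _
        · rw [hρ, h6]; exact min_le_right _ _
      exact h5.trans (pow_le_pow_left₀ hρp.le h4 _))
  rw [scale U σ hσ hp, scale U₀ s₀ hs₀ hp₀, scale U₁ s₁ hs₁ hp₁, ← hA₀, ← hA₁] at key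
  set A := ∫⁻ x, ENNReal.ofReal (U x ^ (n + 1)) with hA
  rcases eq_or_ne A ⊤ with hAt | hAt
  · rw [hAt, ENNReal.top_rpow_of_neg hneg]; simp
  have param : ∀ B : ℝ≥0∞, B ≠ 0 → B ≠ ⊤ → ∃ X : ℝ, 0 < X ∧ B = ENNReal.ofReal ((X ^ n)⁻¹) ∧
      B ^ (-(1 / n : ℝ)) = ENNReal.ofReal X := by
    intro B hB0 hBt
    have hBp := ENNReal.toReal_pos hB0 hBt
    refine ⟨B.toReal ^ (-(1 / n : ℝ)), by positivity, ?_, ?_⟩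
    · rw [← Real.rpow_natCast, ← Real.rpow_mul hBp.le, ← Real.rpow_neg hBp.le]
      have : -(-(1 / n : ℝ) * n) = 1 := by field_simp
      rw [this, Real.rpow_one, ENNReal.ofReal_toReal hBt]
    · rw [← ENNReal.ofReal_rpow_of_pos hBp, ENNReal.ofReal_toReal hBt]
  obtain ⟨X₀, hX₀, hAX₀, e₀⟩ := param A₀ h0 hi₀
  obtain ⟨X₁, hX₁, hAX₁, e₁⟩ := param A₁ h1 hi₁
  rw [e₀, e₁, ← ENNReal.ofReal_mul ha.le, ← ENNReal.ofReal_mul hb.le,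
    ← ENNReal.ofReal_add (by positivity) (by positivity)]
  have hmain := one_le_mul_pow_of_inv_mean n ha hb hs₀ hs₁ hσ hX₀ hX₁ hσe
  have hA_ge : ENNReal.ofReal (((a * X₀ + b * X₁) ^ n)⁻¹) ≤ A := by
    have e3 : A = ENNReal.ofReal A.toReal := (ENNReal.ofReal_toReal hAt).symm
    rw [hAX₀, hAX₁, e3, ← ENNReal.ofReal_mul (by positivity),
      ← ENNReal.ofReal_mul (by positivity), ← ENNReal.ofReal_mul (by positivity),
      ← ENNReal.ofReal_mul (by positivity), ← ENNReal.ofReal_mul (by positivity),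
      ← ENNReal.ofReal_add (by positivity) (by positivity),
      ENNReal.ofReal_le_ofReal_iff (by positivity), inv_mul_eq_div (σ ^ (n + 1)),
      le_div_iff₀ (by positivity)] at key
    rw [e3, ENNReal.ofReal_le_ofReal_iff (by positivity)]
    refine hmain.trans ((le_of_eq ?_).trans key)
    field_simp
  have hX : (ENNReal.ofReal (((a * X₀ + b * X₁) ^ n)⁻¹)) ^ (-(1 / n : ℝ)) =
      ENNReal.ofReal (a * X₀ + b * X₁) := by
    rw [ENNReal.ofReal_rpow_of_pos (by positivity), ← Real.rpow_natCast,
      ← Real.rpow_neg (by positivity), ← Real.rpow_mul (by positivity)]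
    have : (-(n : ℝ) * -(1 / n : ℝ)) = 1 := by field_simp
    rw [this, Real.rpow_one]
  rw [← hX]
  rw [ENNReal.rpow_neg, ENNReal.rpow_neg]
  exact ENNReal.inv_le_inv.2 (ENNReal.rpow_le_rpow hA_ge (by positivity))

open scoped ENNReal in
/-- The one-dimensional Borell–Brascamp–Lieb inequality for negative exponents: if `G` is dominated
by the convex combination of `G₀` and `G₁`, the same holds for `(∫ G ^ (-(n + 1))) ^ (-1 / n)`. -/
theorem lintegral_inv_pow_rpow_le {a b : ℝ} (n : ℕ) (hn : n ≠ 0) (ha : 0 < a) (hb : 0 < b)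
    (hab : a + b = 1) {G G₀ G₁ : ℝ → ℝ≥0∞}
    (hG : Measurable G) (hG₀ : Measurable G₀) (hG₁ : Measurable G₁)
    (h : ∀ x y, G (a * x + b * y) ≤ ENNReal.ofReal a * G₀ x + ENNReal.ofReal b * G₁ y) :
    (∫⁻ x, (G x ^ (n + 1))⁻¹) ^ (-(1 / n : ℝ)) ≤
      ENNReal.ofReal a * (∫⁻ x, (G₀ x ^ (n + 1))⁻¹) ^ (-(1 / n : ℝ)) +
      ENNReal.ofReal b * (∫⁻ x, (G₁ x ^ (n + 1))⁻¹) ^ (-(1 / n : ℝ)) := by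
  have hab' : ENNReal.ofReal a + ENNReal.ofReal b = 1 := by
    rw [← ENNReal.ofReal_add ha.le hb.le, hab, ENNReal.ofReal_one]
  set ε : ℕ → ℝ≥0∞ := fun j => ((j : ℝ≥0∞) + 1)⁻¹ with hε
  have hε0 : ∀ j, ε j ≠ 0 := fun j => by simp [hε]
  have hεanti : Antitone ε := by
    intro i j hij
    simp only [hε]
    gcongr
  have hεlim : Filter.Tendsto ε Filter.atTop (nhds 0) := by
    have := (ENNReal.tendsto_inv_nat_nhds_zero).comp (Filter.tendsto_add_atTop_nat 1)
    simpa [hε, Function.comp_def] using this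
  set I : ℕ → Set ℝ := fun j => Icc (-(j : ℝ)) j with hI
  set V : ℕ → (ℝ → ℝ≥0∞) → ℝ → ℝ≥0∞ :=
    fun j H => (I j).indicator fun x => (H x + ε j)⁻¹ with hV
  have hVle : ∀ j H x, V j H x ≤ (ε j)⁻¹ := by
    intro j H x
    refine (indicator_le_self _ _ x).trans (ENNReal.inv_le_inv.2 le_add_self)
  have hVfin : ∀ j H x, V j H x ≠ ⊤ := fun j H x =>
    ((hVle j H x).trans_lt (ENNReal.inv_lt_top.2 (pos_iff_ne_zero.2 (hε0 j)))).ne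
  have hVmeas : ∀ j H, Measurable H → Measurable (V j H) := by
    intro j H hH
    exact ((hH.add_const _).inv).indicator measurableSet_Icc
  have hlim : ∀ H : ℝ → ℝ≥0∞, Measurable H →
      Filter.Tendsto (fun j => ∫⁻ x, V j H x ^ (n + 1)) Filter.atTop
        (nhds (∫⁻ x, (H x ^ (n + 1))⁻¹)) := by
    intro H hH
    refine lintegral_tendsto_of_tendsto_of_monotone
      (fun j => ((hVmeas j H hH).pow_const _).aemeasurable) ?_ ?_
    · refine Filter.Eventually.of_forall fun x i j hij => ?_
      have hIij : I i ⊆ I j := Icc_subset_Icc (by simpa using hij) (by simpa using hij)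
      have : V i H x ≤ V j H x := by
        refine (indicator_le_indicator_of_subset hIij (fun _ => zero_le) x).trans ?_
        refine indicator_le_indicator ?_
        exact ENNReal.inv_le_inv.2 (add_le_add le_rfl (hεanti hij))
      exact pow_le_pow_left₀ zero_le this _
    · refine Filter.Eventually.of_forall fun x => ?_
      rw [ENNReal.inv_pow]
      have h1 : Filter.Tendsto (fun j => (H x + ε j)⁻¹) Filter.atTop (nhds (H x)⁻¹) := by
        have := (tendsto_const_nhds (x := H x)).add hεlim
        rw [add_zero] at this
        exact this.inv
      have h2 : (fun j => (H x + ε j)⁻¹) =ᶠ[Filter.atTop] fun j => V j H x := by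
        obtain ⟨N, hN⟩ := exists_nat_ge |x|
        filter_upwards [Filter.eventually_ge_atTop N] with j hj
        have : x ∈ I j := abs_le.1 (hN.trans (by exact_mod_cast hj))
        simp [hV, this]
      exact ((ENNReal.continuous_pow (n + 1)).tendsto _).comp (h1.congr' h2)
  have hofReal : ∀ j H x, ENNReal.ofReal ((V j H x).toReal ^ (n + 1)) = V j H x ^ (n + 1) := by
    intro j H x
    rw [ENNReal.ofReal_pow ENNReal.toReal_nonneg, ENNReal.ofReal_toReal (hVfin j H x)]
  have hInt : ∀ j H, ∫⁻ x, V j H x ^ (n + 1) ≠ ⊤ := by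
    intro j H
    have : ∫⁻ x, V j H x ^ (n + 1) ≤ ∫⁻ x, (I j).indicator (fun _ => ((ε j)⁻¹) ^ (n + 1)) x := by
      refine lintegral_mono fun x => ?_
      by_cases hx : x ∈ I j
      · rw [indicator_of_mem hx]
        exact pow_le_pow_left₀ zero_le (hVle j H x) _
      · simp [hV, hx]
    refine (this.trans_lt ?_).ne
    rw [lintegral_indicator_const measurableSet_Icc]
    exact ENNReal.mul_lt_top
      (ENNReal.pow_lt_top (ENNReal.inv_lt_top.2 (pos_iff_ne_zero.2 (hε0 j)))) (by simp)
  have hbdd : ∀ j H, BddAbove (range fun x => (V j H x).toReal) := by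
    intro j H
    refine ⟨((ε j)⁻¹).toReal, ?_⟩
    rintro _ ⟨x, rfl⟩
    exact ENNReal.toReal_mono (ENNReal.inv_ne_top.2 (hε0 j)) (hVle j H x)
  have step : ∀ j, (∫⁻ x, (G x ^ (n + 1))⁻¹) ^ (-(1 / n : ℝ)) ≤
      ENNReal.ofReal a * (∫⁻ x, V j G₀ x ^ (n + 1)) ^ (-(1 / n : ℝ)) +
      ENNReal.ofReal b * (∫⁻ x, V j G₁ x ^ (n + 1)) ^ (-(1 / n : ℝ)) := by
    intro j
    have hWfin : ∀ x, (G x + ε j)⁻¹ ≠ ⊤ := fun x => by simp [hε0]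
    have hbb := lintegral_pow_rpow_le_of_bounded n hn ha hb
      (U := fun x => ((G x + ε j)⁻¹).toReal) (U₀ := fun x => (V j G₀ x).toReal)
      (U₁ := fun x => (V j G₁ x).toReal) ((hG.add_const _).inv.ennreal_toReal)
      (hVmeas j G₀ hG₀).ennreal_toReal (hVmeas j G₁ hG₁).ennreal_toReal
      (fun _ => ENNReal.toReal_nonneg) (fun _ => ENNReal.toReal_nonneg)
      (fun _ => ENNReal.toReal_nonneg) (hbdd j G₀) (hbdd j G₁)
      (by simpa only [hofReal] using hInt j G₀) (by simpa only [hofReal] using hInt j G₁)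
      (by
        have aux : ∀ (H : ℝ → ℝ≥0∞) x, 0 < (V j H x).toReal →
            H x + ε j ≠ ⊤ ∧ ((V j H x).toReal)⁻¹ = (H x + ε j).toReal := by
          intro H x hx
          have hxI : x ∈ I j := by
            by_contra hcon
            simp [hV, hcon] at hx
          simp only [hV, hxI, indicator_of_mem, ENNReal.toReal_inv, inv_inv] at hx ⊢
          refine ⟨fun ht => ?_, trivial⟩
          simp [ht] at hx
        intro x y hx hy
        obtain ⟨hx1, hx2⟩ := aux G₀ x hx
        obtain ⟨hy1, hy2⟩ := aux G₁ y hy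
        have hle : G (a * x + b * y) + ε j ≤
            ENNReal.ofReal a * (G₀ x + ε j) + ENNReal.ofReal b * (G₁ y + ε j) := by
          calc G (a * x + b * y) + ε j ≤ ENNReal.ofReal a * G₀ x + ENNReal.ofReal b * G₁ y
                + (ENNReal.ofReal a + ENNReal.ofReal b) * ε j := by
                rw [hab', one_mul]; gcongr; exact h x y
            _ = _ := by ring
        have hfin : ENNReal.ofReal a * (G₀ x + ε j) ≠ ⊤ :=
          ENNReal.mul_ne_top ENNReal.ofReal_ne_top hx1
        have hfin' : ENNReal.ofReal b * (G₁ y + ε j) ≠ ⊤ :=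
          ENNReal.mul_ne_top ENNReal.ofReal_ne_top hy1
        have hGf : G (a * x + b * y) + ε j ≠ ⊤ :=
          (hle.trans_lt (ENNReal.add_lt_top.2 ⟨hfin.lt_top, hfin'.lt_top⟩)).ne
        refine ⟨ENNReal.toReal_pos (ENNReal.inv_ne_zero.2 hGf) (hWfin _), ?_⟩
        rw [hx2, hy2, ENNReal.toReal_inv, inv_inv]
        have := ENNReal.toReal_mono (ENNReal.add_ne_top.2 ⟨hfin, hfin'⟩) hle
        rwa [ENNReal.toReal_add hfin hfin', ENNReal.toReal_mul, ENNReal.toReal_mul,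
          ENNReal.toReal_ofReal ha.le, ENNReal.toReal_ofReal hb.le] at this)
    simp only [hofReal] at hbb
    refine le_trans ?_ hbb
    rw [ENNReal.rpow_neg, ENNReal.rpow_neg]
    refine ENNReal.inv_le_inv.2 (ENNReal.rpow_le_rpow (lintegral_mono fun x => ?_) (by positivity))
    rw [ENNReal.ofReal_pow ENNReal.toReal_nonneg, ENNReal.ofReal_toReal (hWfin x), ENNReal.inv_pow]
    exact pow_le_pow_left₀ zero_le (ENNReal.inv_le_inv.2 le_self_add) _
  have hcont : ∀ H : ℝ → ℝ≥0∞, Measurable H → Filter.Tendsto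
      (fun j => (∫⁻ x, V j H x ^ (n + 1)) ^ (-(1 / n : ℝ))) Filter.atTop
        (nhds ((∫⁻ x, (H x ^ (n + 1))⁻¹) ^ (-(1 / n : ℝ)))) := fun H hH =>
    (ENNReal.continuous_rpow_const.tendsto _).comp (hlim H hH)
  have hlim₀ := ENNReal.Tendsto.const_mul (a := ENNReal.ofReal a) (hcont G₀ hG₀)
    (Or.inr ENNReal.ofReal_ne_top)
  have hlim₁ := ENNReal.Tendsto.const_mul (a := ENNReal.ofReal b) (hcont G₁ hG₁)
    (Or.inr ENNReal.ofReal_ne_top)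
  exact ge_of_tendsto' (hlim₀.add hlim₁) step

open scoped ENNReal in
theorem lintegral_comp_mul_left_eq {c : ℝ} (hc : 0 < c) {φ : ℝ → ℝ≥0∞} (hφ : Measurable φ) :
    ∫⁻ x, φ x = ENNReal.ofReal c * ∫⁻ x, φ (c * x) := by
  conv_lhs => rw [← Real.smul_map_volume_mul_left hc.ne']
  rw [lintegral_smul_measure, lintegral_map hφ (measurable_const_mul c), abs_of_pos hc]
  rfl

open scoped ENNReal in
theorem lintegral_eq_two_mul_of_even {J : ℝ → ℝ≥0∞} (hJ : ∀ r, J (-r) = J r) :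
    ∫⁻ r, J r = 2 * ∫⁻ r in Ioi 0, J r := by
  have h1 : ∫⁻ r in Iio 0, J r = ∫⁻ r in Ioi 0, J r := by
    have := (Measure.measurePreserving_neg (volume : Measure ℝ)).setLIntegral_comp_preimage_emb
      (MeasurableEquiv.neg ℝ).measurableEmbedding J (Iio 0)
    rw [← this]
    simp [hJ]
  rw [← lintegral_add_compl J (measurableSet_Ioi (a := (0 : ℝ))), compl_Ioi,
    setLIntegral_congr (Iio_ae_eq_Iic (a := (0 : ℝ)) (μ := volume)).symm, h1, two_mul]

open scoped ENNReal in
/-- Integration over the plane in the projective coordinates `(1, w) / q`. -/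
theorem lintegral_eq_projective {φ : ℝ × ℝ → ℝ≥0∞} (hφ : Measurable φ) (he : ∀ y, φ (-y) = φ y) :
    ∫⁻ y, φ y = 2 * ∫⁻ q in Ioi (0 : ℝ), ∫⁻ w, ENNReal.ofReal ((q ^ 3)⁻¹) * φ (q⁻¹, q⁻¹ * w) := by
  have hin : ∀ r : ℝ, Measurable fun s => φ (r, s) := fun r => hφ.comp measurable_prodMk_left
  rw [Measure.volume_eq_prod, lintegral_prod _ hφ.aemeasurable, lintegral_eq_two_mul_of_even]
  · congr 1
    have himg : (fun q : ℝ => q⁻¹) '' Ioi 0 = Ioi 0 := by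
      ext x
      simp only [mem_image, mem_Ioi]
      exact ⟨by rintro ⟨y, hy, rfl⟩; positivity, fun hx => ⟨x⁻¹, by positivity, inv_inv x⟩⟩
    conv_lhs => rw [← himg]
    rw [lintegral_image_eq_lintegral_abs_deriv_mul (f' := fun q => -(q ^ 2)⁻¹) measurableSet_Ioi
      (fun q hq => (hasDerivAt_inv (ne_of_gt hq)).hasDerivWithinAt) inv_injective.injOn]
    refine setLIntegral_congr_fun measurableSet_Ioi fun q hq => ?_
    have hq' : (0 : ℝ) < q := hq
    rw [lintegral_comp_mul_left_eq (inv_pos.2 hq') (hin q⁻¹), ← mul_assoc,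
      ← ENNReal.ofReal_mul (abs_nonneg _), lintegral_const_mul' _ _ ENNReal.ofReal_ne_top]
    congr 2
    rw [abs_neg, abs_of_pos (by positivity)]
    field_simp
  · intro r
    have := (Measure.measurePreserving_neg (volume : Measure ℝ)).lintegral_comp_emb
      (MeasurableEquiv.neg ℝ).measurableEmbedding (fun s => φ (-r, s))
    rw [← this]
    refine lintegral_congr fun s => ?_
    rw [← he (r, s)]
    rfl

open scoped ENNReal in
/-- A Busemann-type theorem: if `Ψ` is even and logarithmically convex on `ℝ³`, the inverse of
`∫ Ψ (y₁, y₂, t y₁) ^ (-c) dy` is a convex function of `t`. -/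
theorem inv_lintegral_le_of_logConvex {Ψ : ℝ → ℝ → ℝ → ℝ} {c : ℝ} (hc : 0 < c)
    (hcont : Continuous fun z : ℝ × ℝ × ℝ => Ψ z.1 z.2.1 z.2.2)
    (hpos : ∀ x y z, 0 < Ψ x y z) (heven : ∀ x y z, Ψ (-x) (-y) (-z) = Ψ x y z)
    (hlog : ∀ μ ν, 0 ≤ μ → 0 ≤ ν → μ + ν = 1 → ∀ x y z x' y' z',
      Ψ (μ * x + ν * x') (μ * y + ν * y') (μ * z + ν * z') ≤ Ψ x y z ^ μ * Ψ x' y' z' ^ ν)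
    {a b : ℝ} (ha : 0 < a) (hb : 0 < b) (hab : a + b = 1) (t₀ t₁ : ℝ) :
    (∫⁻ y : ℝ × ℝ, ENNReal.ofReal (Ψ y.1 y.2 ((a * t₀ + b * t₁) * y.1) ^ (-c)))⁻¹ ≤
      ENNReal.ofReal a * (∫⁻ y : ℝ × ℝ, ENNReal.ofReal (Ψ y.1 y.2 (t₀ * y.1) ^ (-c)))⁻¹ +
      ENNReal.ofReal b * (∫⁻ y : ℝ × ℝ, ENNReal.ofReal (Ψ y.1 y.2 (t₁ * y.1) ^ (-c)))⁻¹ := by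
  set G : ℝ → ℝ → ℝ → ℝ≥0∞ := fun t q w =>
    if 0 < q then ENNReal.ofReal (q * Ψ q⁻¹ (q⁻¹ * w) (t * q⁻¹) ^ (c / 3)) else ⊤ with hG
  have hGm : ∀ t, Measurable fun z : ℝ × ℝ => G t z.1 z.2 := by
    intro t
    refine Measurable.ite (measurableSet_lt measurable_const measurable_fst) ?_ measurable_const
    have h1 : Measurable fun z : ℝ × ℝ => Ψ z.1⁻¹ (z.1⁻¹ * z.2) (t * z.1⁻¹) :=
      hcont.measurable.comp (g := fun z : ℝ × ℝ × ℝ => Ψ z.1 z.2.1 z.2.2)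
        (f := fun z : ℝ × ℝ => (z.1⁻¹, z.1⁻¹ * z.2, t * z.1⁻¹)) (by fun_prop)
    exact (measurable_fst.mul (h1.pow_const _)).ennreal_ofReal
  have hInt : ∀ t, ∫⁻ y : ℝ × ℝ, ENNReal.ofReal (Ψ y.1 y.2 (t * y.1) ^ (-c)) =
      2 * ∫⁻ q, ∫⁻ w, (G t q w ^ (2 + 1))⁻¹ := by
    intro t
    rw [lintegral_eq_projective (φ := fun y => ENNReal.ofReal (Ψ y.1 y.2 (t * y.1) ^ (-c)))]
    · congr 1
      rw [← lintegral_indicator measurableSet_Ioi]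
      refine lintegral_congr fun q => ?_
      by_cases hq : 0 < q
      · rw [indicator_of_mem (mem_Ioi.2 hq)]
        refine lintegral_congr fun w => ?_
        have hΨ := hpos q⁻¹ (q⁻¹ * w) (t * q⁻¹)
        simp only [hG, hq, if_true]
        rw [← ENNReal.ofReal_mul (by positivity), ← ENNReal.ofReal_pow (by positivity),
          ← ENNReal.ofReal_inv_of_pos (by positivity)]
        congr 1
        rw [mul_pow, mul_inv, ← Real.rpow_natCast (Ψ _ _ _ ^ _), ← Real.rpow_mul hΨ.le,
          ← Real.rpow_neg hΨ.le]
        norm_num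
      · rw [indicator_of_notMem (by simpa using hq)]
        simp [hG, hq]
    · have h1 : Measurable fun y : ℝ × ℝ => Ψ y.1 y.2 (t * y.1) :=
        hcont.measurable.comp (g := fun z : ℝ × ℝ × ℝ => Ψ z.1 z.2.1 z.2.2)
          (f := fun y : ℝ × ℝ => (y.1, y.2, t * y.1)) (by fun_prop)
      exact (h1.pow_const _).ennreal_ofReal
    · intro y
      simp [heven]
  set t := a * t₀ + b * t₁ with ht
  have hconv : ∀ q₀ q₁ w₀ w₁, G t (a * q₀ + b * q₁) (a * w₀ + b * w₁) ≤
      ENNReal.ofReal a * G t₀ q₀ w₀ + ENNReal.ofReal b * G t₁ q₁ w₁ := by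
    intro q₀ q₁ w₀ w₁
    by_cases h₀ : 0 < q₀
    swap
    · have : G t₀ q₀ w₀ = ⊤ := by simp [hG, h₀]
      rw [this, ENNReal.mul_top (by simpa using ha), top_add]; exact le_top
    by_cases h₁ : 0 < q₁
    swap
    · have : G t₁ q₁ w₁ = ⊤ := by simp [hG, h₁]
      rw [this, ENNReal.mul_top (by simpa using hb), add_top]; exact le_top
    have hq : 0 < a * q₀ + b * q₁ := by positivity
    simp only [hG, h₀, h₁, hq, if_true]
    set q := a * q₀ + b * q₁ with hqd
    have hΨ₀ := hpos q₀⁻¹ (q₀⁻¹ * w₀) (t₀ * q₀⁻¹)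
    have hΨ₁ := hpos q₁⁻¹ (q₁⁻¹ * w₁) (t₁ * q₁⁻¹)
    have hΨ := hpos q⁻¹ (q⁻¹ * (a * w₀ + b * w₁)) (t * q⁻¹)
    rw [← ENNReal.ofReal_mul ha.le, ← ENNReal.ofReal_mul hb.le,
      ← ENNReal.ofReal_add (by positivity) (by positivity)]
    refine ENNReal.ofReal_le_ofReal ?_
    have hμν : a * q₀ / q + b * q₁ / q = 1 := by rw [← add_div, ← hqd, div_self hq.ne']
    have hl := hlog (a * q₀ / q) (b * q₁ / q) (by positivity) (by positivity) hμν
      q₀⁻¹ (q₀⁻¹ * w₀) (t₀ * q₀⁻¹) q₁⁻¹ (q₁⁻¹ * w₁) (t₁ * q₁⁻¹)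
    have e1 : a * q₀ / q * q₀⁻¹ + b * q₁ / q * q₁⁻¹ = q⁻¹ := by
      field_simp; linarith
    have e2 : a * q₀ / q * (q₀⁻¹ * w₀) + b * q₁ / q * (q₁⁻¹ * w₁) =
        q⁻¹ * (a * w₀ + b * w₁) := by field_simp
    have e3 : a * q₀ / q * (t₀ * q₀⁻¹) + b * q₁ / q * (t₁ * q₁⁻¹) = t * q⁻¹ := by
      rw [ht]; field_simp
    rw [e1, e2, e3] at hl
    set P := Ψ q⁻¹ (q⁻¹ * (a * w₀ + b * w₁)) (t * q⁻¹)
    set P₀ := Ψ q₀⁻¹ (q₀⁻¹ * w₀) (t₀ * q₀⁻¹)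
    set P₁ := Ψ q₁⁻¹ (q₁⁻¹ * w₁) (t₁ * q₁⁻¹)
    have h3 : P ^ (c / 3) ≤ a * q₀ / q * P₀ ^ (c / 3) + b * q₁ / q * P₁ ^ (c / 3) := by
      calc P ^ (c / 3) ≤ (P₀ ^ (a * q₀ / q) * P₁ ^ (b * q₁ / q)) ^ (c / 3) :=
            Real.rpow_le_rpow hΨ.le hl (by positivity)
        _ = (P₀ ^ (c / 3)) ^ (a * q₀ / q) * (P₁ ^ (c / 3)) ^ (b * q₁ / q) := by
            rw [Real.mul_rpow (by positivity) (by positivity), ← Real.rpow_mul hΨ₀.le,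
              ← Real.rpow_mul hΨ₁.le, ← Real.rpow_mul hΨ₀.le, ← Real.rpow_mul hΨ₁.le,
              mul_comm (c / 3), mul_comm (c / 3)]
        _ ≤ _ := Real.geom_mean_le_arith_mean2_weighted (by positivity) (by positivity)
            (by positivity) (by positivity) hμν
    calc q * P ^ (c / 3) ≤ q * (a * q₀ / q * P₀ ^ (c / 3) + b * q₁ / q * P₁ ^ (c / 3)) := by
          gcongr
      _ = _ := by field_simp
  set N : ℝ → ℝ → ℝ≥0∞ := fun t q => (∫⁻ w, (G t q w ^ (2 + 1))⁻¹) ^ (-(1 / (2 : ℕ) : ℝ)) with hN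
  have hJm : ∀ t, Measurable fun q => ∫⁻ w, (G t q w ^ (2 + 1))⁻¹ := fun t =>
    Measurable.lintegral_prod_right' (f := fun z : ℝ × ℝ => (G t z.1 z.2 ^ (2 + 1))⁻¹)
      ((hGm t).pow_const _).inv
  have hsec : ∀ t q, Measurable (G t q) := fun t q => (hGm t).comp measurable_prodMk_left
  have hNm : ∀ t, Measurable (N t) := fun t => (hJm t).pow_const _
  have hNconv : ∀ q₀ q₁, N t (a * q₀ + b * q₁) ≤
      ENNReal.ofReal a * N t₀ q₀ + ENNReal.ofReal b * N t₁ q₁ := fun q₀ q₁ =>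
    lintegral_inv_pow_rpow_le 2 two_ne_zero ha hb hab (hsec _ _) (hsec _ _) (hsec _ _)
      (hconv q₀ q₁)
  have hfin := lintegral_inv_pow_rpow_le 1 one_ne_zero ha hb hab (hNm t) (hNm t₀) (hNm t₁) hNconv
  have hNpow : ∀ t q, (N t q ^ (1 + 1))⁻¹ = ∫⁻ w, (G t q w ^ (2 + 1))⁻¹ := by
    intro t q
    simp only [hN]
    rw [← ENNReal.rpow_natCast, ← ENNReal.rpow_mul, ← ENNReal.rpow_neg]
    norm_num
  simp only [hNpow, Nat.cast_one, div_one, ENNReal.rpow_neg_one] at hfin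
  rw [hInt t, hInt t₀, hInt t₁]
  have h2 : ∀ I : ℝ≥0∞, (2 * I)⁻¹ = 2⁻¹ * I⁻¹ := fun I =>
    ENNReal.mul_inv (Or.inl two_ne_zero) (Or.inl ENNReal.ofNat_ne_top)
  rw [h2, h2, h2]
  calc _ ≤ 2⁻¹ * (ENNReal.ofReal a * (∫⁻ q, ∫⁻ w, (G t₀ q w ^ (2 + 1))⁻¹)⁻¹ +
        ENNReal.ofReal b * (∫⁻ q, ∫⁻ w, (G t₁ q w ^ (2 + 1))⁻¹)⁻¹) := by gcongr
    _ = _ := by ring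

/-- The horizontal shear `(x₁, x₂) ↦ (x₁ + t α(x₂), x₂)`. -/
def shear (α : ℝ → ℝ) (t : ℝ) (x : ℝ × ℝ) : ℝ × ℝ := (x.1 + t * α x.2, x.2)

/-- The normalised Laplace transform of the uniform measure on `K`, lifted to the graph of `α`. -/
noncomputable def liftedLaplace (p : ℝ) (α : ℝ → ℝ) (K : Set (ℝ × ℝ)) (x y z : ℝ) : ℝ :=
  (∫ u in K, Real.exp (p * (u.1 * x + u.2 * y + α u.2 * z))) / (volume K).toReal

theorem shear_neg_shear (α : ℝ → ℝ) (t : ℝ) (x : ℝ × ℝ) : shear α (-t) (shear α t x) = x := by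
  simp [shear]

theorem continuous_shear {α : ℝ → ℝ} (hα : Continuous α) (t : ℝ) : Continuous (shear α t) := by
  unfold shear
  fun_prop

/-- The shear as a measurable equivalence. -/
def shearEquiv {α : ℝ → ℝ} (hα : Continuous α) (t : ℝ) : (ℝ × ℝ) ≃ᵐ (ℝ × ℝ) where
  toFun := shear α t
  invFun := shear α (-t)
  left_inv := shear_neg_shear α t
  right_inv x := by simpa using shear_neg_shear α (-t) x
  measurable_toFun := (continuous_shear hα t).measurable
  measurable_invFun := (continuous_shear hα (-t)).measurable

theorem measurePreserving_shear {α : ℝ → ℝ} (hα : Continuous α) (t : ℝ) :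
    MeasurePreserving (shear α t) := by
  have h : MeasurePreserving (fun z : ℝ × ℝ => (z.1, z.2 + t * α z.1))
      ((volume : Measure ℝ).prod (volume : Measure ℝ)) (volume.prod volume) :=
    (MeasurePreserving.id volume).skew_product (g := fun a b => b + t * α a) (by fun_prop)
      (Filter.Eventually.of_forall fun a => (measurePreserving_add_right volume (t * α a)).map_eq)
  have hs : MeasurePreserving (Prod.swap : ℝ × ℝ → ℝ × ℝ) (volume.prod volume)
    (volume.prod volume) := Measure.measurePreserving_swap
  exact (hs.comp h).comp hs

theorem volume_shear_image {α : ℝ → ℝ} (hα : Continuous α) (t : ℝ) (K : Set (ℝ × ℝ)) :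
    volume (shear α t '' K) = volume K := by
  have := (measurePreserving_shear hα t).measure_preimage_emb
    (shearEquiv hα t).measurableEmbedding (shear α t '' K)
  have hinj : Function.Injective (shear α t) := (shearEquiv hα t).injective
  rw [← this, preimage_image_eq _ hinj]

theorem exp_neg_suppFn {p : ℝ} {K : Set (ℝ × ℝ)} {y : ℝ × ℝ}
    (h : 0 < (∫ x in K, Real.exp (p * (x.1 * y.1 + x.2 * y.2))) / (volume K).toReal) :
    Real.exp (-(suppFn p K y)) =
      ((∫ x in K, Real.exp (p * (x.1 * y.1 + x.2 * y.2))) / (volume K).toReal) ^ (-p⁻¹) := by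
  rw [suppFn, Real.rpow_def_of_pos h]
  congr 1
  ring

section Laplace

variable {p : ℝ} {α : ℝ → ℝ} {K : Set (ℝ × ℝ)}

theorem liftedLaplace_shear (hα : Continuous α) (t : ℝ) (y : ℝ × ℝ) :
    (∫ x in shear α t '' K, Real.exp (p * (x.1 * y.1 + x.2 * y.2))) /
      (volume (shear α t '' K)).toReal = liftedLaplace p α K y.1 y.2 (t * y.1) := by
  rw [volume_shear_image hα, (measurePreserving_shear hα t).setIntegral_image_emb
    (shearEquiv hα t).measurableEmbedding, liftedLaplace]
  congr 2
  ext u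
  simp only [shear]
  ring_nf

theorem continuous_liftedLaplace (hα : Continuous α) (hK : IsCompact K) :
    Continuous fun z : ℝ × ℝ × ℝ => liftedLaplace p α K z.1 z.2.1 z.2.2 := by
  unfold liftedLaplace
  refine Continuous.div_const ?_ _
  refine continuous_parametric_integral_of_continuous
    (f := fun (z : ℝ × ℝ × ℝ) (u : ℝ × ℝ) =>
      Real.exp (p * (u.1 * z.1 + u.2 * z.2.1 + α u.2 * z.2.2))) ?_ hK
  unfold Function.uncurry
  fun_prop

theorem liftedLaplace_neg (hodd : ∀ s, α (-s) = -α s) (hs : K = -K) (x y z : ℝ) :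
    liftedLaplace p α K (-x) (-y) (-z) = liftedLaplace p α K x y z := by
  unfold liftedLaplace
  congr 1
  have := (Measure.measurePreserving_neg (volume : Measure (ℝ × ℝ))).setIntegral_preimage_emb
    (MeasurableEquiv.neg (ℝ × ℝ)).measurableEmbedding
    (fun u => Real.exp (p * (u.1 * x + u.2 * y + α u.2 * z))) K
  rw [← this]
  have hpre : Neg.neg ⁻¹' K = K := hs.symm
  rw [hpre]
  congr 1
  ext u
  simp [hodd]

theorem integrableOn_exp (hα : Continuous α) (hK : IsCompact K) (x y z : ℝ) :
    IntegrableOn (fun u : ℝ × ℝ => Real.exp (p * (u.1 * x + u.2 * y + α u.2 * z))) K :=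
  (by fun_prop : Continuous fun u : ℝ × ℝ =>
    Real.exp (p * (u.1 * x + u.2 * y + α u.2 * z))).continuousOn.integrableOn_compact hK

theorem liftedLaplace_pos (hα : Continuous α) (hK : IsCompact K) (hv : volume K ≠ 0)
    (x y z : ℝ) : 0 < liftedLaplace p α K x y z := by
  refine div_pos ?_ (ENNReal.toReal_pos hv hK.measure_lt_top.ne)
  have : NeZero (volume.restrict K) := ⟨by simpa using hv⟩
  exact integral_exp_pos (integrableOn_exp hα hK x y z)

theorem liftedLaplace_logConvex (hα : Continuous α) (hK : IsCompact K) (hv : volume K ≠ 0)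
    {μ ν : ℝ} (hμ : 0 ≤ μ) (hν : 0 ≤ ν) (hμν : μ + ν = 1) (x y z x' y' z' : ℝ) :
    liftedLaplace p α K (μ * x + ν * x') (μ * y + ν * y') (μ * z + ν * z') ≤
      liftedLaplace p α K x y z ^ μ * liftedLaplace p α K x' y' z' ^ ν := by
  have hvol : 0 < (volume K).toReal := ENNReal.toReal_pos hv hK.measure_lt_top.ne
  have hI : ∀ x y z, ENNReal.ofReal (∫ u in K, Real.exp (p * (u.1 * x + u.2 * y + α u.2 * z))) =
      ∫⁻ u in K, ENNReal.ofReal (Real.exp (p * (u.1 * x + u.2 * y + α u.2 * z))) := fun x y z =>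
    ofReal_integral_eq_lintegral_ofReal (integrableOn_exp hα hK x y z)
      (Filter.Eventually.of_forall fun _ => (Real.exp_pos _).le)
  have hnn : ∀ x y z, 0 ≤ ∫ u in K, Real.exp (p * (u.1 * x + u.2 * y + α u.2 * z)) :=
    fun x y z => integral_nonneg fun _ => (Real.exp_pos _).le
  have hm : ∀ x y z, AEMeasurable (fun u : ℝ × ℝ =>
      ENNReal.ofReal (Real.exp (p * (u.1 * x + u.2 * y + α u.2 * z)))) (volume.restrict K) :=
    fun x y z => (by fun_prop : Continuous fun u : ℝ × ℝ =>
      Real.exp (p * (u.1 * x + u.2 * y + α u.2 * z))).measurable.ennreal_ofReal.aemeasurable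
  have hol := ENNReal.lintegral_mul_norm_pow_le (hm x y z) (hm x' y' z') hμ hν hμν
  rw [← hI, ← hI, ENNReal.ofReal_rpow_of_nonneg (hnn _ _ _) hμ,
    ENNReal.ofReal_rpow_of_nonneg (hnn _ _ _) hν,
    ← ENNReal.ofReal_mul (Real.rpow_nonneg (hnn _ _ _) _)] at hol
  have e : ∀ u : ℝ × ℝ, ENNReal.ofReal (Real.exp (p * (u.1 * x + u.2 * y + α u.2 * z))) ^ μ *
      ENNReal.ofReal (Real.exp (p * (u.1 * x' + u.2 * y' + α u.2 * z'))) ^ ν =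
      ENNReal.ofReal (Real.exp (p * (u.1 * (μ * x + ν * x') + u.2 * (μ * y + ν * y') +
        α u.2 * (μ * z + ν * z')))) := by
    intro u
    rw [ENNReal.ofReal_rpow_of_pos (Real.exp_pos _), ENNReal.ofReal_rpow_of_pos (Real.exp_pos _),
      ← ENNReal.ofReal_mul (by positivity), ← Real.exp_mul, ← Real.exp_mul, ← Real.exp_add]
    congr 2
    ring
  simp only [e] at hol
  rw [← hI, ENNReal.ofReal_le_ofReal_iff
    (mul_nonneg (Real.rpow_nonneg (hnn _ _ _) _) (Real.rpow_nonneg (hnn _ _ _) _))] at hol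
  unfold liftedLaplace
  rw [Real.div_rpow (hnn _ _ _) hvol.le, Real.div_rpow (hnn _ _ _) hvol.le, div_mul_div_comm,
    ← Real.rpow_add hvol, hμν, Real.rpow_one]
  gcongr

/-- The Laplace transform of a neighbourhood of the origin grows exponentially. -/
theorem exists_le_integral_exp (hp : 0 < p) (hK : IsCompact K) (h0 : (0 : ℝ × ℝ) ∈ interior K) :
    ∃ c > 0, ∃ ε > 0, ∀ y : ℝ × ℝ, c * Real.exp (p * (ε * (|y.1| + |y.2|))) ≤
      (∫ x in K, Real.exp (p * (x.1 * y.1 + x.2 * y.2))) / (volume K).toReal := by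
  have hv : volume K ≠ 0 := fun h => by
    have := (isOpen_interior (s := K)).measure_pos volume ⟨0, h0⟩
    exact this.ne' (measure_mono_null interior_subset h)
  have hvol : 0 < (volume K).toReal := ENNReal.toReal_pos hv hK.measure_lt_top.ne
  obtain ⟨r, hr, hball⟩ := Metric.isOpen_iff.1 isOpen_interior 0 h0
  set ε := r / 4 with hε
  have hεp : 0 < ε := by positivity
  refine ⟨ε ^ 2 / (volume K).toReal, by positivity, ε, hεp, fun y => ?_⟩
  have hInt : IntegrableOn (fun x : ℝ × ℝ => Real.exp (p * (x.1 * y.1 + x.2 * y.2))) K :=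
    (by fun_prop : Continuous fun x : ℝ × ℝ =>
      Real.exp (p * (x.1 * y.1 + x.2 * y.2))).continuousOn.integrableOn_compact hK
  obtain ⟨lo, hlo⟩ : ∃ lo : ℝ → ℝ, ∀ s : ℝ, -(2 * ε) ≤ lo s ∧ lo s + ε ≤ 2 * ε ∧
      ∀ x ∈ Icc (lo s) (lo s + ε), ε * |s| ≤ x * s := by
    refine ⟨fun s => if 0 ≤ s then ε else -(2 * ε), fun s => ?_⟩
    by_cases hs : 0 ≤ s
    · simp only [hs, if_true, abs_of_nonneg]
      refine ⟨by linarith, by linarith, fun x hx => mul_le_mul_of_nonneg_right hx.1 hs⟩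
    · simp only [hs, if_false]
      refine ⟨le_rfl, by linarith, fun x hx => ?_⟩
      rw [abs_of_neg (not_le.1 hs)]
      nlinarith [hx.2, not_le.1 hs]
  set B : Set (ℝ × ℝ) := Icc (lo y.1) (lo y.1 + ε) ×ˢ Icc (lo y.2) (lo y.2 + ε) with hB
  have hBK : B ⊆ K := by
    rintro ⟨x₁, x₂⟩ ⟨⟨h1, h2⟩, h3, h4⟩
    refine interior_subset (hball ?_)
    obtain ⟨h5, h6, -⟩ := hlo y.1
    obtain ⟨h7, h8, -⟩ := hlo y.2
    rw [mem_ball_zero_iff, Prod.norm_def, max_lt_iff, Real.norm_eq_abs, Real.norm_eq_abs, abs_lt,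
      abs_lt]
    dsimp only at *
    refine ⟨⟨?_, ?_⟩, ?_, ?_⟩ <;> linarith
  have hBm : MeasurableSet B := measurableSet_Icc.prod measurableSet_Icc
  have hBv : volume.real B = ε ^ 2 := by
    rw [hB, Measure.real, Measure.volume_eq_prod, Measure.prod_prod, Real.volume_Icc,
      Real.volume_Icc, add_sub_cancel_left, add_sub_cancel_left, ← ENNReal.ofReal_mul hεp.le,
      ENNReal.toReal_ofReal (mul_nonneg hεp.le hεp.le), sq]
  rw [div_mul_eq_mul_div]
  refine div_le_div_of_nonneg_right ?_ hvol.le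
  calc ε ^ 2 * Real.exp (p * (ε * (|y.1| + |y.2|)))
      = ∫ x in B, Real.exp (p * (ε * (|y.1| + |y.2|))) := by
        rw [setIntegral_const, smul_eq_mul, hBv]
    _ ≤ ∫ x in B, Real.exp (p * (x.1 * y.1 + x.2 * y.2)) := by
        refine setIntegral_mono_on ?_ (hInt.mono_set hBK) hBm fun x hx => ?_
        · exact integrableOn_const ((measure_mono hBK).trans_lt hK.measure_lt_top).ne
        · have h1 := (hlo y.1).2.2 x.1 hx.1
          have h2 := (hlo y.2).2.2 x.2 hx.2
          gcongr
          linarith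
    _ ≤ _ := setIntegral_mono_set hInt (Filter.Eventually.of_forall fun _ => (Real.exp_pos _).le)
        (Filter.Eventually.of_forall hBK)

theorem integrable_exp_neg_suppFn (hp : 0 < p) (hK : IsCompact K)
    (h0 : (0 : ℝ × ℝ) ∈ interior K) : Integrable fun y => Real.exp (-(suppFn p K y)) := by
  obtain ⟨c, hc, ε, hε, hle⟩ := exists_le_integral_exp hp hK h0
  have hpos : ∀ y : ℝ × ℝ,
      0 < (∫ x in K, Real.exp (p * (x.1 * y.1 + x.2 * y.2))) / (volume K).toReal := fun y =>
    lt_of_lt_of_le (by positivity) (hle y)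
  have hcont : Continuous fun y : ℝ × ℝ =>
      (∫ x in K, Real.exp (p * (x.1 * y.1 + x.2 * y.2))) / (volume K).toReal := by
    refine Continuous.div_const ?_ _
    refine continuous_parametric_integral_of_continuous
      (f := fun (y x : ℝ × ℝ) => Real.exp (p * (x.1 * y.1 + x.2 * y.2))) ?_ hK
    unfold Function.uncurry
    fun_prop
  have hexp : Integrable fun s : ℝ => Real.exp (-ε * |s|) := by
    have h1 : IntegrableOn (fun s : ℝ => Real.exp (-ε * |s|)) (Ioi 0) :=
      (integrableOn_exp_mul_Ioi (neg_lt_zero.2 hε) 0).congr_fun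
        (fun s hs => by simp only [abs_of_pos (mem_Ioi.1 hs)]) measurableSet_Ioi
    have h2 : IntegrableOn (fun s : ℝ => Real.exp (-ε * |s|)) (Iic 0) :=
      (integrableOn_exp_mul_Iic hε 0).congr_fun
        (fun s hs => by simp only [abs_of_nonpos (mem_Iic.1 hs), neg_mul_neg]) measurableSet_Iic
    rw [← integrableOn_univ, ← Iic_union_Ioi (a := (0 : ℝ))]
    exact h2.union h1
  have hg : Integrable fun y : ℝ × ℝ =>
      c ^ (-p⁻¹) * (Real.exp (-ε * |y.1|) * Real.exp (-ε * |y.2|)) :=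
    (hexp.mul_prod hexp).const_mul _
  refine hg.mono' ?_ (Filter.Eventually.of_forall fun y => ?_)
  · simp only [fun y => exp_neg_suppFn (hpos y)]
    exact (hcont.measurable.pow_const _).aestronglyMeasurable
  · rw [Real.norm_eq_abs, Real.abs_exp, exp_neg_suppFn (hpos y)]
    calc _ ≤ (c * Real.exp (p * (ε * (|y.1| + |y.2|)))) ^ (-p⁻¹) :=
          Real.rpow_le_rpow_of_nonpos (by positivity) (hle y) (by simpa using hp.le)
      _ = _ := by
          rw [Real.mul_rpow hc.le (Real.exp_pos _).le, ← Real.exp_mul, ← Real.exp_add]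
          congr 2
          field_simp
          ring

end Laplace

/-- The `L^p`-Mahler volume along a family of shears is minimal at the end points. -/
theorem mahlerVol_shear_le {p : ℝ} (hp : 0 < p) {α : ℝ → ℝ} (hα : Continuous α)
    (hodd : ∀ s, α (-s) = -α s) {K : Set (ℝ × ℝ)} (hK : IsCompact K) (hs : K = -K)
    (h0 : (0 : ℝ × ℝ) ∈ interior K) {t₀ t₁ : ℝ} (ht₀ : 0 < t₀) (ht₁ : 0 < t₁) :
    mahlerVol p (shear α (-t₀) '' K) ≤ mahlerVol p K ∨
      mahlerVol p (shear α t₁ '' K) ≤ mahlerVol p K := by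
  have hv : volume K ≠ 0 := fun h => by
    have := (isOpen_interior (s := K)).measure_pos volume ⟨0, h0⟩
    exact this.ne' (measure_mono_null interior_subset h)
  set a := t₁ / (t₀ + t₁) with ha
  set b := t₀ / (t₀ + t₁) with hb
  have hab : a + b = 1 := by rw [ha, hb]; field_simp; ring
  have hab0 : a * (-t₀) + b * t₁ = 0 := by rw [ha, hb]; field_simp; ring
  have hap : 0 < a := by positivity
  have hbp : 0 < b := by positivity
  have hpos := liftedLaplace_pos (p := p) hα hK hv
  have hkey := inv_lintegral_le_of_logConvex (inv_pos.2 hp) (continuous_liftedLaplace (p := p) hα hK)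
    hpos (liftedLaplace_neg hodd hs)
    (fun μ ν h1 h2 h3 => liftedLaplace_logConvex hα hK hv h1 h2 h3) hap hbp hab (-t₀) t₁
  have hI : ∀ t, ∫⁻ y : ℝ × ℝ, ENNReal.ofReal (liftedLaplace p α K y.1 y.2 (t * y.1) ^ (-p⁻¹)) =
      ∫⁻ y, ENNReal.ofReal (Real.exp (-(suppFn p (shear α t '' K) y))) := by
    intro t
    refine lintegral_congr fun y => ?_
    rw [exp_neg_suppFn (by rw [liftedLaplace_shear hα]; exact hpos _ _ _),
      liftedLaplace_shear hα]
  have hK0 : shear α 0 '' K = K := by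
    have : shear α 0 = id := by ext x <;> simp [shear]
    rw [this, image_id]
  rw [hab0, hI, hI, hI, hK0] at hkey
  have hfin : ∫⁻ y, ENNReal.ofReal (Real.exp (-(suppFn p K y))) ≠ ⊤ := by
    have := (integrable_exp_neg_suppFn hp hK h0).lintegral_lt_top
    exact this.ne
  have hmono : ∀ t, ∫⁻ y, ENNReal.ofReal (Real.exp (-(suppFn p (shear α t '' K) y))) ≤
      ∫⁻ y, ENNReal.ofReal (Real.exp (-(suppFn p K y))) →
      mahlerVol p (shear α t '' K) ≤ mahlerVol p K := by
    intro t ht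
    have hmeas : AEStronglyMeasurable (fun y => Real.exp (-(suppFn p (shear α t '' K) y))) := by
      have h1 : ∀ y, Real.exp (-(suppFn p (shear α t '' K) y)) =
          liftedLaplace p α K y.1 y.2 (t * y.1) ^ (-p⁻¹) := fun y => by
        rw [exp_neg_suppFn (by rw [liftedLaplace_shear hα]; exact hpos _ _ _),
          liftedLaplace_shear hα]
      simp only [h1]
      have h2 : Measurable fun y : ℝ × ℝ => liftedLaplace p α K y.1 y.2 (t * y.1) :=
        (continuous_liftedLaplace (p := p) hα hK).measurable.comp
          (f := fun y : ℝ × ℝ => (y.1, y.2, t * y.1)) (by fun_prop)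
      exact (h2.pow_const _).aestronglyMeasurable
    unfold mahlerVol
    rw [volume_shear_image hα]
    refine mul_le_mul_of_nonneg_left ?_ ENNReal.toReal_nonneg
    rw [integral_eq_lintegral_of_nonneg_ae (Filter.Eventually.of_forall fun _ => (Real.exp_pos _).le)
      hmeas, integral_eq_lintegral_of_nonneg_ae
      (Filter.Eventually.of_forall fun _ => (Real.exp_pos _).le)
      (integrable_exp_neg_suppFn hp hK h0).1]
    exact ENNReal.toReal_mono hfin ht
  by_contra! hcon
  obtain ⟨hc0, hc1⟩ := hcon
  set I := ∫⁻ y, ENNReal.ofReal (Real.exp (-(suppFn p K y)))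
  set I₀ := ∫⁻ y, ENNReal.ofReal (Real.exp (-(suppFn p (shear α (-t₀) '' K) y)))
  set I₁ := ∫⁻ y, ENNReal.ofReal (Real.exp (-(suppFn p (shear α t₁ '' K) y)))
  have h0' : I < I₀ := not_le.1 fun h => hc0.not_ge (hmono _ h)
  have h1' : I < I₁ := not_le.1 fun h => hc1.not_ge (hmono _ h)
  have hmin : I < min I₀ I₁ := lt_min h0' h1'
  refine absurd (ENNReal.inv_le_inv.1 (hkey.trans ?_)) (not_le.2 hmin)
  calc ENNReal.ofReal a * I₀⁻¹ + ENNReal.ofReal b * I₁⁻¹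
      ≤ ENNReal.ofReal a * (min I₀ I₁)⁻¹ + ENNReal.ofReal b * (min I₀ I₁)⁻¹ := by
        gcongr
        · exact min_le_left _ _
        · exact min_le_right _ _
    _ = (min I₀ I₁)⁻¹ := by
        rw [← add_mul, ← ENNReal.ofReal_add hap.le hbp.le, hab, ENNReal.ofReal_one, one_mul]

/-- The odd piecewise linear function vanishing on `[-1, 1]` and taking the value `1` at `h`. -/
noncomputable def bend (h s : ℝ) : ℝ := (max (s - 1) 0 - max (-s - 1) 0) / (h - 1)

theorem continuous_bend (h : ℝ) : Continuous (bend h) := by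
  unfold bend
  fun_prop

theorem bend_neg (h s : ℝ) : bend h (-s) = -bend h s := by
  simp only [bend, neg_neg]
  ring

theorem bend_of_abs_le {h s : ℝ} (hs : |s| ≤ 1) : bend h s = 0 := by
  rw [abs_le] at hs
  rw [bend, max_eq_right (by linarith), max_eq_right (by linarith)]
  simp

theorem bend_of_one_le {h s : ℝ} (hs : 1 ≤ s) : bend h s = (s - 1) / (h - 1) := by
  rw [bend, max_eq_left (by linarith), max_eq_right (by linarith), sub_zero]

/-- The triangle with base `[-1, 1] × {1}` and apex `(V, h)`. -/
def capTriangle (h V : ℝ) : Set (ℝ × ℝ) :=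
  {x | 1 ≤ x.2 ∧ x.2 ≤ h ∧ (V + 1) * (x.2 - 1) ≤ (x.1 + 1) * (h - 1) ∧
    (x.1 - 1) * (h - 1) ≤ (V - 1) * (x.2 - 1)}

/-- The body obtained from `C` by attaching two opposite triangles. -/
def capped (C : Set (ℝ × ℝ)) (h V : ℝ) : Set (ℝ × ℝ) :=
  {x | x ∈ C ∨ x ∈ capTriangle h V ∨ -x ∈ capTriangle h V}

theorem shear_mem_capTriangle {h V : ℝ} (hh : 1 < h) (t : ℝ) {x : ℝ × ℝ}
    (hx : x ∈ capTriangle h V) : shear (bend h) t x ∈ capTriangle h (V + t) := by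
  obtain ⟨h1, h2, h3, h4⟩ := hx
  have hh' : h - 1 ≠ 0 := by linarith
  have e : t * ((x.2 - 1) / (h - 1)) * (h - 1) = t * (x.2 - 1) := by field_simp
  simp only [capTriangle, shear, mem_ofPred_eq, bend_of_one_le h1]
  refine ⟨h1, h2, ?_, ?_⟩ <;> nlinarith

theorem shear_neg {α : ℝ → ℝ} (hodd : ∀ s, α (-s) = -α s) (t : ℝ) (x : ℝ × ℝ) :
    shear α t (-x) = -shear α t x := by
  ext
  · simp [shear, hodd]; ring
  · simp [shear]

theorem shear_mem_capped {C : Set (ℝ × ℝ)} (hC : ∀ x ∈ C, |x.2| ≤ 1) {h V : ℝ} (hh : 1 < h)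
    (t : ℝ) {x : ℝ × ℝ} (hx : x ∈ capped C h V) : shear (bend h) t x ∈ capped C h (V + t) := by
  rcases hx with hx | hx | hx
  · left
    have : shear (bend h) t x = x := by ext <;> simp [shear, bend_of_abs_le (hC x hx)]
    rwa [this]
  · exact Or.inr (Or.inl (shear_mem_capTriangle hh t hx))
  · right; right
    rw [← shear_neg (bend_neg h)]
    exact shear_mem_capTriangle hh t hx

theorem shear_image_capped {C : Set (ℝ × ℝ)} (hC : ∀ x ∈ C, |x.2| ≤ 1) {h V : ℝ} (hh : 1 < h)
    (t : ℝ) : shear (bend h) t '' capped C h V = capped C h (V + t) := by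
  ext x
  constructor
  · rintro ⟨y, hy, rfl⟩
    exact shear_mem_capped hC hh t hy
  · intro hx
    refine ⟨shear (bend h) (-t) x, ?_, by simpa using shear_neg_shear (bend h) (-t) x⟩
    simpa using shear_mem_capped hC hh (-t) hx

theorem neg_mem_convexHull {F : Set (ℝ × ℝ)} (hF : ∀ x ∈ F, -x ∈ F) {x : ℝ × ℝ}
    (hx : x ∈ convexHull ℝ F) : -x ∈ convexHull ℝ F := by
  have h : -F = F := by
    ext y
    exact ⟨fun hy => by simpa using hF _ hy, fun hy => hF y hy⟩
  have h2 := convexHull_neg (𝕜 := ℝ) F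
  rw [h] at h2
  rw [h2] at hx
  exact hx

theorem capTriangle_subset {Q : Set (ℝ × ℝ)} (hQ : Convex ℝ Q) {h V : ℝ} (hh : 1 < h)
    (hw : ((1, 1) : ℝ × ℝ) ∈ Q) (hw' : ((-1, 1) : ℝ × ℝ) ∈ Q) (hv : (V, h) ∈ Q) :
    capTriangle h V ⊆ Q := by
  rintro ⟨x₁, x₂⟩ ⟨h1, h2, h3, h4⟩
  dsimp only at h1 h2 h3 h4
  have hh' : 0 < h - 1 := by linarith
  set a := (x₂ - 1) / (h - 1) with ha
  have hah : a * (h - 1) = x₂ - 1 := by rw [ha]; field_simp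
  have ha0 : 0 ≤ a := div_nonneg (by linarith) hh'.le
  have hb : 0 ≤ ((1 - a) + (x₁ - a * V)) / 2 := by
    refine nonneg_of_mul_nonneg_left (b := 2 * (h - 1)) ?_ (by linarith)
    have : ((1 - a) + (x₁ - a * V)) / 2 * (2 * (h - 1)) =
        (x₁ + 1) * (h - 1) - (V + 1) * (x₂ - 1) := by linear_combination (-1 - V) * hah
    linarith
  have hc : 0 ≤ ((1 - a) - (x₁ - a * V)) / 2 := by
    refine nonneg_of_mul_nonneg_left (b := 2 * (h - 1)) ?_ (by linarith)
    have : ((1 - a) - (x₁ - a * V)) / 2 * (2 * (h - 1)) =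
        (V - 1) * (x₂ - 1) - (x₁ - 1) * (h - 1) := by linear_combination (V - 1) * hah
    linarith
  have hconv := hQ.sum_mem (t := Finset.univ)
    (w := ![a, ((1 - a) + (x₁ - a * V)) / 2, ((1 - a) - (x₁ - a * V)) / 2])
    (z := ![(V, h), (1, 1), (-1, 1)])
    (by intro i _; fin_cases i <;> simpa)
    (by simp [Fin.sum_univ_three]; ring)
    (by intro i _; fin_cases i <;> simpa)
  convert hconv using 1
  ext
  · simp [Fin.sum_univ_three]; ring
  · simp [Fin.sum_univ_three]; linarith

/-- Clipping a segment to a horizontal strip. -/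
theorem exists_clip {Q C : Set (ℝ × ℝ)} (hQ : Convex ℝ Q)
    (hlev : ∀ x ∈ Q, |x.2| = 1 → x ∈ C) {x y : ℝ × ℝ} (hx : x ∈ Q) (hx1 : |x.2| ≤ 1) (hy : y ∈ Q)
    (hyC : |y.2| ≤ 1 → y ∈ C) : ∃ s : ℝ, 0 ≤ s ∧ x + s • (y - x) ∈ C := by
  by_cases h : |y.2| ≤ 1
  · exact ⟨1, zero_le_one, by simpa using hyC h⟩
  have key : ∀ s : ℝ, 0 ≤ s → s ≤ 1 → x + s • (y - x) ∈ Q := fun s h0 h1 =>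
    hQ.add_smul_sub_mem hx hy ⟨h0, h1⟩
  rw [abs_le] at hx1 h
  rcases lt_or_ge 1 y.2 with h1 | h1
  · have hd : 0 < y.2 - x.2 := by linarith
    refine ⟨(1 - x.2) / (y.2 - x.2), div_nonneg (by linarith) hd.le, hlev _ (key _
      (div_nonneg (by linarith) hd.le) ((div_le_one hd).2 (by linarith))) ?_⟩
    have : (x + ((1 - x.2) / (y.2 - x.2)) • (y - x)).2 = 1 := by
      simp only [Prod.snd_add, Prod.smul_snd, Prod.snd_sub, smul_eq_mul]
      field_simp
      ring
    rw [this, abs_one]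
  · have h2 : y.2 < -1 := by
      by_contra h3
      exact h ⟨not_lt.1 h3, h1⟩
    have hd : 0 < x.2 - y.2 := by linarith
    refine ⟨(1 + x.2) / (x.2 - y.2), div_nonneg (by linarith) hd.le, hlev _ (key _
      (div_nonneg (by linarith) hd.le) ((div_le_one hd).2 (by linarith))) ?_⟩
    have : (x + ((1 + x.2) / (x.2 - y.2)) • (y - x)).2 = -1 := by
      simp only [Prod.snd_add, Prod.smul_snd, Prod.snd_sub, smul_eq_mul]
      field_simp
      ring
    rw [this, abs_neg, abs_one]

theorem convex_strip_mem {Q C : Set (ℝ × ℝ)} (hQ : Convex ℝ Q) (hC : Convex ℝ C)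
    (hlev : ∀ x ∈ Q, |x.2| = 1 → x ∈ C) : Convex ℝ {x | x ∈ Q ∧ (|x.2| ≤ 1 → x ∈ C)} := by
  rintro y ⟨hy, hyC⟩ u ⟨hu, huC⟩ a b ha hb hab
  have hxQ := hQ hy hu ha hb hab
  set x := a • y + b • u with hx
  refine ⟨hxQ, fun hx1 => ?_⟩
  obtain ⟨s, hs, hsC⟩ := exists_clip hQ hlev hxQ hx1 hy hyC
  obtain ⟨r, hr, hrC⟩ := exists_clip hQ hlev hxQ hx1 hu huC
  rcases hs.eq_or_lt with rfl | hs
  · simpa using hsC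
  rcases hr.eq_or_lt with rfl | hr
  · simpa using hrC
  have hk : 0 < a * r + b * s := by
    rcases ha.eq_or_lt with rfl | ha
    · have : b = 1 := by linarith
      subst this
      linarith
    · have := mul_pos ha hr
      have := mul_nonneg hb hs.le
      linarith
  have h := hC hsC hrC (a := a * r / (a * r + b * s)) (b := b * s / (a * r + b * s))
    (by positivity) (by positivity) (by field_simp)
  convert h using 1
  have e : a • (y - x) + b • (u - x) = 0 := by
    rw [smul_sub, smul_sub, sub_add_sub_comm, ← hx, ← add_smul, hab, one_smul, sub_self]
  have e2 : (a * r / (a * r + b * s)) • (x + s • (y - x)) +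
      (b * s / (a * r + b * s)) • (x + r • (u - x)) =
      (a * r / (a * r + b * s) + b * s / (a * r + b * s)) • x +
      (r * s / (a * r + b * s)) • (a • (y - x) + b • (u - x)) := by
    module
  rw [e2, e, smul_zero, add_zero, ← add_div, div_self hk.ne', one_smul]

theorem convexHull_eq_capped {F C : Set (ℝ × ℝ)} {h V : ℝ} (hh : 1 < h) (hC : Convex ℝ C)
    (hCs : ∀ x ∈ C, -x ∈ C) (hC1 : ∀ x ∈ C, |x.2| ≤ 1) (hw : ((1, 1) : ℝ × ℝ) ∈ C)
    (hw' : ((-1, 1) : ℝ × ℝ) ∈ C) (hCF : C ⊆ convexHull ℝ F) (hFs : ∀ x ∈ F, -x ∈ F)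
    (hFC : ∀ x ∈ F, x = (V, h) ∨ x = -(V, h) ∨ x ∈ C) (hv : (V, h) ∈ F)
    (hl : ∀ x ∈ F, (V + 1) * (x.2 - 1) ≤ (x.1 + 1) * (h - 1))
    (hr : ∀ x ∈ F, (x.1 - 1) * (h - 1) ≤ (V - 1) * (x.2 - 1)) :
    convexHull ℝ F = capped C h V := by
  have hconv := convex_convexHull ℝ F
  have hHl : ∀ x ∈ convexHull ℝ F, (V + 1) * (x.2 - 1) ≤ (x.1 + 1) * (h - 1) := by
    refine convexHull_min (t := {x : ℝ × ℝ | (V + 1) * (x.2 - 1) ≤ (x.1 + 1) * (h - 1)}) (fun x hx => hl x hx) ?_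
    intro x hx y hy a b ha hb hab
    simp only [mem_ofPred_eq, Prod.fst_add, Prod.smul_fst, Prod.snd_add, Prod.smul_snd,
      smul_eq_mul] at *
    obtain rfl : b = 1 - a := by linarith
    nlinarith [mul_le_mul_of_nonneg_left hx ha, mul_le_mul_of_nonneg_left hy hb]
  have hHr : ∀ x ∈ convexHull ℝ F, (x.1 - 1) * (h - 1) ≤ (V - 1) * (x.2 - 1) := by
    refine convexHull_min (t := {x : ℝ × ℝ | (x.1 - 1) * (h - 1) ≤ (V - 1) * (x.2 - 1)}) (fun x hx => hr x hx) ?_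
    intro x hx y hy a b ha hb hab
    simp only [mem_ofPred_eq, Prod.fst_add, Prod.smul_fst, Prod.snd_add, Prod.smul_snd,
      smul_eq_mul] at *
    obtain rfl : b = 1 - a := by linarith
    nlinarith [mul_le_mul_of_nonneg_left hx ha, mul_le_mul_of_nonneg_left hy hb]
  have hHh : ∀ x ∈ convexHull ℝ F, x.2 ≤ h := by
    refine convexHull_min (t := {x : ℝ × ℝ | x.2 ≤ h}) ?_ ?_
    · intro x hx
      rcases hFC x hx with rfl | rfl | hx
      · exact le_refl h
      · simp only [mem_ofPred_eq, Prod.snd_neg]; linarith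
      · have := (abs_le.1 (hC1 x hx)).2
        simp only [mem_ofPred_eq]; linarith
    · intro x hx y hy a b ha hb hab
      simp only [mem_ofPred_eq, Prod.snd_add, Prod.smul_snd, smul_eq_mul] at *
      obtain rfl : b = 1 - a := by linarith
      nlinarith [mul_le_mul_of_nonneg_left hx ha, mul_le_mul_of_nonneg_left hy hb]
  have hneg : ∀ x ∈ convexHull ℝ F, -x ∈ convexHull ℝ F := fun x => neg_mem_convexHull hFs
  have hlev1 : ∀ x ∈ convexHull ℝ F, x.2 = 1 → x ∈ C := by
    rintro ⟨x₁, x₂⟩ hx rfl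
    have h1 := hHl _ hx
    have h2 := hHr _ hx
    simp only [sub_self, mul_zero] at h1 h2
    have h3 : 0 ≤ x₁ + 1 := nonneg_of_mul_nonneg_left h1 (by linarith)
    have h4 : x₁ - 1 ≤ 0 := by
      by_contra h5
      exact absurd h2 (not_le.2 (mul_pos (not_le.1 h5) (by linarith)))
    have := hC hw hw' (a := (1 + x₁) / 2) (b := (1 - x₁) / 2) (by linarith) (by linarith) (by ring)
    convert this using 1
    ext
    · simp; ring
    · simp; ring
  have hlev : ∀ x ∈ convexHull ℝ F, |x.2| = 1 → x ∈ C := by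
    intro x hx h1
    rcases (abs_eq zero_le_one).1 h1 with h1 | h1
    · exact hlev1 x hx h1
    · have := hCs _ (hlev1 (-x) (hneg x hx) (by simp [h1]))
      simpa using this
  have hstrip : convexHull ℝ F ⊆ {x | x ∈ convexHull ℝ F ∧ (|x.2| ≤ 1 → x ∈ C)} := by
    refine convexHull_min (fun x hx => ⟨subset_convexHull ℝ F hx, fun h1 => ?_⟩)
      (convex_strip_mem hconv hC hlev)
    rcases hFC x hx with rfl | rfl | hx
    · exact absurd (abs_le.1 h1).2 (by simpa using hh)
    · have := (abs_le.1 h1).1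
      simp only [Prod.snd_neg] at this
      linarith
    · exact hx
  have htri : capTriangle h V ⊆ convexHull ℝ F :=
    capTriangle_subset hconv hh (hCF hw) (hCF hw') (subset_convexHull ℝ F hv)
  refine Subset.antisymm (fun x hx => ?_) ?_
  · by_cases h1 : |x.2| ≤ 1
    · exact Or.inl ((hstrip hx).2 h1)
    rcases lt_or_ge 1 x.2 with h2 | h2
    · exact Or.inr (Or.inl ⟨h2.le, hHh x hx, hHl x hx, hHr x hx⟩)
    · have h3 : 1 ≤ (-x).2 := by
        by_contra h4
        simp only [Prod.snd_neg, not_le] at h4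
        exact h1 (abs_le.2 ⟨by linarith, h2⟩)
      exact Or.inr (Or.inr ⟨h3, hHh _ (hneg x hx), hHl _ (hneg x hx), hHr _ (hneg x hx)⟩)
  · rintro x (hx | hx | hx)
    · exact hCF hx
    · exact htri hx
    · simpa using hneg _ (htri hx)

theorem mem_extremePoints_of_strict_min {F : Set (ℝ × ℝ)} {e : ℝ × ℝ} (he : e ∈ F) (a b : ℝ)
    (h : ∀ x ∈ F, x ≠ e → a * e.1 + b * e.2 < a * x.1 + b * x.2) :
    e ∈ extremePoints ℝ (convexHull ℝ F) := by
  have hsub : convexHull ℝ F ⊆ {x : ℝ × ℝ | x = e ∨ a * e.1 + b * e.2 < a * x.1 + b * x.2} := by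
    refine convexHull_min (fun x hx => ?_) ?_
    · by_cases hxe : x = e
      · exact Or.inl hxe
      · exact Or.inr (h x hx hxe)
    · rw [convex_iff_pairwise_pos]
      rintro x hx y hy - s t hs ht hst
      obtain rfl : t = 1 - s := by linarith
      rcases hx with rfl | hx <;> rcases hy with rfl | hy
      · left
        rw [← add_smul, hst, one_smul]
      all_goals
        right
        simp only [Prod.fst_add, Prod.smul_fst, Prod.snd_add, Prod.smul_snd, smul_eq_mul] at *
        nlinarith
  rw [(convex_convexHull ℝ F).mem_extremePoints_iff_mem_sdiff_convexHull_sdiff]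
  refine ⟨subset_convexHull ℝ F he, fun hcon => ?_⟩
  have hmin : convexHull ℝ (convexHull ℝ F \ {e}) ⊆
      {x : ℝ × ℝ | a * e.1 + b * e.2 < a * x.1 + b * x.2} := by
    refine convexHull_min (fun x hx => (hsub hx.1).resolve_left hx.2) ?_
    intro x hx y hy s t hs ht hst
    simp only [mem_ofPred_eq, Prod.fst_add, Prod.smul_fst, Prod.snd_add, Prod.smul_snd,
      smul_eq_mul] at *
    obtain rfl : t = 1 - s := by linarith
    rcases hs.eq_or_lt with rfl | hs
    · simpa using hy
    · nlinarith [mul_lt_mul_of_pos_left hx hs, mul_le_mul_of_nonneg_left hy.le ht]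
  exact lt_irrefl (a * e.1 + b * e.2) (hmin hcon)

/-- Extremality is a local property. -/
theorem mem_extremePoints_of_strip {Q Q' : Set (ℝ × ℝ)} (hQ' : Convex ℝ Q')
    (hsub : ∀ x ∈ Q', |x.2| ≤ 1 → x ∈ Q) {e : ℝ × ℝ} (he : e ∈ extremePoints ℝ Q) (he' : e ∈ Q')
    (he1 : |e.2| < 1) : e ∈ extremePoints ℝ Q' := by
  rw [mem_extremePoints_iff_left] at he ⊢
  refine ⟨he', fun x hx y hy hxy => ?_⟩
  obtain ⟨a, b, ha, hb, hab, rfl⟩ := hxy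
  set e := a • x + b • y with hedef
  have hnear : ∀ z : ℝ × ℝ, ∀ᶠ s : ℝ in nhdsWithin 0 (Ioi 0), |(e + s • (z - e)).2| < 1 := by
    intro z
    have hc : ContinuousAt (fun s : ℝ => |(e + s • (z - e)).2|) 0 := by fun_prop
    refine (hc.eventually_lt_const ?_).filter_mono nhdsWithin_le_nhds
    simpa using he1
  have hlt : ∀ᶠ s : ℝ in nhdsWithin 0 (Ioi 0), s < 1 :=
    (eventually_lt_nhds zero_lt_one).filter_mono nhdsWithin_le_nhds
  obtain ⟨s, ⟨⟨hsx, hsy⟩, hs1⟩, hs0⟩ :=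
    (((hnear x).and (hnear y)).and hlt).and (eventually_mem_nhdsWithin) |>.exists
  rw [mem_Ioi] at hs0
  have hmem : ∀ z ∈ Q', |(e + s • (z - e)).2| < 1 → e + s • (z - e) ∈ Q := fun z hz h1 =>
    hsub _ (hQ'.add_smul_sub_mem he' hz ⟨hs0.le, hs1.le⟩) h1.le
  have h := he.2 _ (hmem x hx hsx) _ (hmem y hy hsy) ⟨a, b, ha, hb, hab, by
    have : a • (e + s • (x - e)) + b • (e + s • (y - e)) =
      (a + b) • ((1 - s) • e) + s • (a • x + b • y) := by module
    rw [this, ← hedef, hab, one_smul, ← add_smul, sub_add_cancel, one_smul]⟩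
  have h2 : s • (x - e) = 0 := by simpa using h
  exact sub_eq_zero.1 ((smul_eq_zero.1 h2).resolve_left hs0.ne')

/-- A symmetric vertex set with a distinguished vertex `v`, normalised so that the neighbours of
`v` are `(1, 1)` and `(-1, 1)`. -/
structure IsNormalised (E : Set (ℝ × ℝ)) (v : ℝ × ℝ) : Prop where
  finite : E.Finite
  neg_mem : ∀ x ∈ E, -x ∈ E
  extreme : extremePoints ℝ (convexHull ℝ E) = E
  right_mem : (1, 1) ∈ E
  left_mem : (-1, 1) ∈ E
  apex_mem : v ∈ E
  one_lt : 1 < v.2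
  le_one : ∀ x ∈ E, x ≠ v → x.2 ≤ 1
  left : ∀ x ∈ E, (v.1 + 1) * (x.2 - 1) ≤ (x.1 + 1) * (v.2 - 1)
  right : ∀ x ∈ E, (x.1 - 1) * (v.2 - 1) ≤ (v.1 - 1) * (x.2 - 1)

namespace IsNormalised

variable {E : Set (ℝ × ℝ)} {v : ℝ × ℝ}

theorem abs_snd_le (H : IsNormalised E v) {x : ℝ × ℝ} (hx : x ∈ E) (h1 : x ≠ v) (h2 : x ≠ -v) :
    |x.2| ≤ 1 := by
  refine abs_le.2 ⟨?_, H.le_one x hx h1⟩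
  have := H.le_one (-x) (H.neg_mem x hx) (fun h => h2 (by rw [← h, neg_neg]))
  simp only [Prod.snd_neg] at this
  linarith

theorem neg_one_le (H : IsNormalised E v) : -1 ≤ v.1 := by
  have := H.left _ (H.neg_mem _ H.right_mem)
  simp only [Prod.fst_neg, Prod.snd_neg] at this
  linarith

/-- The position of the apex when the right-hand neighbour becomes degenerate. -/
theorem exists_apex (H : IsNormalised E v) : ∃ V, v.1 < V ∧ V ≤ 1 ∧
    (∀ x ∈ E, x ≠ v → (x.1 - 1) * (v.2 - 1) ≤ (V - 1) * (x.2 - 1)) ∧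
    ∃ u ∈ E, u.2 < 1 ∧ u ≠ -v ∧ (u.1 - 1) * (v.2 - 1) = (V - 1) * (u.2 - 1) := by
  have hh := H.one_lt
  have hh' : 0 < v.2 - 1 := by linarith
  have hv1 := H.neg_one_le
  set T : Set (ℝ × ℝ) := {x | x ∈ E ∧ x.2 < 1 ∧ x ≠ -v} with hT
  have hTfin : T.Finite := H.finite.subset fun x hx => hx.1
  have hmem : ((1, -1) : ℝ × ℝ) ∈ T := by
    refine ⟨by simpa using H.neg_mem _ H.left_mem, by norm_num, fun h => ?_⟩
    have := congrArg Prod.snd h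
    simp only [Prod.snd_neg] at this
    linarith
  obtain ⟨u, hu, hmin⟩ := exists_min_image T
    (fun x => (1 - x.1) * (v.2 - 1) / (1 - x.2)) hTfin ⟨_, hmem⟩
  set μ := (1 - u.1) * (v.2 - 1) / (1 - u.2) with hμ
  have hu2 : 0 < 1 - u.2 := by linarith [hu.2.1]
  have hμu : μ * (1 - u.2) = (1 - u.1) * (v.2 - 1) := by rw [hμ]; field_simp
  have hμ0 : μ ≤ 0 := by simpa using hmin _ hmem
  have hlt : v.1 < 1 + μ := by
    have h1 := H.right u hu.1
    by_contra hcon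
    have h2 : μ = v.1 - 1 := by nlinarith
    have hw := H.extreme.symm ▸ H.right_mem
    rw [mem_extremePoints_iff_left] at hw
    have h3 := hw.2 v (subset_convexHull ℝ E H.apex_mem) u (subset_convexHull ℝ E hu.1)
      ⟨(1 - u.2) / (v.2 - u.2), (v.2 - 1) / (v.2 - u.2), div_pos hu2 (by linarith),
        div_pos hh' (by linarith), by
          have : v.2 - u.2 ≠ 0 := by linarith
          field_simp
          ring, by
          have : v.2 - u.2 ≠ 0 := by linarith
          rw [h2] at hμu
          ext
          · simp only [Prod.fst_add, Prod.smul_fst, smul_eq_mul]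
            field_simp
            linarith
          · simp only [Prod.snd_add, Prod.smul_snd, smul_eq_mul]
            field_simp
            ring⟩
    rw [h3] at hh
    exact lt_irrefl _ hh
  refine ⟨1 + μ, hlt, by linarith, fun x hx hxv => ?_, u, hu.1, hu.2.1, hu.2.2, by
    linarith⟩
  by_cases hxv' : x = -v
  · subst hxv'
    simp only [Prod.fst_neg, Prod.snd_neg]
    nlinarith
  rcases (H.le_one x hx hxv).lt_or_eq with h1 | h1
  · have h2 := hmin x ⟨hx, h1, hxv'⟩
    rw [le_div_iff₀ (by linarith)] at h2
    linarith
  · have := H.right x hx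
    rw [h1, sub_self, mul_zero] at this ⊢
    exact this

end IsNormalised

namespace IsNormalised

variable {E : Set (ℝ × ℝ)} {v : ℝ × ℝ}

theorem exists_shear (H : IsNormalised E v) {m : ℕ} (hcard : E.ncard = 2 * m)
    (hInt : (interior (convexHull ℝ E)).Nonempty) :
    ∃ t > 0, IsPolytopeWith (2 * m - 2) (shear (bend v.2) t '' convexHull ℝ E) ∧
      shear (bend v.2) t '' convexHull ℝ E = -(shear (bend v.2) t '' convexHull ℝ E) := by
  obtain ⟨V, hvV, hV1, hVr, u, huE, hu1, huv, hu⟩ := H.exists_apex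
  have hh := H.one_lt
  have hh' : 0 < v.2 - 1 := by linarith
  have hv1 := H.neg_one_le
  set C := convexHull ℝ (E \ {v, -v}) with hC
  set P : ℝ × ℝ := (V, v.2) with hP
  set E' : Set (ℝ × ℝ) := insert P (insert (-P) (E \ {v, -v, (1, 1), -(1, 1)})) with hE'
  have hCconv : Convex ℝ C := convex_convexHull ℝ _
  have hC1 : ∀ x ∈ C, |x.2| ≤ 1 := by
    have : C ⊆ {x : ℝ × ℝ | |x.2| ≤ 1} := by
      refine convexHull_min (fun x hx => ?_) ?_
      · exact H.abs_snd_le hx.1 (fun h => hx.2 (by simp [h])) (fun h => hx.2 (by simp [h]))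
      · intro x hx y hy s t hs ht hst
        simp only [mem_ofPred_eq, Prod.snd_add, Prod.smul_snd, smul_eq_mul, abs_le] at *
        obtain rfl : t = 1 - s := by linarith
        constructor <;> nlinarith
    exact fun x hx => this hx
  have hCs : ∀ x ∈ C, -x ∈ C := fun x hx => by
    refine neg_mem_convexHull (F := E \ {v, -v}) (fun y hy => ?_) hx
    refine ⟨H.neg_mem y hy.1, fun h => hy.2 ?_⟩
    rcases h with h | h
    · right
      rw [← h, neg_neg]
      rfl
    · left
      simpa using h
  have ne_of_abs : ∀ x : ℝ × ℝ, |x.2| ≤ 1 → x ≠ v ∧ x ≠ -v := by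
    intro x hx
    rw [abs_le] at hx
    constructor
    · rintro rfl
      linarith
    · rintro rfl
      simp only [Prod.snd_neg] at hx
      linarith
  have hEC : ∀ x ∈ E, |x.2| ≤ 1 → x ∈ C := fun x hx h1 =>
    subset_convexHull ℝ _ ⟨hx, by simpa using ne_of_abs x h1⟩
  have hwC : ((1, 1) : ℝ × ℝ) ∈ C := hEC _ H.right_mem (by simp)
  have hwC' : ((-1, 1) : ℝ × ℝ) ∈ C := hEC _ H.left_mem (by simp)
  have hS : convexHull ℝ E = capped C v.2 v.1 := by
    refine convexHull_eq_capped hh hCconv hCs hC1 hwC hwC' (convexHull_mono sdiff_subset) H.neg_mem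
      (fun x hx => ?_) H.apex_mem H.left H.right
    by_cases h1 : x = v
    · exact Or.inl h1
    by_cases h2 : x = -v
    · exact Or.inr (Or.inl h2)
    exact Or.inr (Or.inr (hEC x hx (H.abs_snd_le hx h1 h2)))
  have hmemE' : ∀ x ∈ E, |x.2| ≤ 1 → x ≠ (1, 1) → x ≠ -(1, 1) → x ∈ E' := fun x hx h1 h2 h3 => by
    refine Or.inr (Or.inr ⟨hx, ?_⟩)
    simp only [mem_insert_iff, mem_singleton_iff, not_or]
    exact ⟨(ne_of_abs x h1).1, (ne_of_abs x h1).2, h2, h3⟩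
  have hE'mem : ∀ x ∈ E', x = P ∨ x = -P ∨
      (x ∈ E ∧ |x.2| ≤ 1 ∧ x ≠ (1, 1) ∧ x ≠ -(1, 1)) := by
    rintro x (hx | hx | hx)
    · exact Or.inl hx
    · exact Or.inr (Or.inl hx)
    · obtain ⟨hx, hx'⟩ := hx
      simp only [mem_insert_iff, mem_singleton_iff, not_or] at hx'
      exact Or.inr (Or.inr ⟨hx, H.abs_snd_le hx hx'.1 hx'.2.1, hx'.2.2⟩)
  have hE's : ∀ x ∈ E', -x ∈ E' := by
    intro x hx
    rcases hE'mem x hx with rfl | rfl | ⟨h1, h2, h3, h4⟩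
    · exact Or.inr (Or.inl rfl)
    · exact Or.inl (neg_neg P)
    · refine hmemE' _ (H.neg_mem x h1) (by simpa using h2) (fun h => h4 ?_) (fun h => h3 ?_)
      · rw [← h, neg_neg]
      · rwa [neg_inj] at h
  have hu2 : |u.2| ≤ 1 := H.abs_snd_le huE (fun h => by rw [h] at hu1; linarith) huv
  have huE' : u ∈ E' := by
    refine hmemE' u huE hu2 (fun h => ?_) (fun h => ?_)
    · rw [h] at hu1
      exact lt_irrefl _ hu1
    · rw [h] at hu
      simp only [Prod.fst_neg, Prod.snd_neg] at hu
      nlinarith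
  have hwE' : ((1, 1) : ℝ × ℝ) ∈ convexHull ℝ E' := by
    refine convex_convexHull ℝ E' |>.segment_subset (subset_convexHull ℝ E' (mem_insert P _))
      (subset_convexHull ℝ E' huE') ?_
    have hne : v.2 - u.2 ≠ 0 := by linarith
    refine ⟨(1 - u.2) / (v.2 - u.2), (v.2 - 1) / (v.2 - u.2), div_nonneg (by linarith)
      (by linarith), div_nonneg (by linarith) (by linarith), by field_simp; ring, ?_⟩
    ext
    · simp only [hP, Prod.fst_add, Prod.smul_fst, smul_eq_mul]
      field_simp
      linarith
    · simp only [hP, Prod.snd_add, Prod.smul_snd, smul_eq_mul]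
      field_simp
      ring
  have hCE' : C ⊆ convexHull ℝ E' := by
    refine convexHull_min (fun x hx => ?_) (convex_convexHull ℝ E')
    have h1 := H.abs_snd_le hx.1 (fun h => hx.2 (by simp [h])) (fun h => hx.2 (by simp [h]))
    by_cases h2 : x = (1, 1)
    · rw [h2]
      exact hwE'
    by_cases h3 : x = -(1, 1)
    · rw [h3]
      exact neg_mem_convexHull hE's hwE'
    exact subset_convexHull ℝ E' (hmemE' x hx.1 h1 h2 h3)
  have hS' : convexHull ℝ E' = capped C v.2 V := by
    refine convexHull_eq_capped hh hCconv hCs hC1 hwC hwC' hCE' hE's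
      (fun x hx => (hE'mem x hx).imp_right (Or.imp_right fun h => hEC x h.1 h.2.1))
      (mem_insert P _) (fun x hx => ?_) (fun x hx => ?_)
    · rcases hE'mem x hx with rfl | rfl | ⟨h1, h2, -⟩
      · exact le_of_eq (by ring)
      · simp only [hP, Prod.fst_neg, Prod.snd_neg]
        nlinarith
      · have := H.left x h1
        nlinarith [(abs_le.1 h2).2]
    · rcases hE'mem x hx with rfl | rfl | ⟨h1, h2, -⟩
      · exact le_of_eq (by ring)
      · simp only [hP, Prod.fst_neg, Prod.snd_neg]
        nlinarith
      · exact hVr x h1 (ne_of_abs x h2).1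
  have himg : shear (bend v.2) (V - v.1) '' convexHull ℝ E = convexHull ℝ E' := by
    rw [hS, hS', shear_image_capped hC1 hh, add_sub_cancel]
  have hE'fin : E'.Finite := ((H.finite.subset sdiff_subset).insert _).insert _
  have hneg : ∀ {e : ℝ × ℝ}, e ∈ extremePoints ℝ (convexHull ℝ E') →
      -e ∈ extremePoints ℝ (convexHull ℝ E') := by
    intro e he
    rw [mem_extremePoints_iff_left] at he ⊢
    refine ⟨neg_mem_convexHull hE's he.1, fun x hx y hy hxy => ?_⟩
    obtain ⟨a, b, ha, hb, hab, hxy⟩ := hxy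
    have := he.2 (-x) (neg_mem_convexHull hE's hx) (-y) (neg_mem_convexHull hE's hy)
      ⟨a, b, ha, hb, hab, by rw [smul_neg, smul_neg, ← neg_add, hxy, neg_neg]⟩
    rw [← this, neg_neg]
  have hextP : P ∈ extremePoints ℝ (convexHull ℝ E') := by
    refine mem_extremePoints_of_strict_min (mem_insert P _) 0 (-1) fun x hx hxP => ?_
    rcases hE'mem x hx with rfl | rfl | ⟨-, h2, -⟩
    · exact absurd rfl hxP
    · simp only [hP, Prod.fst_neg, Prod.snd_neg]
      linarith
    · have := (abs_le.1 h2).2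
      simp only [hP]
      linarith
  have hextw : ((-1, 1) : ℝ × ℝ) ∈ extremePoints ℝ (convexHull ℝ E') := by
    have hmem : ((-1, 1) : ℝ × ℝ) ∈ E' := by
      refine hmemE' _ H.left_mem (by simp) (fun h => ?_) (fun h => ?_)
      · have := congrArg Prod.fst h
        norm_num at this
      · have := congrArg Prod.snd h
        norm_num at this
    refine mem_extremePoints_of_strict_min hmem (v.2 - 1) (-((v.1 + V) / 2 + 1))
      fun x hx hxw => ?_
    rcases hE'mem x hx with rfl | rfl | ⟨h1, h2, h3, -⟩
    · simp only [hP]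
      nlinarith
    · simp only [hP, Prod.fst_neg, Prod.snd_neg]
      nlinarith
    · have h4 := H.left x h1
      rcases (abs_le.1 h2).2.lt_or_eq with h5 | h5
      · nlinarith
      · have h6 := H.right x h1
        rw [h5, sub_self, mul_zero] at h4 h6
        have h7 : 0 ≤ x.1 + 1 := nonneg_of_mul_nonneg_left h4 hh'
        have h8 : x.1 - 1 ≤ 0 := by
          by_contra h9
          exact absurd h6 (not_le.2 (mul_pos (not_le.1 h9) hh'))
        have h9 : x.1 ≠ -1 := fun h => hxw (Prod.ext h h5)
        have h10 : 0 < x.1 + 1 := lt_of_le_of_ne h7 fun h => h9 (by linarith)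
        have h11 := mul_pos h10 hh'
        rw [h5]
        simp only
        linarith
  have hunit : ∀ x ∈ E, x.2 = 1 → x = (1, 1) ∨ x = (-1, 1) := by
    intro x hx hx2
    have h4 := H.left x hx
    have h6 := H.right x hx
    rw [hx2, sub_self, mul_zero] at h4 h6
    have h7 : 0 ≤ x.1 + 1 := nonneg_of_mul_nonneg_left h4 hh'
    have h8 : x.1 - 1 ≤ 0 := by
      by_contra h9
      exact absurd h6 (not_le.2 (mul_pos (not_le.1 h9) hh'))
    have hxe := H.extreme.symm ▸ hx
    rw [mem_extremePoints] at hxe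
    by_contra! hcon
    have h9 : x.1 ≠ -1 := fun h => hcon.2 (Prod.ext h hx2)
    have h10 : x.1 ≠ 1 := fun h => hcon.1 (Prod.ext h hx2)
    have h11 : 0 < x.1 + 1 := lt_of_le_of_ne h7 fun h => h9 (by linarith)
    have h12 : 0 < 1 - x.1 := lt_of_le_of_ne (by linarith) fun h => h10 (by linarith)
    have := hxe.2 _ (subset_convexHull ℝ E H.right_mem) _ (subset_convexHull ℝ E H.left_mem)
      ⟨(x.1 + 1) / 2, (1 - x.1) / 2, by linarith, by linarith, by ring, by
        ext
        · simp; ring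
        · simp [hx2]; ring⟩
    exact hcon.1 this.1.symm
  have hext : extremePoints ℝ (convexHull ℝ E') = E' := by
    refine Subset.antisymm (extremePoints_convexHull_subset (𝕜 := ℝ) (A := E')) fun e he => ?_
    rcases hE'mem e he with rfl | rfl | ⟨h1, h2, h3, h4⟩
    · exact hextP
    · exact hneg hextP
    · rcases h2.lt_or_eq with h5 | h5
      · refine mem_extremePoints_of_strip (Q := convexHull ℝ E) (convex_convexHull ℝ E') ?_
          (H.extreme.symm ▸ h1) (subset_convexHull ℝ E' he) h5
        intro x hx hx1
        rw [hS'] at hx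
        have := shear_mem_capped hC1 hh (v.1 - V) hx
        rw [add_sub_cancel, ← hS] at this
        convert this using 1
        ext <;> simp [shear, bend_of_abs_le hx1]
      · rcases (abs_eq zero_le_one).1 h5 with h6 | h6
        · rw [(hunit e h1 h6).resolve_left h3]
          exact hextw
        · have h7 := (hunit (-e) (H.neg_mem e h1) (by simp [h6])).resolve_left
            (fun h => h4 (by rw [← h, neg_neg]))
          have h8 := hneg hextw
          rw [← h7, neg_neg] at h8
          exact h8
  have hncard : E'.ncard = 2 * m - 2 := by
    have hvE := H.neg_mem v H.apex_mem
    have hsub : ({v, -v, (1, 1), -(1, 1)} : Set (ℝ × ℝ)) ⊆ E := by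
      simp only [insert_subset_iff, singleton_subset_iff]
      exact ⟨H.apex_mem, hvE, H.right_mem, H.neg_mem _ H.right_mem⟩
    have h4 : ({v, -v, (1, 1), -(1, 1)} : Set (ℝ × ℝ)).ncard = 4 := by
      have h1 := ne_of_abs (1, 1) (by simp)
      have h2 := ne_of_abs (-(1, 1)) (by simp)
      have h3 : v ≠ -v := fun h => by
        have := congrArg Prod.snd h
        simp only [Prod.snd_neg] at this
        linarith
      have h5 : ((1, 1) : ℝ × ℝ) ≠ -(1, 1) := fun h => by
        have := congrArg Prod.snd h
        norm_num at this
      rw [ncard_insert_of_notMem, ncard_insert_of_notMem, ncard_pair h5]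
      · simp only [mem_insert_iff, mem_singleton_iff, not_or]
        exact ⟨h1.2.symm, h2.2.symm⟩
      · simp only [mem_insert_iff, mem_singleton_iff, not_or]
        exact ⟨h3, h1.1.symm, h2.1.symm⟩
    have hP2 : ∀ x ∈ E \ {v, -v, (1, 1), -(1, 1)}, |x.2| ≤ 1 := fun x hx => by
      obtain ⟨hx, hx'⟩ := hx
      simp only [mem_insert_iff, mem_singleton_iff, not_or] at hx'
      exact H.abs_snd_le hx hx'.1 hx'.2.1
    rw [hE', ncard_insert_of_notMem _ ((H.finite.subset sdiff_subset).insert _),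
      ncard_insert_of_notMem _ (H.finite.subset sdiff_subset), ncard_sdiff hsub
        (H.finite.subset hsub), h4, hcard]
    · have := ncard_le_ncard hsub H.finite
      omega
    · intro h
      have := (abs_le.1 (hP2 _ h)).1
      simp only [hP, Prod.snd_neg] at this
      linarith
    · rintro (h | h)
      · have := congrArg Prod.snd h
        simp only [hP, Prod.snd_neg] at this
        linarith
      · have := (abs_le.1 (hP2 _ h)).2
        simp only [hP] at this
        linarith
  refine ⟨V - v.1, by linarith, ⟨?_, ?_, ?_, ?_, ?_⟩, ?_⟩
  · rw [himg]
    exact hE'fin.isCompact_convexHull ℝ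
  · rw [himg]
    exact convex_convexHull ℝ E'
  · obtain ⟨x, hx⟩ := hInt
    refine ⟨shear (bend v.2) (V - v.1) x, mem_interior.2
      ⟨shear (bend v.2) (-(V - v.1)) ⁻¹' interior (convexHull ℝ E), ?_, ?_, ?_⟩⟩
    · intro y hy
      exact ⟨_, interior_subset hy, by simpa using shear_neg_shear (bend v.2) (-(V - v.1)) y⟩
    · exact isOpen_interior.preimage (continuous_shear (continuous_bend v.2) _)
    · rwa [mem_preimage, shear_neg_shear]
  · rw [himg]
    exact ⟨hE'fin.toFinset, by rw [hE'fin.coe_toFinset]⟩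
  · rw [himg, hext, hncard]
  · rw [himg]
    ext x
    rw [Set.mem_neg]
    exact ⟨neg_mem_convexHull hE's, fun h => by simpa using neg_mem_convexHull hE's h⟩

end IsNormalised

/-- The invertible linear map of the plane with matrix `!![a, b; c, d]`. -/
noncomputable def planeEquiv (a b c d : ℝ) (h : a * d - b * c ≠ 0) : (ℝ × ℝ) ≃ₗ[ℝ] (ℝ × ℝ) where
  toFun x := (a * x.1 + b * x.2, c * x.1 + d * x.2)
  invFun y := ((d * y.1 - b * y.2) / (a * d - b * c), (a * y.2 - c * y.1) / (a * d - b * c))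
  map_add' x y := by ext <;> simp <;> ring
  map_smul' r x := by ext <;> simp <;> ring
  left_inv x := by
    ext <;> simp only [div_eq_iff h] <;> ring
  right_inv x := by
    ext <;> simp only [mul_div_assoc', ← add_div, div_eq_iff h] <;> ring

theorem planeEquiv_apply {a b c d : ℝ} (h : a * d - b * c ≠ 0) (x : ℝ × ℝ) :
    planeEquiv a b c d h x = (a * x.1 + b * x.2, c * x.1 + d * x.2) := rfl

theorem det_planeEquiv {a b c d : ℝ} (h : a * d - b * c ≠ 0) :
    ((planeEquiv a b c d h : (ℝ × ℝ) →ₗ[ℝ] (ℝ × ℝ))).det = a * d - b * c := by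
  have : (planeEquiv a b c d h : (ℝ × ℝ) →ₗ[ℝ] (ℝ × ℝ)) =
      Matrix.toLin (Module.Basis.finTwoProd ℝ) (Module.Basis.finTwoProd ℝ) !![a, b; c, d] := by
    rw [Matrix.toLin_finTwoProd]
    ext <;> simp [planeEquiv_apply]
  rw [this, LinearMap.det_toLin, Matrix.det_fin_two_of]

theorem setIntegral_planeEquiv_image {a b c d : ℝ} (h : a * d - b * c ≠ 0) {K : Set (ℝ × ℝ)}
    (hK : MeasurableSet K) (g : ℝ × ℝ → ℝ) :
    ∫ x in planeEquiv a b c d h '' K, g x =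
      |a * d - b * c| * ∫ x in K, g (planeEquiv a b c d h x) := by
  rw [integral_image_eq_integral_abs_det_fderiv_smul volume (f := planeEquiv a b c d h) hK
    (f' := fun _ => ((planeEquiv a b c d h).toContinuousLinearEquiv : (ℝ × ℝ) →L[ℝ] (ℝ × ℝ)))
    (fun x _ => ((planeEquiv a b c d h).toContinuousLinearEquiv.hasFDerivAt).hasFDerivWithinAt)
    (planeEquiv a b c d h).injective.injOn, ← integral_const_mul]
  have : ((planeEquiv a b c d h).toContinuousLinearEquiv : (ℝ × ℝ) →L[ℝ] (ℝ × ℝ)).det =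
      a * d - b * c := det_planeEquiv h
  simp only [this, smul_eq_mul]

theorem volume_planeEquiv_image {a b c d : ℝ} (h : a * d - b * c ≠ 0) (K : Set (ℝ × ℝ)) :
    volume (planeEquiv a b c d h '' K) = ENNReal.ofReal |a * d - b * c| * volume K := by
  have := Measure.addHaar_image_linearMap volume
    (planeEquiv a b c d h : (ℝ × ℝ) →ₗ[ℝ] (ℝ × ℝ)) K
  rwa [det_planeEquiv] at this

theorem suppFn_planeEquiv_image {a b c d : ℝ} (h : a * d - b * c ≠ 0) {K : Set (ℝ × ℝ)}
    (hK : MeasurableSet K) (p : ℝ) (y : ℝ × ℝ) :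
    suppFn p (planeEquiv a b c d h '' K) y =
      suppFn p K (planeEquiv a c b d (by rwa [mul_comm c b]) y) := by
  rw [suppFn, suppFn, setIntegral_planeEquiv_image h hK, volume_planeEquiv_image, ENNReal.toReal_mul,
    ENNReal.toReal_ofReal (abs_nonneg _), mul_div_mul_left _ _ (abs_ne_zero.2 h)]
  congr 4
  ext x
  simp only [planeEquiv_apply]
  ring_nf

theorem mahlerVol_planeEquiv_image {a b c d : ℝ} (h : a * d - b * c ≠ 0) {K : Set (ℝ × ℝ)}
    (hK : MeasurableSet K) (p : ℝ) :
    mahlerVol p (planeEquiv a b c d h '' K) = mahlerVol p K := by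
  have h' : a * d - c * b ≠ 0 := by rwa [mul_comm c b]
  have := setIntegral_planeEquiv_image h' MeasurableSet.univ fun y => Real.exp (-(suppFn p K y))
  rw [image_univ_of_surjective (planeEquiv a c b d h').surjective, setIntegral_univ,
    setIntegral_univ, mul_comm c b] at this
  rw [mahlerVol, mahlerVol, volume_planeEquiv_image, ENNReal.toReal_mul,
    ENNReal.toReal_ofReal (abs_nonneg _), this]
  simp only [suppFn_planeEquiv_image h hK]
  ring

theorem IsPolytopeWith.image {k : ℕ} {Q : Set (ℝ × ℝ)} (hQ : IsPolytopeWith k Q)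
    (L : (ℝ × ℝ) ≃ₗ[ℝ] (ℝ × ℝ)) : IsPolytopeWith k (L '' Q) := by
  classical
  obtain ⟨h1, h2, h3, ⟨F, hF⟩, h5⟩ := hQ
  refine ⟨h1.image L.toContinuousLinearEquiv.continuous, ?_, ?_, ⟨F.image L, ?_⟩, ?_⟩
  · exact h2.linear_image (L : (ℝ × ℝ) →ₗ[ℝ] (ℝ × ℝ))
  · have := L.toContinuousLinearEquiv.toHomeomorph.image_interior Q
    exact (h3.image L).mono this.le
  · rw [Finset.coe_image, hF]
    exact LinearMap.image_convexHull (L : (ℝ × ℝ) →ₗ[ℝ] (ℝ × ℝ)) _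
  · rw [← image_extremePoints, ncard_image_of_injective _ L.injective, h5]

/-- Reflection in the vertical axis. -/
noncomputable def reflectFst : (ℝ × ℝ) ≃ₗ[ℝ] (ℝ × ℝ) := planeEquiv (-1) 0 0 1 (by norm_num)

theorem reflectFst_apply (x : ℝ × ℝ) : reflectFst x = (-x.1, x.2) := by
  simp [reflectFst, planeEquiv_apply]

namespace IsNormalised

variable {E : Set (ℝ × ℝ)} {v : ℝ × ℝ}

theorem reflect (H : IsNormalised E v) : IsNormalised (reflectFst '' E) (reflectFst v) where
  finite := H.finite.image _
  neg_mem := by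
    rintro _ ⟨x, hx, rfl⟩
    exact ⟨-x, H.neg_mem x hx, map_neg _ _⟩
  extreme := by
    have : convexHull ℝ (reflectFst '' E) = reflectFst '' convexHull ℝ E :=
      (LinearMap.image_convexHull (reflectFst : (ℝ × ℝ) →ₗ[ℝ] (ℝ × ℝ)) E).symm
    rw [this, ← image_extremePoints, H.extreme]
  right_mem := ⟨_, H.left_mem, by simp [reflectFst_apply]⟩
  left_mem := ⟨_, H.right_mem, by simp [reflectFst_apply]⟩
  apex_mem := ⟨_, H.apex_mem, rfl⟩
  one_lt := by simpa [reflectFst_apply] using H.one_lt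
  le_one := by
    rintro _ ⟨x, hx, rfl⟩ hne
    simpa [reflectFst_apply] using H.le_one x hx fun h => hne (by rw [h])
  left := by
    rintro _ ⟨x, hx, rfl⟩
    have := H.right x hx
    simp only [reflectFst_apply]
    linarith
  right := by
    rintro _ ⟨x, hx, rfl⟩
    have := H.left x hx
    simp only [reflectFst_apply]
    linarith

theorem exists_polytope (H : IsNormalised E v) {p : ℝ} (hp : 0 < p) {m : ℕ}
    (hcard : E.ncard = 2 * m) (hInt : 0 ∈ interior (convexHull ℝ E)) :
    ∃ S' : Set (ℝ × ℝ), IsPolytopeWith (2 * m - 2) S' ∧ S' = -S' ∧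
      volume S' = volume (convexHull ℝ E) ∧ mahlerVol p S' ≤ mahlerVol p (convexHull ℝ E) := by
  obtain ⟨t₁, ht₁, hpol₁, hsym₁⟩ := H.exists_shear hcard ⟨0, hInt⟩
  have himg : convexHull ℝ (reflectFst '' E) = reflectFst '' convexHull ℝ E :=
    (LinearMap.image_convexHull (reflectFst : (ℝ × ℝ) →ₗ[ℝ] (ℝ × ℝ)) E).symm
  have hInt' : (interior (convexHull ℝ (reflectFst '' E))).Nonempty := by
    rw [himg]
    have := reflectFst.toContinuousLinearEquiv.toHomeomorph.image_interior (convexHull ℝ E)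
    exact (Nonempty.image reflectFst ⟨0, hInt⟩).mono this.le
  obtain ⟨t₀, ht₀, hpol₀, hsym₀⟩ := H.reflect.exists_shear
    (by rw [ncard_image_of_injective _ reflectFst.injective, hcard]) hInt'
  have hrefl : shear (bend v.2) (-t₀) '' convexHull ℝ E = reflectFst ''
      (shear (bend (reflectFst v).2) t₀ '' convexHull ℝ (reflectFst '' E)) := by
    rw [himg, image_image, image_image]
    refine image_congr fun x _ => ?_
    ext
    · simp only [shear, reflectFst_apply]
      ring
    · simp only [shear, reflectFst_apply]
  have hsym : convexHull ℝ E = -convexHull ℝ E := by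
    ext x
    rw [Set.mem_neg]
    exact ⟨neg_mem_convexHull H.neg_mem, fun h => by simpa using neg_mem_convexHull H.neg_mem h⟩
  rcases mahlerVol_shear_le hp (continuous_bend v.2) (bend_neg v.2)
    (H.finite.isCompact_convexHull ℝ) hsym hInt ht₀ ht₁ with h | h
  · refine ⟨_, ?_, ?_, volume_shear_image (continuous_bend v.2) (-t₀) _, h⟩
    · rw [hrefl]
      exact hpol₀.image _
    · rw [hrefl]
      nth_rewrite 1 [hsym₀]
      ext x
      simp only [mem_image, Set.mem_neg]
      constructor
      · rintro ⟨y, hy, rfl⟩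
        exact ⟨-y, hy, map_neg _ _⟩
      · rintro ⟨y, hy, hyx⟩
        exact ⟨-y, by simpa using hy, by rw [map_neg, hyx, neg_neg]⟩
  · exact ⟨_, hpol₁, hsym₁, volume_shear_image (continuous_bend v.2) t₁ _, h⟩

end IsNormalised

/-- The signed area spanned by two vectors of the plane. -/
def cross (x y : ℝ × ℝ) : ℝ := x.1 * y.2 - x.2 * y.1

section Vertices

variable {E : Set (ℝ × ℝ)}

theorem zero_notMem_of_extreme (hneg : ∀ x ∈ E, -x ∈ E)
    (hext : extremePoints ℝ (convexHull ℝ E) = E) (hcard : 1 < E.ncard) :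
    (0 : ℝ × ℝ) ∉ E := by
  intro h0
  obtain ⟨y, hy, hy0⟩ := exists_ne_of_one_lt_ncard hcard 0
  have h := hext.symm ▸ h0
  rw [mem_extremePoints_iff_left] at h
  exact hy0 (h.2 y (subset_convexHull ℝ E hy) (-y) (subset_convexHull ℝ E (hneg y hy))
    ⟨1 / 2, 1 / 2, by norm_num, by norm_num, by norm_num, by module⟩)

theorem not_eq_smul_of_extreme (hneg : ∀ x ∈ E, -x ∈ E)
    (hext : extremePoints ℝ (convexHull ℝ E) = E) {x y : ℝ × ℝ} (hx : x ∈ E) (hy : y ∈ E) {c : ℝ}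
    (hc : |c| < 1) (hxy : x = c • y) : x = y := by
  have h := hext.symm ▸ hx
  rw [mem_extremePoints_iff_left] at h
  rw [abs_lt] at hc
  exact (h.2 y (subset_convexHull ℝ E hy) (-y) (subset_convexHull ℝ E (hneg y hy))
    ⟨(1 + c) / 2, (1 - c) / 2, by linarith, by linarith, by ring, by rw [hxy]; module⟩).symm

theorem eq_or_eq_neg_of_cross_eq_zero (hneg : ∀ x ∈ E, -x ∈ E)
    (hext : extremePoints ℝ (convexHull ℝ E) = E) (h0 : (0 : ℝ × ℝ) ∉ E) {x y : ℝ × ℝ}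
    (hx : x ∈ E) (hy : y ∈ E) (hxy : cross x y = 0) : x = y ∨ x = -y := by
  have hy0 : y ≠ 0 := fun h => h0 (h ▸ hy)
  have hx0 : x ≠ 0 := fun h => h0 (h ▸ hx)
  obtain ⟨c, hc⟩ : ∃ c : ℝ, x = c • y := by
    unfold cross at hxy
    by_cases h1 : y.1 = 0
    · have h2 : y.2 ≠ 0 := fun h => hy0 (Prod.ext h1 h)
      rw [h1, mul_zero, sub_zero] at hxy
      have h3 := (mul_eq_zero.1 hxy).resolve_right h2
      refine ⟨x.2 / y.2, Prod.ext ?_ ?_⟩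
      · simp [h1, h3]
      · simp [h2]
    · refine ⟨x.1 / y.1, Prod.ext ?_ ?_⟩
      · simp [h1]
      · simp only [Prod.smul_snd, smul_eq_mul]
        field_simp
        linarith
  have hc0 : c ≠ 0 := by
    rintro rfl
    exact hx0 (by rw [hc, zero_smul])
  rcases lt_trichotomy |c| 1 with h | h | h
  · exact Or.inl (not_eq_smul_of_extreme hneg hext hx hy h hc)
  · rcases (abs_eq zero_le_one).1 h with rfl | rfl
    · left
      rw [hc, one_smul]
    · right
      rw [hc, neg_smul, one_smul]
  · left
    refine (not_eq_smul_of_extreme hneg hext hy hx (c := c⁻¹) ?_ ?_).symm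
    · rw [abs_inv]
      exact inv_lt_one_of_one_lt₀ h
    · rw [hc, smul_smul, inv_mul_cancel₀ hc0, one_smul]

/-- A vertex of a polygon together with its two neighbours. -/
theorem exists_neighbours (hfin : E.Finite) (hneg : ∀ x ∈ E, -x ∈ E)
    (hext : extremePoints ℝ (convexHull ℝ E) = E) (hcard : 4 < E.ncard) :
    ∃ v ∈ E, ∃ w ∈ E, ∃ w' ∈ E, 0 < cross w w' ∧ 0 < cross (w' - v) (w - v) ∧
      (∀ x ∈ E, x ≠ v → 0 ≤ cross (w - x) (w' - x)) ∧
      (∀ x ∈ E, 0 ≤ cross (w' - v) (x - v)) ∧ ∀ x ∈ E, 0 ≤ cross (x - v) (w - v) := by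
  have h0 := zero_notMem_of_extreme hneg hext (by omega)
  have hcr := fun {x y : ℝ × ℝ} => eq_or_eq_neg_of_cross_eq_zero (x := x) (y := y) hneg hext h0
  obtain ⟨v, hv⟩ : E.Nonempty := nonempty_of_ncard_ne_zero (by omega)
  have hv0 : v ≠ 0 := fun h => h0 (h ▸ hv)
  have hnv : -v ≠ v := fun h => hv0 (by
    ext
    · have := congrArg Prod.fst h; simp only [Prod.fst_neg] at this; simp only [Prod.fst_zero]; linarith
    · have := congrArg Prod.snd h; simp only [Prod.snd_neg] at this; simp only [Prod.snd_zero]; linarith)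
  obtain ⟨f, s, hfv, hfs⟩ : ∃ (f : StrongDual ℝ (ℝ × ℝ)) (s : ℝ), f v < s ∧
      ∀ x ∈ convexHull ℝ (E \ {v}), s < f x := by
    refine geometric_hahn_banach_point_closed (convex_convexHull ℝ _)
      ((hfin.subset sdiff_subset).isClosed_convexHull ℝ) fun hcon => ?_
    have h := hext.symm ▸ hv
    rw [(convex_convexHull ℝ E).mem_extremePoints_iff_mem_sdiff_convexHull_sdiff] at h
    exact h.2 (convexHull_mono (sdiff_subset_sdiff_left (subset_convexHull ℝ E)) hcon)
  set g : ℝ × ℝ := (f (1, 0), f (0, 1)) with hg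
  have hfg : ∀ x : ℝ × ℝ, f x = g.1 * x.1 + g.2 * x.2 := by
    intro x
    have : x = x.1 • ((1, 0) : ℝ × ℝ) + x.2 • ((0, 1) : ℝ × ℝ) := by ext <;> simp
    conv_lhs => rw [this]
    rw [map_add, map_smul, map_smul, smul_eq_mul, smul_eq_mul, mul_comm, mul_comm x.2]
  have hd : ∀ x ∈ E, x ≠ v → 0 < f (x - v) := fun x hx hxv => by
    rw [map_sub]
    linarith [hfs x (subset_convexHull ℝ _ ⟨hx, hxv⟩)]
  have hid : ∀ x y : ℝ × ℝ, f x * cross g y - cross g x * f y = f g * cross x y := by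
    intro x y
    simp only [hfg, cross]
    ring
  have hgpos : 0 < f g := by
    have h1 : 0 ≤ f g := by
      rw [hfg]
      nlinarith [sq_nonneg g.1, sq_nonneg g.2]
    refine lt_of_le_of_ne h1 fun h2 => ?_
    rw [hfg] at h2
    have h3 : g.1 = 0 := by nlinarith [sq_nonneg g.1, sq_nonneg g.2]
    have h4 : g.2 = 0 := by nlinarith [sq_nonneg g.1, sq_nonneg g.2]
    have := hd (-v) (hneg v hv) hnv
    rw [hfg, h3, h4] at this
    linarith
  have hTne : (E \ {v}).Nonempty := ⟨-v, hneg v hv, hnv⟩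
  obtain ⟨w, ⟨hw, hwv⟩, hwmax⟩ := exists_max_image (E \ {v})
    (fun x => cross g (x - v) / f (x - v)) (hfin.subset sdiff_subset) hTne
  obtain ⟨w', ⟨hw', hwv'⟩, hwmin⟩ := exists_min_image (E \ {v})
    (fun x => cross g (x - v) / f (x - v)) (hfin.subset sdiff_subset) hTne
  have hmul : ∀ x ∈ E, x ≠ v → ∀ y ∈ E, y ≠ v →
      cross g (x - v) / f (x - v) ≤ cross g (y - v) / f (y - v) →
      0 ≤ cross (x - v) (y - v) := by
    intro x hx hxv y hy hyv h
    rw [div_le_div_iff₀ (hd x hx hxv) (hd y hy hyv)] at h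
    refine nonneg_of_mul_nonneg_right (a := f g) ?_ hgpos
    rw [← hid]
    linarith
  have hcross0 : ∀ y : ℝ × ℝ, cross (v - v) y = 0 := fun y => by simp [cross]
  have hcross0' : ∀ y : ℝ × ℝ, cross y (v - v) = 0 := fun y => by simp [cross]
  have hd' : ∀ x ∈ E, 0 ≤ cross (w' - v) (x - v) := fun x hx => by
    by_cases hxv : x = v
    · rw [hxv, hcross0']
    · exact hmul _ hw' hwv' x hx hxv (hwmin x ⟨hx, hxv⟩)
  have he' : ∀ x ∈ E, 0 ≤ cross (x - v) (w - v) := fun x hx => by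
    by_cases hxv : x = v
    · rw [hxv, hcross0]
    · exact hmul x hx hxv w hw hwv (hwmax x ⟨hx, hxv⟩)
  have hΔ : 0 < cross (w' - v) (w - v) := by
    refine lt_of_le_of_ne (hd' w hw) fun hcon => ?_
    have hconst : ∀ x ∈ E, x ≠ v →
        cross g (x - v) / f (x - v) = cross g (w - v) / f (w - v) := by
      intro x hx hxv
      have h1 := hid (w' - v) (w - v)
      rw [← hcon, mul_zero] at h1
      have h2 : cross g (w' - v) / f (w' - v) = cross g (w - v) / f (w - v) := by
        rw [div_eq_div_iff (hd _ hw' hwv').ne' (hd _ hw hwv).ne']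
        linarith
      exact le_antisymm (hwmax x ⟨hx, hxv⟩) (h2.symm.le.trans (hwmin x ⟨hx, hxv⟩))
    have hsub : E ⊆ {v, -v} := by
      intro x hx
      by_cases hxv : x = v
      · exact Or.inl hxv
      have h1 := (hconst x hx hxv).trans (hconst (-v) (hneg v hv) hnv).symm
      have h2 := hmul x hx hxv _ (hneg v hv) hnv h1.le
      have h3 := hmul _ (hneg v hv) hnv x hx hxv h1.symm.le
      refine hcr hx hv ?_
      simp only [cross, Prod.fst_sub, Prod.snd_sub, Prod.fst_neg, Prod.snd_neg] at h2 h3 ⊢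
      linarith
    have := (ncard_le_ncard hsub (toFinite _)).trans (ncard_insert_le v {-v})
    rw [ncard_singleton] at this
    omega
  have hc' : ∀ x ∈ E, x ≠ v → 0 ≤ cross (w - x) (w' - x) := by
    intro x hx hxv
    by_contra hcon
    rw [not_le] at hcon
    set A := cross (w' - v) (x - v) with hA
    set B := cross (x - v) (w - v) with hB
    set Δ := cross (w' - v) (w - v) with hΔdef
    have hA0 : 0 ≤ A := hd' x hx
    have hB0 : 0 ≤ B := he' x hx
    have hAB : cross (w - x) (w' - x) = A + B - Δ := by
      simp only [hA, hB, hΔdef, cross, Prod.fst_sub, Prod.snd_sub]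
      ring
    have hrep : Δ • (x - v) = A • (w - v) + B • (w' - v) := by
      ext <;> simp only [hA, hB, hΔdef, cross, Prod.fst_sub, Prod.snd_sub, Prod.smul_fst,
        Prod.smul_snd, Prod.fst_add, Prod.snd_add, smul_eq_mul] <;> ring
    have hABpos : 0 < A + B := by
      refine lt_of_le_of_ne (by linarith) fun h => hxv ?_
      have hA1 : A = 0 := by linarith
      have hB1 : B = 0 := by linarith
      rw [hA1, hB1, zero_smul, zero_smul, add_zero] at hrep
      exact sub_eq_zero.1 ((smul_eq_zero.1 hrep).resolve_left hΔ.ne')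
    have hz : (A / (A + B)) • w + (B / (A + B)) • w' ∈ convexHull ℝ E :=
      convex_convexHull ℝ E (subset_convexHull ℝ E hw) (subset_convexHull ℝ E hw')
        (by positivity) (by positivity) (by field_simp)
    have h := hext.symm ▸ hx
    rw [mem_extremePoints_iff_left] at h
    refine hxv (h.2 v (subset_convexHull ℝ E hv) _ hz ⟨(Δ - (A + B)) / Δ, (A + B) / Δ,
      div_pos (by linarith) hΔ, by positivity, by field_simp; ring, ?_⟩).symm
    have h1 : x = v + Δ⁻¹ • (A • (w - v) + B • (w' - v)) := by
      rw [← hrep, smul_smul, inv_mul_cancel₀ hΔ.ne', one_smul, add_sub_cancel]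
    rw [h1]
    ext <;> simp <;> field_simp <;> ring
  refine ⟨v, hv, w, hw, w', hw', ?_, hΔ, hc', hd', he'⟩
  have h1 := hd' (-w) (hneg w hw)
  have h2 := he' (-w') (hneg w' hw')
  have hκ : 0 ≤ cross w w' := by
    simp only [cross, Prod.fst_sub, Prod.snd_sub, Prod.fst_neg, Prod.snd_neg] at h1 h2 ⊢
    linarith
  refine lt_of_le_of_ne hκ fun hcon => ?_
  rcases hcr hw hw' hcon.symm with h | h
  · rw [h] at hΔ
    simp only [cross] at hΔ
    linarith
  · have hw2 : w' = -w := by rw [h, neg_neg]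
    have hsub : E ⊆ {v, -v, w, -w} := by
      intro x hx
      by_cases hxv : x = v
      · exact Or.inl hxv
      by_cases hxv' : x = -v
      · exact Or.inr (Or.inl hxv')
      refine Or.inr (Or.inr (hcr hx hw ?_))
      have h3 := hc' x hx hxv
      have h4 := hc' (-x) (hneg x hx) fun h => hxv' (by rw [← h, neg_neg])
      rw [hw2] at h3 h4
      simp only [cross, Prod.fst_sub, Prod.snd_sub, Prod.fst_neg, Prod.snd_neg] at h3 h4 ⊢
      linarith
    have h4 : ({v, -v, w, -w} : Set (ℝ × ℝ)).ncard ≤ 4 := by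
      refine (ncard_insert_le _ _).trans (Nat.succ_le_succ ?_)
      refine (ncard_insert_le _ _).trans (Nat.succ_le_succ ?_)
      exact (ncard_insert_le _ _).trans (by rw [ncard_singleton])
    have := (ncard_le_ncard hsub (toFinite _)).trans h4
    omega

end Vertices

/-- A polygon with at least six vertices can be normalised by a linear map. -/
theorem exists_isNormalised_image {E : Set (ℝ × ℝ)} (hfin : E.Finite) (hneg : ∀ x ∈ E, -x ∈ E)
    (hext : extremePoints ℝ (convexHull ℝ E) = E) (hcard : 4 < E.ncard) :
    ∃ (a b c d : ℝ) (h : a * d - b * c ≠ 0) (v : ℝ × ℝ),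
      IsNormalised (planeEquiv a b c d h '' E) v := by
  obtain ⟨v, hv, w, hw, w', hw', hκ, hΔ, hc, hl, hr⟩ := exists_neighbours hfin hneg hext hcard
  set κ := cross w w' with hκdef
  have hdet : (w'.2 + w.2) / κ * ((w.1 - w'.1) / κ) - -(w'.1 + w.1) / κ * ((w'.2 - w.2) / κ) =
      2 / κ := by
    field_simp
    rw [hκdef, cross]
    ring
  have hdet0 : (w'.2 + w.2) / κ * ((w.1 - w'.1) / κ) - -(w'.1 + w.1) / κ * ((w'.2 - w.2) / κ) ≠
      0 := by
    rw [hdet]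
    positivity
  refine ⟨(w'.2 + w.2) / κ, -(w'.1 + w.1) / κ, (w'.2 - w.2) / κ, (w.1 - w'.1) / κ, hdet0, ?_⟩
  set L := planeEquiv _ _ _ _ hdet0 with hL
  have hLx : ∀ x, L x = ((cross x w' - cross w x) / κ, (cross x w' + cross w x) / κ) := by
    intro x
    rw [hL, planeEquiv_apply]
    ext <;> simp only [cross] <;> field_simp <;> ring
  refine ⟨L v, hfin.image _, ?_, ?_, ⟨w, hw, ?_⟩, ⟨w', hw', ?_⟩, ⟨v, hv, rfl⟩, ?_, ?_, ?_, ?_⟩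
  · rintro _ ⟨x, hx, rfl⟩
    exact ⟨-x, hneg x hx, map_neg _ _⟩
  · have : convexHull ℝ (L '' E) = L '' convexHull ℝ E :=
      (LinearMap.image_convexHull (L : (ℝ × ℝ) →ₗ[ℝ] (ℝ × ℝ)) E).symm
    rw [this, ← image_extremePoints, hext]
  · have : cross w w = 0 := by simp only [cross]; ring
    rw [hLx, this, ← hκdef, sub_zero, add_zero, div_self hκ.ne']
  · have : cross w' w' = 0 := by simp only [cross]; ring
    rw [hLx, this, ← hκdef, zero_sub, zero_add, neg_div, div_self hκ.ne']
  · rw [hLx, lt_div_iff₀ hκ, hκdef]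
    simp only [cross, Prod.fst_sub, Prod.snd_sub] at hΔ ⊢
    linarith
  · rintro _ ⟨x, hx, rfl⟩ hne
    have := hc x hx fun h => hne (by rw [h])
    rw [hLx, div_le_iff₀ hκ, hκdef]
    simp only [cross, Prod.fst_sub, Prod.snd_sub] at this ⊢
    linarith
  · rintro _ ⟨x, hx, rfl⟩
    have h1 := hl x hx
    rw [hLx, hLx, ← sub_nonneg]
    have e : ((cross x w' - cross w x) / κ + 1) * ((cross v w' + cross w v) / κ - 1) -
        ((cross v w' - cross w v) / κ + 1) * ((cross x w' + cross w x) / κ - 1) =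
        2 / κ * cross (w' - v) (x - v) := by
      field_simp
      rw [hκdef]
      simp only [cross, Prod.fst_sub, Prod.snd_sub]
      ring
    rw [e]
    positivity
  · rintro _ ⟨x, hx, rfl⟩
    have h1 := hr x hx
    rw [hLx, hLx, ← sub_nonneg]
    have e : ((cross v w' - cross w v) / κ - 1) * ((cross x w' + cross w x) / κ - 1) -
        ((cross x w' - cross w x) / κ - 1) * ((cross v w' + cross w v) / κ - 1) =
        2 / κ * cross (x - v) (w - v) := by
      field_simp
      rw [hκdef]
      simp only [cross, Prod.fst_sub, Prod.snd_sub]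
      ring
    rw [e]
    positivity

/-- Proposition 3.1: a symmetric polytope with `2m > 4` vertices can be
replaced by a symmetric polytope with `2m - 2` vertices of the same area and no larger
`L^p`-Mahler volume. -/
theorem sym_sliding_reduces_mahler (p : ℝ) (hp : 0 < p) (m : ℕ) (hm : 2 * m > 4)
    (S : Set (ℝ × ℝ)) (hS : IsPolytopeWith (2 * m) S) (hsym : S = -S) :
    ∃ S' : Set (ℝ × ℝ), IsPolytopeWith (2 * m - 2) S' ∧ S' = -S' ∧
      volume S' = volume S ∧ mahlerVol p S' ≤ mahlerVol p S := by
  obtain ⟨hcomp, hconv, ⟨x₀, hx₀⟩, -, hcard⟩ := hS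
  set E := extremePoints ℝ S with hE
  have hfin : E.Finite := finite_of_ncard_pos (by omega)
  have hSE : convexHull ℝ E = S := by
    rw [← (hfin.isClosed_convexHull ℝ).closure_eq, hE]
    exact closure_convexHull_extremePoints hcomp hconv
  have hSneg : ∀ x ∈ S, -x ∈ S := fun x hx => by
    rw [hsym, Set.mem_neg, neg_neg]
    exact hx
  have hneg : ∀ x ∈ E, -x ∈ E := by
    intro x hx
    have h : -S = (LinearEquiv.neg ℝ : (ℝ × ℝ) ≃ₗ[ℝ] (ℝ × ℝ)) '' S := by
      rw [← image_neg_eq_neg]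
      rfl
    rw [hE, hsym, h, ← image_extremePoints]
    exact ⟨x, hx, rfl⟩
  have h0 : (0 : ℝ × ℝ) ∈ interior S := by
    have h1 : -x₀ ∈ interior S := mem_interior.2 ⟨-interior S,
      fun x hx => by simpa using hSneg _ (interior_subset hx), isOpen_interior.neg, by simpa⟩
    have := hconv.interior hx₀ h1 (a := 1 / 2) (b := 1 / 2) (by norm_num) (by norm_num)
      (by norm_num)
    simpa using this
  obtain ⟨a, b, c, d, h, v, H⟩ := exists_isNormalised_image hfin hneg (by rw [hSE]) (by omega)
  set L := planeEquiv a b c d h with hL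
  have himg : convexHull ℝ (L '' E) = L '' S := by
    rw [← hSE]
    exact (LinearMap.image_convexHull (L : (ℝ × ℝ) →ₗ[ℝ] (ℝ × ℝ)) E).symm
  have hInt : 0 ∈ interior (convexHull ℝ (L '' E)) := by
    rw [himg]
    have := L.toContinuousLinearEquiv.toHomeomorph.image_interior S
    exact this.le ⟨0, h0, map_zero L⟩
  obtain ⟨T, hT, hTsym, hTvol, hTm⟩ := H.exists_polytope hp
    (by rw [ncard_image_of_injective _ L.injective, hcard]) hInt
  have hLT : L '' (L.symm '' T) = T := by
    rw [image_image]
    simp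
  have hS' : IsPolytopeWith (2 * m - 2) (L.symm '' T) := hT.image L.symm
  refine ⟨L.symm '' T, hS', ?_, ?_, ?_⟩
  · ext x
    simp only [Set.mem_neg, mem_image]
    have hTneg : ∀ y ∈ T, -y ∈ T := fun y hy => by
      rw [hTsym, Set.mem_neg, neg_neg]
      exact hy
    constructor
    · rintro ⟨y, hy, rfl⟩
      exact ⟨-y, hTneg y hy, map_neg _ _⟩
    · rintro ⟨y, hy, hyx⟩
      exact ⟨-y, hTneg y hy, by rw [map_neg, hyx, neg_neg]⟩
  · rw [himg, ← hLT, volume_planeEquiv_image, volume_planeEquiv_image] at hTvol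
    exact (ENNReal.mul_right_inj (by simpa using h) ENNReal.ofReal_ne_top).1 hTvol
  · rw [himg, ← hLT, mahlerVol_planeEquiv_image h hS'.1.measurableSet,
      mahlerVol_planeEquiv_image h hcomp.measurableSet] at hTm
    exact hTm
end

section
/- Let p ∈ (0,∞) and let (Ŝ, Δ(·), S(·), I) be a symmetric Mahler sliding family in ℝ². Then the function t ↦ 1/|S(t)^{∘,p}| is convex on I. -/
open MeasureTheory Set

/-- One-dimensional Brunn–Minkowski inequality for convex sets. -/
theorem volume_add_le_of_combo_subset {A B C : Set ℝ} (hA : Convex ℝ A) (hB : Convex ℝ B)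
    (hAne : A.Nonempty) (hBne : B.Nonempty) {a b : ℝ} (ha : 0 ≤ a) (hb : 0 ≤ b)
    (hC : ∀ x ∈ A, ∀ y ∈ B, a * x + b * y ∈ C) :
    ENNReal.ofReal a * volume A + ENNReal.ofReal b * volume B ≤ volume C := by
  by_cases hCtop : volume C = ⊤
  · simp [hCtop]
  have key_le : ∀ x ∈ A, ∀ x' ∈ A, x ≤ x' → ∀ y ∈ B, ∀ y' ∈ B, y ≤ y' →
      ENNReal.ofReal a * edist x x' + ENNReal.ofReal b * edist y y' ≤ volume C := by
    intro x hx x' hx' hxx y hy y' hy' hyy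
    have hsub : Icc (a * x + b * y) (a * x' + b * y') ⊆ C := by
      rw [← segment_eq_Icc (by gcongr)]
      rintro _ ⟨s, t, hs, ht, hst, rfl⟩
      have := hC _ (hA hx hx' hs ht hst) _ (hB hy hy' hs ht hst)
      convert this using 1
      simp only [smul_eq_mul]
      ring
    refine le_trans (le_of_eq ?_) (measure_mono hsub)
    rw [Real.volume_Icc, edist_comm x, edist_comm y, edist_dist, edist_dist, Real.dist_eq,
      Real.dist_eq, abs_of_nonneg (sub_nonneg.2 hxx), abs_of_nonneg (sub_nonneg.2 hyy),
      ← ENNReal.ofReal_mul ha, ← ENNReal.ofReal_mul hb, ← ENNReal.ofReal_add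
        (mul_nonneg ha (sub_nonneg.2 hxx)) (mul_nonneg hb (sub_nonneg.2 hyy))]
    congr 1
    ring
  have key : ∀ x ∈ A, ∀ x' ∈ A, ∀ y ∈ B, ∀ y' ∈ B,
      ENNReal.ofReal a * edist x x' + ENNReal.ofReal b * edist y y' ≤ volume C := by
    intro x hx x' hx' y hy y' hy'
    rcases le_total x x' with h1 | h1 <;> rcases le_total y y' with h2 | h2
    · exact key_le x hx x' hx' h1 y hy y' hy' h2
    · rw [edist_comm y]; exact key_le x hx x' hx' h1 y' hy' y hy h2
    · rw [edist_comm x]; exact key_le x' hx' x hx h1 y hy y' hy' h2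
    · rw [edist_comm x, edist_comm y]; exact key_le x' hx' x hx h1 y' hy' y hy h2
  have hdiam : ∀ D : Set ℝ, D.Nonempty → ∀ c : ENNReal,
      c * Metric.ediam D = ⨆ q : D × D, c * edist (q.1 : ℝ) (q.2 : ℝ) := by
    intro D hD c
    rw [← ENNReal.mul_iSup]
    congr 1
    apply le_antisymm
    · exact Metric.ediam_le fun x hx y hy =>
        le_iSup (fun q : D × D => edist (q.1 : ℝ) (q.2 : ℝ)) (⟨x, hx⟩, ⟨y, hy⟩)
    · exact iSup_le fun q => Metric.edist_le_ediam_of_mem q.1.2 q.2.2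
  have := hAne.to_subtype
  have := hBne.to_subtype
  calc ENNReal.ofReal a * volume A + ENNReal.ofReal b * volume B
      ≤ ENNReal.ofReal a * Metric.ediam A + ENNReal.ofReal b * Metric.ediam B := by
        gcongr <;> exact Real.volume_le_diam _
    _ ≤ volume C := by
        rw [hdiam A hAne, hdiam B hBne]
        exact ENNReal.iSup_add_iSup_le fun q r =>
          key _ q.1.2 _ q.2.2 _ r.1.2 _ r.2.2

/-- A Prékopa–Leindler type inequality for quasi-concave functions with equal suprema. -/
theorem lintegral_add_le_of_min_le_s7 {f g h : ℝ → ℝ} (hf : Measurable f) (hg : Measurable g)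
    (hh : Measurable h) (hf0 : ∀ x, 0 ≤ f x) (hg0 : ∀ x, 0 ≤ g x) (hh0 : ∀ x, 0 ≤ h x)
    (hfq : QuasiconcaveOn ℝ univ f) (hgq : QuasiconcaveOn ℝ univ g)
    (hsup : ∀ q, 0 < q → ((∃ x, q < f x) ↔ ∃ x, q < g x)) {a b : ℝ} (ha : 0 ≤ a) (hb : 0 ≤ b)
    (hmin : ∀ x y, min (f x) (g y) ≤ h (a * x + b * y)) :
    ENNReal.ofReal a * (∫⁻ x, ENNReal.ofReal (f x)) + ENNReal.ofReal b *
      (∫⁻ x, ENNReal.ofReal (g x)) ≤ ∫⁻ x, ENNReal.ofReal (h x) := by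
  rw [lintegral_eq_lintegral_meas_lt volume (.of_forall hf0) hf.aemeasurable,
    lintegral_eq_lintegral_meas_lt volume (.of_forall hg0) hg.aemeasurable,
    lintegral_eq_lintegral_meas_lt volume (.of_forall hh0) hh.aemeasurable,
    ← lintegral_const_mul' _ _ ENNReal.ofReal_ne_top,
    ← lintegral_const_mul' _ _ ENNReal.ofReal_ne_top]
  refine (le_lintegral_add _ _).trans (setLIntegral_mono' measurableSet_Ioi fun q hq => ?_)
  have hconvF : Convex ℝ {x | q < f x} := by simpa using hfq.convex_gt q
  have hconvG : Convex ℝ {x | q < g x} := by simpa using hgq.convex_gt q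
  by_cases hne : ∃ x, q < f x
  · refine volume_add_le_of_combo_subset hconvF hconvG hne ((hsup q hq).1 hne) ha hb ?_
    intro x hx y hy
    exact (lt_min hx hy).trans_le (hmin x y)
  · have hne' : ¬ ∃ x, q < g x := fun h => hne ((hsup q hq).2 h)
    have h1 : {x | q < f x} = ∅ := by
      ext x; simpa using not_lt.1 fun h => hne ⟨x, h⟩
    have h2 : {x | q < g x} = ∅ := by
      ext x; simpa using not_lt.1 fun h => hne' ⟨x, h⟩
    simp [h1, h2]

theorem lintegral_comp_const_mul {c : ℝ} (hc : 0 < c) {f : ℝ → ENNReal} (hf : Measurable f) :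
    ∫⁻ x, f (c * x) = ENNReal.ofReal c⁻¹ * ∫⁻ x, f x := by
  have h := lintegral_map (μ := volume) hf (measurable_const_mul c)
  rw [Real.map_volume_mul_left hc.ne', lintegral_smul_measure,
    abs_of_pos (inv_pos.2 hc)] at h
  rw [← h, smul_eq_mul]

section Radial

variable {E : Type*} [NormedAddCommGroup E] [NormedSpace ℝ E]

/-- The second radial moment `∫ r exp (-H (r x)) dr` over the positive half-line. -/
noncomputable def radialMoment (H : E → ℝ) (x : E) : ENNReal :=
  ∫⁻ r in Ioi (0 : ℝ), ENNReal.ofReal (r * Real.exp (-H (r • x)))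

/-- The density of the radial moment after the substitution `s = 1 / r`. -/
noncomputable def radialKernel (H : E → ℝ) (x : E) (s : ℝ) : ℝ :=
  if 0 < s then Real.exp (-(3 * Real.log s) - H (s⁻¹ • x)) else 0

theorem radialKernel_of_pos (H : E → ℝ) (x : E) {s : ℝ} (hs : 0 < s) :
    radialKernel H x s = Real.exp (-(3 * Real.log s) - H (s⁻¹ • x)) := if_pos hs

theorem radialKernel_of_nonpos (H : E → ℝ) (x : E) {s : ℝ} (hs : s ≤ 0) :
    radialKernel H x s = 0 := if_neg hs.not_gt

theorem radialKernel_nonneg (H : E → ℝ) (x : E) (s : ℝ) : 0 ≤ radialKernel H x s := by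
  unfold radialKernel
  split_ifs <;> positivity

theorem measurable_radialKernel {H : E → ℝ} (hH : Continuous H) (x : E) :
    Measurable (radialKernel H x) := by
  have h : Measurable fun s : ℝ => Real.exp (-(3 * Real.log s) - H (s⁻¹ • x)) := by
    have h2 : Measurable fun s : ℝ => H (s⁻¹ • x) :=
      (hH.comp (continuous_id.smul continuous_const)).measurable.comp measurable_inv
    exact Real.measurable_exp.comp (((Real.measurable_log.const_mul 3).neg).sub h2)
  exact Measurable.ite measurableSet_Ioi h measurable_const

theorem radialMoment_eq_lintegral_kernel (H : E → ℝ) (x : E) :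
    radialMoment H x = ∫⁻ s, ENNReal.ofReal (radialKernel H x s) := by
  have himg : (fun s : ℝ => s⁻¹) '' Ioi 0 = Ioi 0 := by
    ext y
    constructor
    · rintro ⟨s, hs, rfl⟩
      exact mem_Ioi.2 (inv_pos.2 (mem_Ioi.1 hs))
    · intro hy
      exact ⟨y⁻¹, mem_Ioi.2 (inv_pos.2 (mem_Ioi.1 hy)), inv_inv y⟩
  have h := lintegral_image_eq_lintegral_abs_deriv_mul (s := Ioi (0 : ℝ))
    (f := fun s => s⁻¹) (f' := fun s => -(s ^ 2)⁻¹) measurableSet_Ioi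
    (fun s hs => (hasDerivAt_inv (ne_of_gt hs)).hasDerivWithinAt) inv_injective.injOn
    (fun r => ENNReal.ofReal (r * Real.exp (-H (r • x))))
  rw [himg] at h
  rw [radialMoment, h, ← lintegral_indicator measurableSet_Ioi]
  refine lintegral_congr fun s => ?_
  by_cases hs : 0 < s
  · rw [indicator_of_mem (mem_Ioi.2 hs), radialKernel_of_pos H x hs,
      ← ENNReal.ofReal_mul (abs_nonneg _)]
    congr 1
    rw [abs_neg, abs_of_nonneg (by positivity), Real.exp_sub, Real.exp_neg (H _), Real.exp_neg,
      mul_comm 3, Real.exp_mul, Real.exp_log hs]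
    norm_cast
    field_simp
  · rw [indicator_of_notMem (by simpa using hs), radialKernel_of_nonpos H x (not_lt.1 hs)]
    simp

theorem radialMoment_smul {H : E → ℝ} (hH : Continuous H) {c : ℝ} (hc : 0 < c) (x : E) :
    ENNReal.ofReal (c ^ 2) * radialMoment H (c • x) = radialMoment H x := by
  have hmeas : Measurable ((Ioi (0 : ℝ)).indicator
      fun r => ENNReal.ofReal (r * Real.exp (-H (r • x)))) := by
    refine Measurable.indicator ?_ measurableSet_Ioi
    exact (continuous_id.mul (Real.continuous_exp.comp
      (hH.comp (continuous_id.smul continuous_const)).neg)).measurable.ennreal_ofReal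
  have h := lintegral_comp_const_mul hc hmeas
  rw [lintegral_indicator measurableSet_Ioi] at h
  change _ = _ * radialMoment H x at h
  have h2 : radialMoment H x = ENNReal.ofReal c * (ENNReal.ofReal c⁻¹ * radialMoment H x) := by
    rw [← mul_assoc, ← ENNReal.ofReal_mul hc.le, mul_inv_cancel₀ hc.ne']
    simp
  rw [h2, ← h, pow_two, ENNReal.ofReal_mul hc.le, mul_assoc]
  congr 1
  rw [radialMoment, ← lintegral_const_mul' _ _ ENNReal.ofReal_ne_top,
    ← lintegral_indicator measurableSet_Ioi]
  refine lintegral_congr fun r => ?_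
  by_cases hr : 0 < r
  · rw [indicator_of_mem (mem_Ioi.2 hr), indicator_of_mem (mem_Ioi.2 (mul_pos hc hr)),
      ← ENNReal.ofReal_mul hc.le, smul_smul, mul_comm r c, mul_assoc]
  · rw [indicator_of_notMem (by simpa using hr), indicator_of_notMem]
    simpa using mul_nonpos_of_nonneg_of_nonpos hc.le (not_lt.1 hr)

theorem min_radialKernel_le {H : E → ℝ} (hH : ConvexOn ℝ univ H) (x y : E) {a b : ℝ}
    (ha : 0 ≤ a) (hb : 0 ≤ b) (hab : a + b = 1) (s t : ℝ) :
    min (radialKernel H x s) (radialKernel H y t) ≤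
      radialKernel H (a • x + b • y) (a * s + b * t) := by
  by_cases hs : 0 < s
  swap
  · rw [radialKernel_of_nonpos H x (not_lt.1 hs)]
    exact (min_le_left _ _).trans (radialKernel_nonneg _ _ _)
  by_cases ht : 0 < t
  swap
  · rw [radialKernel_of_nonpos H y (not_lt.1 ht)]
    exact (min_le_right _ _).trans (radialKernel_nonneg _ _ _)
  have hw : 0 < a * s + b * t := by
    rcases ha.eq_or_lt with h | h
    · have : b = 1 := by linarith
      subst this; subst h; simpa using ht
    · have := mul_pos h hs
      have := mul_nonneg hb ht.le
      linarith
  set w := a * s + b * t with hwdef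
  rw [radialKernel_of_pos H x hs, radialKernel_of_pos H y ht, radialKernel_of_pos H _ hw,
    ← Real.exp_monotone.map_min, Real.exp_le_exp]
  have h1 : a * s / w + b * t / w = 1 := by rw [← add_div, ← hwdef, div_self hw.ne']
  have h1a : 0 ≤ a * s / w := by positivity
  have h1b : 0 ≤ b * t / w := by positivity
  have hHc := hH.2 (mem_univ (s⁻¹ • x)) (mem_univ (t⁻¹ • y)) h1a h1b h1
  have hlog := strictConcaveOn_log_Ioi.concaveOn.2 (mem_Ioi.2 (inv_pos.2 hs))
    (mem_Ioi.2 (inv_pos.2 ht)) h1a h1b h1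
  have e1 : (a * s / w) • s⁻¹ • x + (b * t / w) • t⁻¹ • y = w⁻¹ • (a • x + b • y) := by
    rw [smul_smul, smul_smul, smul_add, smul_smul, smul_smul]
    congr 2 <;> field_simp
  have e2 : (a * s / w) • s⁻¹ + (b * t / w) • t⁻¹ = w⁻¹ := by
    simp only [smul_eq_mul]
    field_simp
    exact hab
  rw [e1] at hHc
  rw [e2, Real.log_inv, Real.log_inv, Real.log_inv] at hlog
  simp only [smul_eq_mul] at hHc hlog
  set u := -(3 * Real.log s) - H (s⁻¹ • x) with hu
  set v := -(3 * Real.log t) - H (t⁻¹ • y) with hv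
  have h3 : min u v ≤ a * s / w * u + b * t / w * v := by
    calc min u v = a * s / w * min u v + b * t / w * min u v := by
          rw [← add_mul, h1, one_mul]
      _ ≤ _ := by gcongr; exacts [min_le_left _ _, min_le_right _ _]
  rw [hu, hv] at h3
  refine h3.trans ?_
  linarith

theorem quasiconcaveOn_radialKernel {H : E → ℝ} (hH : ConvexOn ℝ univ H) (x : E) :
    QuasiconcaveOn ℝ univ (radialKernel H x) := by
  refine quasiconcaveOn_iff_min_le.2 ⟨convex_univ, fun s _ t _ a b ha hb hab => ?_⟩
  simpa [← add_smul, hab] using min_radialKernel_le hH x x ha hb hab s t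

theorem radialMoment_add_le {H : E → ℝ} (hH : ConvexOn ℝ univ H) (hHc : Continuous H) (x y : E)
    (hsup : ∀ q, 0 < q → ((∃ s, q < radialKernel H x s) ↔ ∃ s, q < radialKernel H y s))
    {a b : ℝ} (ha : 0 ≤ a) (hb : 0 ≤ b) (hab : a + b = 1) :
    ENNReal.ofReal a * radialMoment H x + ENNReal.ofReal b * radialMoment H y ≤
      radialMoment H (a • x + b • y) := by
  simp only [radialMoment_eq_lintegral_kernel]
  exact lintegral_add_le_of_min_le_s7 (measurable_radialKernel hHc x) (measurable_radialKernel hHc y)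
    (measurable_radialKernel hHc _) (radialKernel_nonneg H x) (radialKernel_nonneg H y)
    (radialKernel_nonneg H _) (quasiconcaveOn_radialKernel hH x) (quasiconcaveOn_radialKernel hH y)
    hsup ha hb (min_radialKernel_le hH x y ha hb hab)

theorem radialKernel_inv_smul (H : E → ℝ) (x : E) {c : ℝ} (hc : 0 < c) (s : ℝ) :
    radialKernel H (c⁻¹ • x) s = c ^ 3 * radialKernel H x (c * s) := by
  by_cases hs : 0 < s
  · rw [radialKernel_of_pos _ _ hs, radialKernel_of_pos _ _ (mul_pos hc hs),
      Real.log_mul hc.ne' hs.ne', smul_smul, mul_inv, mul_comm s⁻¹]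
    have : c ^ 3 = Real.exp (3 * Real.log c) := by
      rw [mul_comm, Real.exp_mul, Real.exp_log hc]
      norm_cast
    rw [this, ← Real.exp_add]
    congr 1
    ring
  · rw [radialKernel_of_nonpos _ _ (not_lt.1 hs),
      radialKernel_of_nonpos _ _ (mul_nonpos_of_nonneg_of_nonpos hc.le (not_lt.1 hs)), mul_zero]

/-- If the radial kernel is bounded, its supremum can be normalised by rescaling the point. -/
theorem exists_radialKernel_sup_eq_one {H : E → ℝ} {x : E}
    (hbdd : BddAbove (range (radialKernel H x))) :
    ∃ c : ℝ, 0 < c ∧ ∀ q, (∃ s, q < radialKernel H (c⁻¹ • x) s) ↔ q < 1 := by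
  set m := ⨆ s, radialKernel H x s with hm
  have hmpos : 0 < m := by
    refine lt_of_lt_of_le ?_ (le_ciSup hbdd 1)
    rw [radialKernel_of_pos _ _ one_pos]
    positivity
  refine ⟨m ^ (-(1 / 3) : ℝ), by positivity, fun q => ?_⟩
  set c := m ^ (-(1 / 3) : ℝ) with hcdef
  have hc : 0 < c := by positivity
  have hc3 : c ^ 3 = m⁻¹ := by
    rw [hcdef, ← Real.rpow_natCast, ← Real.rpow_mul hmpos.le, ← Real.rpow_neg_one]
    norm_num
  have h1 : (∃ s, q < radialKernel H (c⁻¹ • x) s) ↔ ∃ s, q * m < radialKernel H x s := by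
    constructor
    · rintro ⟨s, hs⟩
      refine ⟨c * s, ?_⟩
      rw [radialKernel_inv_smul H x hc, hc3, inv_mul_eq_div, lt_div_iff₀ hmpos] at hs
      exact hs
    · rintro ⟨s, hs⟩
      refine ⟨c⁻¹ * s, ?_⟩
      rw [radialKernel_inv_smul H x hc, hc3, inv_mul_eq_div, lt_div_iff₀ hmpos,
        mul_inv_cancel_left₀ hc.ne']
      exact hs
  rw [h1, ← lt_ciSup_iff hbdd, ← hm]
  constructor
  · intro h
    by_contra! h'
    nlinarith
  · intro h
    nlinarith

/-- Ball's theorem: the superlevel set `{1 ≤ radialMoment H}` is convex. -/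
theorem one_le_radialMoment_combo {H : E → ℝ} (hH : ConvexOn ℝ univ H) (hHc : Continuous H)
    {x y : E} (hbx : BddAbove (range (radialKernel H x)))
    (hby : BddAbove (range (radialKernel H y)))
    (hx : 1 ≤ radialMoment H x) (hy : 1 ≤ radialMoment H y)
    {a b : ℝ} (ha : 0 ≤ a) (hb : 0 ≤ b) (hab : a + b = 1) :
    1 ≤ radialMoment H (a • x + b • y) := by
  obtain ⟨c, hc, hcs⟩ := exists_radialKernel_sup_eq_one hbx
  obtain ⟨d, hd, hds⟩ := exists_radialKernel_sup_eq_one hby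
  have hD : 0 < a * c + b * d := by
    rcases ha.eq_or_lt with h | h
    · have : b = 1 := by linarith
      subst this; subst h; simpa using hd
    · have := mul_pos h hc
      have := mul_nonneg hb hd.le
      linarith
  set D := a * c + b * d with hDdef
  have h1 := radialMoment_add_le hH hHc (c⁻¹ • x) (d⁻¹ • y)
    (fun q _ => (hcs q).trans (hds q).symm) (a := a * c / D) (b := b * d / D)
    (by positivity) (by positivity) (by rw [← add_div, ← hDdef, div_self hD.ne'])
  have e1 : (a * c / D) • c⁻¹ • x + (b * d / D) • d⁻¹ • y = D⁻¹ • (a • x + b • y) := by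
    rw [smul_smul, smul_smul, smul_add, smul_smul, smul_smul]
    congr 2 <;> field_simp
  have hsc : ∀ (k : ℝ) (_ : 0 < k) (z : E),
      radialMoment H (k⁻¹ • z) = ENNReal.ofReal (k ^ 2) * radialMoment H z := by
    intro k hk z
    rw [← radialMoment_smul hHc hk (k⁻¹ • z), smul_inv_smul₀ hk.ne'] 
  rw [e1, hsc D hD, hsc c hc, hsc d hd] at h1
  have h2 : ENNReal.ofReal (a * c / D * c ^ 2 + b * d / D * d ^ 2) ≤
      ENNReal.ofReal (D ^ 2) * radialMoment H (a • x + b • y) := by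
    refine le_trans ?_ h1
    rw [ENNReal.ofReal_add (by positivity) (by positivity),
      ENNReal.ofReal_mul (p := a * c / D) (by positivity),
      ENNReal.ofReal_mul (p := b * d / D) (by positivity)]
    gcongr
    · exact le_mul_of_one_le_right' hx
    · exact le_mul_of_one_le_right' hy
  have h3 : ENNReal.ofReal (D ^ 2) ≤ ENNReal.ofReal (a * c / D * c ^ 2 + b * d / D * d ^ 2) := by
    apply ENNReal.ofReal_le_ofReal
    have hcube := (convexOn_pow 3).2 (mem_Ici.2 hc.le) (mem_Ici.2 hd.le) ha hb hab
    simp only [smul_eq_mul, ← hDdef] at hcube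
    have : a * c / D * c ^ 2 + b * d / D * d ^ 2 = (a * c ^ 3 + b * d ^ 3) / D := by
      field_simp
    rw [this, le_div_iff₀ hD]
    linarith
  have h4 := h3.trans h2
  have hne : ENNReal.ofReal (D ^ 2) ≠ 0 := by simpa using hD.ne'
  by_contra! hlt
  exact absurd h4 (not_le.2 (by
    simpa using ENNReal.mul_lt_mul_right hne ENNReal.ofReal_ne_top hlt))

end Radial

section Sections

/-- The half-width of a symmetric convex planar set in the first coordinate direction. -/
theorem exists_width {C : Set (ℝ × ℝ)} (hconv : Convex ℝ C) (hsymm : ∀ y ∈ C, -y ∈ C)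
    (hbdd : Bornology.IsBounded C) {δ : ℝ} (hδ : 0 < δ) (hmem : (δ, (0 : ℝ)) ∈ C) :
    ∃ U : ℝ, 0 < U ∧ (∀ τ : ℝ, |τ| < 1 → (Prod.mk (U * τ) ⁻¹' C).Nonempty) ∧
      ∀ τ : ℝ, 1 < |τ| → Prod.mk (U * τ) ⁻¹' C = ∅ := by
  have hne : (Prod.fst '' C).Nonempty := ⟨δ, _, hmem, rfl⟩
  have hba : BddAbove (Prod.fst '' C) := by
    obtain ⟨R, hR⟩ := hbdd.exists_norm_le
    refine ⟨R, ?_⟩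
    rintro _ ⟨y, hy, rfl⟩
    exact (le_abs_self _).trans ((norm_fst_le y).trans (hR y hy))
  have hU : 0 < sSup (Prod.fst '' C) := hδ.trans_le (le_csSup hba ⟨_, hmem, rfl⟩)
  refine ⟨sSup (Prod.fst '' C), hU, fun τ hτ => ?_, fun τ hτ => ?_⟩
  · obtain ⟨_, ⟨y, hy, rfl⟩, hlt⟩ := exists_lt_of_lt_csSup hne
      (show sSup (Prod.fst '' C) * |τ| < sSup (Prod.fst '' C) by nlinarith)
    have hy1 : 0 < y.1 := lt_of_le_of_lt (by positivity) hlt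
    set q := sSup (Prod.fst '' C) * τ / y.1 with hq
    have hq1 : |q| ≤ 1 := by
      rw [hq, abs_div, abs_mul, abs_of_pos hU, abs_of_pos hy1, div_le_one hy1]
      exact hlt.le
    obtain ⟨hq2, hq3⟩ := abs_le.1 hq1
    have h := hconv hy (hsymm y hy) (a := (1 + q) / 2) (b := (1 - q) / 2)
      (by linarith) (by linarith) (by ring)
    refine ⟨q * y.2, ?_⟩
    have e : (sSup (Prod.fst '' C) * τ, q * y.2) =
        ((1 + q) / 2) • y + ((1 - q) / 2) • (-y) := by
      ext
      · have : sSup (Prod.fst '' C) * τ = q * y.1 := by rw [hq]; field_simp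
        simp [this]; ring
      · simp; ring
    rw [mem_preimage, e]
    exact h
  · ext v
    simp only [mem_preimage, mem_empty_iff_false, iff_false]
    intro hv
    have h1 : sSup (Prod.fst '' C) * |τ| ∈ Prod.fst '' C := by
      rcases abs_cases τ with h | h
      · exact ⟨_, hv, by simp [h.1]⟩
      · exact ⟨_, hsymm _ hv, by simp [h.1]⟩
    nlinarith [le_csSup hba h1]

theorem volume_eq_mul_lintegral_slice {C : Set (ℝ × ℝ)} (hC : MeasurableSet C) {U : ℝ}
    (hU : 0 < U) :
    volume C = ENNReal.ofReal U * ∫⁻ τ, volume (Prod.mk (U * τ) ⁻¹' C) := by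
  rw [lintegral_comp_const_mul hU (measurable_measure_prodMk_left hC), ← mul_assoc,
    ← ENNReal.ofReal_mul hU.le, mul_inv_cancel₀ hU.ne', ENNReal.ofReal_one, one_mul,
    Measure.volume_eq_prod, Measure.prod_apply hC]

theorem volume_pos_of_mem_axes {C : Set (ℝ × ℝ)} (hconv : Convex ℝ C) (hsymm : ∀ y ∈ C, -y ∈ C)
    {δ : ℝ} (hδ : 0 < δ) (h1 : (δ, (0 : ℝ)) ∈ C) (h2 : ((0 : ℝ), δ) ∈ C) : 0 < volume C := by
  have hsub : Ioo 0 (δ / 2) ×ˢ Ioo 0 (δ / 2) ⊆ C := by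
    rintro ⟨u, v⟩ ⟨⟨hu, hu'⟩, hv, hv'⟩
    have h0 : (0 : ℝ × ℝ) ∈ C := by
      have := hconv h1 (hsymm _ h1) (a := 1 / 2) (b := 1 / 2) (by norm_num) (by norm_num)
        (by norm_num)
      convert this using 1
      ext <;> simp
    simp only at hu hu' hv hv'
    have ha : u / δ ≤ 1 / 2 := by rw [div_le_iff₀ hδ]; linarith
    have hb : v / δ ≤ 1 / 2 := by rw [div_le_iff₀ hδ]; linarith
    have h3 := hconv.starConvex h0
    have h4 := hconv (h3.smul_mem h1 (t := 2 * (u / δ)) (by positivity) (by linarith))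
      (h3.smul_mem h2 (t := 2 * (v / δ)) (by positivity) (by linarith))
      (a := 1 / 2) (b := 1 / 2) (by norm_num) (by norm_num) (by norm_num)
    convert h4 using 1
    ext <;> simp <;> field_simp
  refine lt_of_lt_of_le ?_ (measure_mono hsub)
  rw [Measure.volume_eq_prod, Measure.prod_prod, Real.volume_Ioo]
  have : 0 < ENNReal.ofReal (δ / 2 - 0) := by simpa using hδ
  exact ENNReal.mul_pos this.ne' this.ne'

/-- Busemann's inequality: a set `C` containing suitable mixtures of `C₀` and `C₁` has area at
least the harmonic mean of the two areas. -/
theorem inv_volume_le_of_combo_mem {C₀ C₁ C : Set (ℝ × ℝ)} (hm₀ : MeasurableSet C₀)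
    (hm₁ : MeasurableSet C₁) (hm : MeasurableSet C) (hc₀ : Convex ℝ C₀) (hc₁ : Convex ℝ C₁)
    (hs₀ : ∀ y ∈ C₀, -y ∈ C₀) (hs₁ : ∀ y ∈ C₁, -y ∈ C₁)
    (hb₀ : Bornology.IsBounded C₀) (hb₁ : Bornology.IsBounded C₁)
    {δ : ℝ} (hδ : 0 < δ) (h₀ : (δ, (0 : ℝ)) ∈ C₀) (h₀' : ((0 : ℝ), δ) ∈ C₀)
    (h₁ : (δ, (0 : ℝ)) ∈ C₁) (h₁' : ((0 : ℝ), δ) ∈ C₁)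
    {t₀ t₁ a b : ℝ} (ha : 0 ≤ a) (hb : 0 ≤ b) (hab : a + b = 1)
    (hmix : ∀ y ∈ C₀, ∀ z ∈ C₁, ∀ c d : ℝ, 0 ≤ c → 0 ≤ d → c + d = 1 →
      (a * t₀ + b * t₁) * (c * y.1 + d * z.1) = c * (t₀ * y.1) + d * (t₁ * z.1) →
      c • y + d • z ∈ C) :
    1 / (volume C).toReal ≤ a * (1 / (volume C₀).toReal) + b * (1 / (volume C₁).toReal) := by
  by_cases hCtop : volume C = ⊤
  · simp only [hCtop, ENNReal.toReal_top, div_zero]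
    positivity
  obtain ⟨U₀, hU₀, hne₀, hem₀⟩ := exists_width hc₀ hs₀ hb₀ hδ h₀
  obtain ⟨U₁, hU₁, hne₁, hem₁⟩ := exists_width hc₁ hs₁ hb₁ hδ h₁
  have hσ : 0 < a / U₀ + b / U₁ := by
    rcases ha.eq_or_lt with h | h
    · have : b = 1 := by linarith
      subst this; subst h; simpa using hU₁
    · have := div_pos h hU₀
      have := div_nonneg hb hU₁.le
      linarith
  set σ := a / U₀ + b / U₁ with hσdef
  set c := a / U₀ / σ with hcdef
  set d := b / U₁ / σ with hddef
  have hc : 0 ≤ c := by positivity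
  have hd : 0 ≤ d := by positivity
  have hcd : c + d = 1 := by rw [hcdef, hddef, ← add_div, ← hσdef, div_self hσ.ne']
  have hcU : c * U₀ = a * σ⁻¹ := by rw [hcdef]; field_simp
  have hdU : d * U₁ = b * σ⁻¹ := by rw [hddef]; field_simp
  have hslice : ∀ᵐ τ : ℝ, ENNReal.ofReal c * volume (Prod.mk (U₀ * τ) ⁻¹' C₀) +
      ENNReal.ofReal d * volume (Prod.mk (U₁ * τ) ⁻¹' C₁) ≤
      volume (Prod.mk (σ⁻¹ * τ) ⁻¹' C) := by
    filter_upwards [Measure.ae_ne volume 1, Measure.ae_ne volume (-1)] with τ hτ1 hτ2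
    rcases lt_trichotomy |τ| 1 with hτ | hτ | hτ
    · have hpc : ∀ (D : Set (ℝ × ℝ)) (_ : Convex ℝ D) (u : ℝ), Convex ℝ (Prod.mk u ⁻¹' D) := by
        intro D hD u x hx y hy p q hp hq hpq
        have := hD hx hy hp hq hpq
        have e : p • (u, x) + q • (u, y) = (u, p • x + q • y) := by
          ext
          · simp [← add_mul, hpq]
          · simp
        rw [e] at this
        exact this
      refine volume_add_le_of_combo_subset (hpc _ hc₀ _) (hpc _ hc₁ _) (hne₀ τ hτ) (hne₁ τ hτ)
        hc hd fun x hx y hy => ?_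
      have hu : c * (U₀ * τ) + d * (U₁ * τ) = σ⁻¹ * τ := by
        rw [← mul_assoc, ← mul_assoc, hcU, hdU, ← add_mul, ← add_mul, hab, one_mul]
      have h := hmix _ hx _ hy c d hc hd hcd (by
        simp only
        rw [hu]
        linear_combination (-(t₀ * τ)) * hcU - t₁ * τ * hdU)
      have e : c • (U₀ * τ, x) + d • (U₁ * τ, y) = (σ⁻¹ * τ, c * x + d * y) := by
        ext
        · simpa using hu
        · simp
      rw [e] at h
      exact h
    · rcases (abs_eq one_pos.le).1 hτ with h | h
      · exact absurd h hτ1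
      · exact absurd h hτ2
    · rw [hem₀ τ hτ, hem₁ τ hτ]
      simp
  have hint := (le_lintegral_add _ _).trans (lintegral_mono_ae hslice)
  rw [lintegral_const_mul' _ _ ENNReal.ofReal_ne_top,
    lintegral_const_mul' _ _ ENNReal.ofReal_ne_top] at hint
  set L₀ := ∫⁻ τ, volume (Prod.mk (U₀ * τ) ⁻¹' C₀)
  set L₁ := ∫⁻ τ, volume (Prod.mk (U₁ * τ) ⁻¹' C₁)
  set L := ∫⁻ τ, volume (Prod.mk (σ⁻¹ * τ) ⁻¹' C)
  have hv₀ : volume C₀ = ENNReal.ofReal U₀ * L₀ := volume_eq_mul_lintegral_slice hm₀ hU₀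
  have hv₁ : volume C₁ = ENNReal.ofReal U₁ * L₁ := volume_eq_mul_lintegral_slice hm₁ hU₁
  have hv : volume C = ENNReal.ofReal σ⁻¹ * L := volume_eq_mul_lintegral_slice hm (inv_pos.2 hσ)
  have hLtop : L ≠ ⊤ := by
    intro h
    rw [hv, h, ENNReal.mul_top (by simpa using hσ)] at hCtop
    exact hCtop rfl
  have hp₀ : 0 < (volume C₀).toReal :=
    ENNReal.toReal_pos (volume_pos_of_mem_axes hc₀ hs₀ hδ h₀ h₀').ne' hb₀.measure_lt_top.ne
  have hp₁ : 0 < (volume C₁).toReal :=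
    ENNReal.toReal_pos (volume_pos_of_mem_axes hc₁ hs₁ hδ h₁ h₁').ne' hb₁.measure_lt_top.ne
  have hL₀top : L₀ ≠ ⊤ := by
    intro h
    have := hb₀.measure_lt_top (μ := volume)
    rw [hv₀, h, ENNReal.mul_top (by simpa using hU₀)] at this
    exact lt_irrefl _ this
  have hL₁top : L₁ ≠ ⊤ := by
    intro h
    have := hb₁.measure_lt_top (μ := volume)
    rw [hv₁, h, ENNReal.mul_top (by simpa using hU₁)] at this
    exact lt_irrefl _ this
  have hreal := ENNReal.toReal_mono hLtop hint
  rw [ENNReal.toReal_add (ENNReal.mul_ne_top ENNReal.ofReal_ne_top hL₀top)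
    (ENNReal.mul_ne_top ENNReal.ofReal_ne_top hL₁top), ENNReal.toReal_mul, ENNReal.toReal_mul,
    ENNReal.toReal_ofReal hc, ENNReal.toReal_ofReal hd] at hreal
  rw [hv₀, ENNReal.toReal_mul, ENNReal.toReal_ofReal hU₀.le] at hp₀ ⊢
  rw [hv₁, ENNReal.toReal_mul, ENNReal.toReal_ofReal hU₁.le] at hp₁ ⊢
  rw [hv, ENNReal.toReal_mul, ENNReal.toReal_ofReal (inv_pos.2 hσ).le]
  set l₀ := L₀.toReal
  set l₁ := L₁.toReal
  set l := L.toReal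
  have hl₀ : 0 < l₀ := pos_of_mul_pos_right hp₀ hU₀.le
  have hl₁ : 0 < l₁ := pos_of_mul_pos_right hp₁ hU₁.le
  have hl : 0 < l := by
    refine lt_of_lt_of_le ?_ hreal
    rcases hc.eq_or_lt with h | h
    · have : d = 1 := by linarith
      rw [← h, this]
      simpa using hl₁
    · have := mul_pos h hl₀
      have := mul_nonneg hd hl₁.le
      linarith
  have hcs : σ ^ 2 ≤ (a / U₀ * l₀ + b / U₁ * l₁) * (a * (1 / (U₀ * l₀)) + b * (1 / (U₁ * l₁))) := by
    have e : (a / U₀ * l₀ + b / U₁ * l₁) * (a * (1 / (U₀ * l₀)) + b * (1 / (U₁ * l₁))) - σ ^ 2 =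
        a * b * (l₀ - l₁) ^ 2 / (U₀ * U₁ * l₀ * l₁) := by
      rw [hσdef]
      field_simp
      ring
    have : 0 ≤ a * b * (l₀ - l₁) ^ 2 / (U₀ * U₁ * l₀ * l₁) := by positivity
    linarith
  have hreal2 : a / U₀ * l₀ + b / U₁ * l₁ ≤ l * σ := by
    have : c * l₀ + d * l₁ = (a / U₀ * l₀ + b / U₁ * l₁) / σ := by rw [hcdef, hddef]; ring
    rwa [this, div_le_iff₀ hσ] at hreal
  rw [div_le_iff₀ (by positivity)]
  set M := a * (1 / (U₀ * l₀)) + b * (1 / (U₁ * l₁))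
  have hM : 0 ≤ M := by positivity
  have h5 : σ ^ 2 ≤ l * σ * M := hcs.trans (by gcongr)
  have h6 : σ ≤ l * M := by nlinarith
  rw [← mul_assoc, mul_comm M, mul_assoc, ← div_eq_inv_mul, le_div_iff₀ hσ]
  linarith

end Sections

section Growth

variable {E : Type*} [NormedAddCommGroup E] [NormedSpace ℝ E]

theorem bddAbove_radialKernel {H : E → ℝ} {x : E} {k C : ℝ} (hk : 0 < k)
    (hH : ∀ r : ℝ, 0 < r → k * r - C ≤ H (r • x)) : BddAbove (range (radialKernel H x)) := by
  refine ⟨Real.exp C * (6 / k ^ 3), ?_⟩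
  rintro _ ⟨s, rfl⟩
  by_cases hs : 0 < s
  · rw [radialKernel_of_pos _ _ hs]
    have h1 : Real.exp (-(3 * Real.log s)) = (s ^ 3)⁻¹ := by
      rw [Real.exp_neg, mul_comm, Real.exp_mul, Real.exp_log hs]
      norm_cast
    have h2 := Real.pow_div_factorial_le_exp (k * s⁻¹) (by positivity) 3
    have h3 : (k * s⁻¹) ^ 3 / (Nat.factorial 3 : ℝ) = k ^ 3 / 6 * (s ^ 3)⁻¹ := by
      norm_num [Nat.factorial]
      ring
    rw [h3] at h2
    calc Real.exp (-(3 * Real.log s) - H (s⁻¹ • x))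
        ≤ Real.exp (-(3 * Real.log s) + (C + -(k * s⁻¹))) := by
          have := hH s⁻¹ (inv_pos.2 hs)
          gcongr
          linarith
      _ = Real.exp C * ((s ^ 3)⁻¹ * Real.exp (-(k * s⁻¹))) := by
          rw [Real.exp_add, Real.exp_add, h1]; ring
      _ ≤ Real.exp C * (6 / k ^ 3) := by
          gcongr
          rw [Real.exp_neg, ← div_eq_mul_inv, div_le_iff₀ (Real.exp_pos _)]
          calc (s ^ 3)⁻¹ = 6 / k ^ 3 * (k ^ 3 / 6 * (s ^ 3)⁻¹) := by field_simp
            _ ≤ _ := by gcongr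
  · rw [radialKernel_of_nonpos _ _ (not_lt.1 hs)]
    positivity

theorem lintegral_mul_exp_neg_lt_top {k : ℝ} (hk : 0 < k) (C : ℝ) :
    ∫⁻ r in Ioi (0 : ℝ), ENNReal.ofReal (r * Real.exp (-(k * r - C))) < ⊤ := by
  have h := (integrableOn_rpow_mul_exp_neg_mul_rpow (p := 1) (s := 1) (b := k) (by norm_num)
    one_pos hk).mul_const (Real.exp C)
  have h2 := h.lintegral_lt_top
  convert h2 using 3 with r
  rw [Real.rpow_one, mul_assoc, ← Real.exp_add]
  congr 2
  ring_nf

theorem radialMoment_le {H : E → ℝ} {x : E} {k C : ℝ}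
    (hH : ∀ r : ℝ, 0 < r → k * r - C ≤ H (r • x)) :
    radialMoment H x ≤ ∫⁻ r in Ioi (0 : ℝ), ENNReal.ofReal (r * Real.exp (-(k * r - C))) := by
  refine setLIntegral_mono' measurableSet_Ioi fun r hr => ?_
  have := hH r hr
  have h0 : (0 : ℝ) ≤ r := le_of_lt hr
  gcongr

theorem radialMoment_zero (H : E → ℝ) : radialMoment H 0 = ⊤ := by
  by_contra hne
  have h2 : ∫⁻ _ in Ioi (1 : ℝ), ENNReal.ofReal (1 * Real.exp (-H 0)) ≤ radialMoment H 0 := by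
    calc _ ≤ ∫⁻ r in Ioi (1 : ℝ), ENNReal.ofReal (r * Real.exp (-H (r • (0 : E)))) := by
          refine setLIntegral_mono' measurableSet_Ioi fun r hr => ?_
          rw [smul_zero]
          have : (1 : ℝ) ≤ r := le_of_lt hr
          gcongr
      _ ≤ _ := lintegral_mono_set (Ioi_subset_Ioi zero_le_one)
  rw [setLIntegral_const, Real.volume_Ioi, ENNReal.mul_top] at h2
  · exact hne (top_le_iff.1 h2)
  · simp only [ne_eq, ENNReal.ofReal_eq_zero, not_le]
    positivity

theorem radialMoment_pos {H : E → ℝ} (hH : Continuous H) (x : E) : 0 < radialMoment H x := by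
  have hmeas : Measurable fun r : ℝ => ENNReal.ofReal (r * Real.exp (-H (r • x))) :=
    (continuous_id.mul (Real.continuous_exp.comp
      (hH.comp (continuous_id.smul continuous_const)).neg)).measurable.ennreal_ofReal
  rw [radialMoment, setLIntegral_pos_iff hmeas]
  have : (Function.support fun r : ℝ => ENNReal.ofReal (r * Real.exp (-H (r • x)))) ∩ Ioi 0 =
      Ioi 0 := by
    refine inter_eq_right.2 fun r hr => ?_
    simp only [Function.mem_support, ne_eq, ENNReal.ofReal_eq_zero, not_le]
    exact mul_pos hr (Real.exp_pos _)
  rw [this, Real.volume_Ioi]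
  exact ENNReal.zero_lt_top

theorem measurable_radialMoment [FiniteDimensional ℝ E] [MeasurableSpace E] [BorelSpace E]
    {H : E → ℝ} (hH : Continuous H) : Measurable (radialMoment H) := by
  have h : Continuous fun q : E × ℝ => q.2 * Real.exp (-H (q.2 • q.1)) :=
    continuous_snd.mul (Real.continuous_exp.comp
      (hH.comp (continuous_snd.smul continuous_fst)).neg)
  exact Measurable.lintegral_prod_right' (f := fun q : E × ℝ =>
    ENNReal.ofReal (q.2 * Real.exp (-H (q.2 • q.1)))) h.measurable.ennreal_ofReal

end Growth

section Planes

/-- The section by the plane `s = t u` of the body `{1 ≤ radialMoment H}`. -/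
def momentSection (H : ℝ × ℝ × ℝ → ℝ) (t : ℝ) : Set (ℝ × ℝ) :=
  {y | 1 ≤ radialMoment H (y.1, t * y.1, y.2)}

variable {H : ℝ × ℝ × ℝ → ℝ}

theorem measurableSet_momentSection (hHc : Continuous H) (t : ℝ) :
    MeasurableSet (momentSection H t) := by
  have h : Measurable fun y : ℝ × ℝ => (y.1, t * y.1, y.2) := by fun_prop
  exact measurableSet_le measurable_const ((measurable_radialMoment hHc).comp h)

theorem neg_mem_momentSection (heven : ∀ z, H (-z) = H z) (t : ℝ) :
    ∀ y ∈ momentSection H t, -y ∈ momentSection H t := by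
  intro y hy
  have : radialMoment H ((-y).1, t * (-y).1, (-y).2) = radialMoment H (y.1, t * y.1, y.2) := by
    unfold radialMoment
    refine lintegral_congr fun r => ?_
    have e : r • ((-y).1, t * (-y).1, (-y).2) = -(r • (y.1, t * y.1, y.2)) := by
      ext <;> simp
    rw [e, heven]
  rw [momentSection, mem_ofPred_eq, this]
  exact hy

theorem growth_smul {ε C : ℝ} (hgrow : ∀ u s v, ε * (|u| + |v|) - C ≤ H (u, s, v)) (u s v : ℝ) :
    ∀ r : ℝ, 0 < r → ε * (|u| + |v|) * r - C ≤ H (r • (u, s, v)) := by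
  intro r hr
  have h := hgrow (r * u) (r * s) (r * v)
  rw [abs_mul, abs_mul, abs_of_pos hr] at h
  have e : r • (u, s, v) = (r * u, r * s, r * v) := rfl
  rw [e]
  linarith

theorem combo_mem_momentSection (hH : ConvexOn ℝ univ H) (hHc : Continuous H) {ε C : ℝ}
    (hε : 0 < ε) (hgrow : ∀ u s v, ε * (|u| + |v|) - C ≤ H (u, s, v)) {t₀ t₁ t : ℝ}
    {y z : ℝ × ℝ} (hy : y ∈ momentSection H t₀) (hz : z ∈ momentSection H t₁) {c d : ℝ}
    (hc : 0 ≤ c) (hd : 0 ≤ d) (hcd : c + d = 1)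
    (ht : t * (c * y.1 + d * z.1) = c * (t₀ * y.1) + d * (t₁ * z.1)) :
    c • y + d • z ∈ momentSection H t := by
  have e : ((c • y + d • z).1, t * (c • y + d • z).1, (c • y + d • z).2) =
      c • (y.1, t₀ * y.1, y.2) + d • (z.1, t₁ * z.1, z.2) := by
    ext
    · simp
    · simpa using ht
    · simp
  rw [momentSection, mem_ofPred_eq, e]
  have hscale : ∀ (k : ℝ) (x : ℝ × ℝ × ℝ), 0 ≤ k → k ≤ 1 → 1 ≤ radialMoment H x →
      1 ≤ radialMoment H (k • x) := by
    intro k x hk hk1 hx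
    rcases hk.eq_or_lt with rfl | hk
    · simp [radialMoment_zero]
    · rw [← radialMoment_smul hHc hk] at hx
      refine hx.trans (mul_le_of_le_one_left' ?_)
      rw [ENNReal.ofReal_le_one]
      exact pow_le_one₀ hk.le hk1
  have hpos : ∀ w : ℝ × ℝ, w ≠ 0 → 0 < ε * (|w.1| + |w.2|) := by
    intro w hw
    refine mul_pos hε ?_
    by_contra! hle
    have h1 := abs_nonneg w.1
    have h2 := abs_nonneg w.2
    exact hw (Prod.ext (abs_eq_zero.1 (by linarith)) (abs_eq_zero.1 (by linarith)))
  by_cases hy0 : y = 0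
  · have : ((y.1, t₀ * y.1, y.2) : ℝ × ℝ × ℝ) = 0 := by subst hy0; ext <;> simp
    rw [this, smul_zero, zero_add]
    exact hscale d _ hd (by linarith) hz
  by_cases hz0 : z = 0
  · have : ((z.1, t₁ * z.1, z.2) : ℝ × ℝ × ℝ) = 0 := by subst hz0; ext <;> simp
    rw [this, smul_zero, add_zero]
    exact hscale c _ hc (by linarith) hy
  exact one_le_radialMoment_combo hH hHc
    (bddAbove_radialKernel (hpos y hy0) (growth_smul hgrow _ _ _))
    (bddAbove_radialKernel (hpos z hz0) (growth_smul hgrow _ _ _)) hy hz hc hd hcd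

theorem isBounded_momentSection (hHc : Continuous H) {ε C : ℝ}
    (hε : 0 < ε) (hgrow : ∀ u s v, ε * (|u| + |v|) - C ≤ H (u, s, v)) (t : ℝ) :
    Bornology.IsBounded (momentSection H t) := by
  set K := (∫⁻ r in Ioi (0 : ℝ), ENNReal.ofReal (r * Real.exp (-(ε * r - C)))).toReal with hK
  have hKtop := lintegral_mul_exp_neg_lt_top hε C
  refine isBounded_iff_forall_norm_le.2 ⟨K + 1, fun y hy => ?_⟩
  have hK0 : 0 ≤ K := ENNReal.toReal_nonneg
  set n := |y.1| + |y.2| with hn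
  have hyn : ‖y‖ ≤ n := by
    rw [Prod.norm_def, Real.norm_eq_abs, Real.norm_eq_abs]
    exact max_le (le_add_of_nonneg_right (abs_nonneg _)) (le_add_of_nonneg_left (abs_nonneg _))
  refine hyn.trans ?_
  by_contra! hlt
  have hn0 : 0 < n := by linarith
  have h1 : radialMoment H (n⁻¹ • (y.1, t * y.1, y.2)) ≤ ENNReal.ofReal K := by
    rw [hK, ENNReal.ofReal_toReal hKtop.ne]
    refine radialMoment_le (fun r hr => ?_)
    rw [smul_smul]
    have h := growth_smul hgrow y.1 (t * y.1) y.2 (r * n⁻¹) (by positivity)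
    rw [← hn] at h
    convert h using 2
    field_simp
  have hy' : 1 ≤ radialMoment H (y.1, t * y.1, y.2) := hy
  have h2 := radialMoment_smul hHc (inv_pos.2 hn0) (y.1, t * y.1, y.2)
  rw [← h2] at hy'
  have h3 : (1 : ENNReal) ≤ ENNReal.ofReal (n⁻¹ ^ 2 * K) := by
    rw [ENNReal.ofReal_mul (by positivity)]
    exact hy'.trans (by gcongr)
  rw [ENNReal.one_le_ofReal, inv_pow, inv_mul_eq_div, le_div_iff₀ (by positivity)] at h3
  nlinarith

theorem exists_smul_mem_momentSection (hHc : Continuous H) (t : ℝ) (y : ℝ × ℝ) :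
    ∃ δ : ℝ, 0 < δ ∧ ∀ k, 0 < k → k ≤ δ → k • y ∈ momentSection H t := by
  have hpos := radialMoment_pos hHc (y.1, t * y.1, y.2)
  obtain ⟨q, hq0, hq⟩ : ∃ q : ℝ, 0 < q ∧ ENNReal.ofReal q ≤ radialMoment H (y.1, t * y.1, y.2) := by
    obtain ⟨q, -, hq0, hq⟩ := ENNReal.lt_iff_exists_real_btwn.1 hpos
    exact ⟨q, by simpa using hq0, hq.le⟩
  refine ⟨Real.sqrt q, Real.sqrt_pos.2 hq0, fun k hk hkq => ?_⟩
  have e : ((k • y).1, t * (k • y).1, (k • y).2) = k • (y.1, t * y.1, y.2) := by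
    ext
    · simp
    · simp; ring
    · simp
  rw [momentSection, mem_ofPred_eq, e]
  by_contra! hlt
  rw [← radialMoment_smul hHc hk] at hq
  have hk2 : ENNReal.ofReal (k ^ 2) ≠ 0 := by simpa using hk.ne'
  have h1 : ENNReal.ofReal (k ^ 2) * radialMoment H (k • (y.1, t * y.1, y.2)) <
      ENNReal.ofReal (k ^ 2) := by
    simpa using ENNReal.mul_lt_mul_right hk2 ENNReal.ofReal_ne_top hlt
  have h2 := hq.trans_lt h1
  rw [ENNReal.ofReal_lt_ofReal_iff (by positivity)] at h2
  have := pow_le_pow_left₀ hk.le hkq 2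
  rw [Real.sq_sqrt hq0.le] at this
  linarith

/-- The inverse area of the sections of `{1 ≤ radialMoment H}` is a convex function of the
slope. -/
theorem convexOn_inv_volume_momentSection (hH : ConvexOn ℝ univ H) (heven : ∀ z, H (-z) = H z)
    {ε C : ℝ} (hε : 0 < ε) (hgrow : ∀ u s v, ε * (|u| + |v|) - C ≤ H (u, s, v)) :
    ConvexOn ℝ univ fun t => 1 / (volume (momentSection H t)).toReal := by
  have hHc : Continuous H := continuousOn_univ.1 (hH.continuousOn isOpen_univ)
  refine ⟨convex_univ, fun t₀ _ t₁ _ a b ha hb hab => ?_⟩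
  have hconv : ∀ t, Convex ℝ (momentSection H t) := fun t y hy z hz c d hc hd hcd =>
    combo_mem_momentSection hH hHc hε hgrow hy hz hc hd hcd (by ring)
  obtain ⟨δ₁, hδ₁, h₁⟩ := exists_smul_mem_momentSection hHc t₀ (1, 0)
  obtain ⟨δ₂, hδ₂, h₂⟩ := exists_smul_mem_momentSection hHc t₀ (0, 1)
  obtain ⟨δ₃, hδ₃, h₃⟩ := exists_smul_mem_momentSection hHc t₁ (1, 0)
  obtain ⟨δ₄, hδ₄, h₄⟩ := exists_smul_mem_momentSection hHc t₁ (0, 1)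
  set δ := min (min δ₁ δ₂) (min δ₃ δ₄)
  have hδ : 0 < δ := by positivity
  have e₁ : δ • ((1 : ℝ), (0 : ℝ)) = (δ, 0) := by ext <;> simp
  have e₂ : δ • ((0 : ℝ), (1 : ℝ)) = (0, δ) := by ext <;> simp
  have k₁ := e₁ ▸ h₁ δ hδ ((min_le_left _ _).trans (min_le_left _ _))
  have k₂ := e₂ ▸ h₂ δ hδ ((min_le_left _ _).trans (min_le_right _ _))
  have k₃ := e₁ ▸ h₃ δ hδ ((min_le_right _ _).trans (min_le_left _ _))
  have k₄ := e₂ ▸ h₄ δ hδ ((min_le_right _ _).trans (min_le_right _ _))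
  simp only [smul_eq_mul]
  exact inv_volume_le_of_combo_mem (measurableSet_momentSection hHc _)
    (measurableSet_momentSection hHc _) (measurableSet_momentSection hHc _) (hconv _) (hconv _)
    (neg_mem_momentSection heven _) (neg_mem_momentSection heven _)
    (isBounded_momentSection hHc hε hgrow _) (isBounded_momentSection hHc hε hgrow _) hδ
    k₁ k₂ k₃ k₄ ha hb hab fun y hy z hz c d hc hd hcd ht =>
      combo_mem_momentSection hH hHc hε hgrow hy hz hc hd hcd ht

end Planes

theorem lpPolar_eq_momentSection {p : ℝ} {K : Set (ℝ × ℝ)} {H : ℝ × ℝ × ℝ → ℝ} {t : ℝ}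
    (hHc : Continuous H) {ε C : ℝ} (hε : 0 < ε)
    (hgrow : ∀ u s v, ε * (|u| + |v|) - C ≤ H (u, s, v))
    (hsupp : ∀ y : ℝ × ℝ, suppFn p K y = H (y.1, t * y.1, y.2)) :
    lpPolar p K = momentSection H t := by
  ext y
  rw [lpPolar, momentSection, mem_ofPred_eq, mem_ofPred_eq, nearNorm]
  by_cases hy : y = 0
  · have e : ((y.1, t * y.1, y.2) : ℝ × ℝ × ℝ) = 0 := by subst hy; ext <;> simp
    rw [if_pos hy, e, radialMoment_zero]
    simp
  rw [if_neg hy]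
  set z : ℝ × ℝ × ℝ := (y.1, t * y.1, y.2) with hz
  have hsz : ∀ r : ℝ, suppFn p K (r • y) = H (r • z) := by
    intro r
    rw [hsupp]
    congr 1
    ext
    · simp [hz]
    · simp [hz]; ring
    · simp [hz]
  have hpos : 0 < ε * (|y.1| + |y.2|) := by
    refine mul_pos hε ?_
    by_contra! hle
    have h1 := abs_nonneg y.1
    have h2 := abs_nonneg y.2
    exact hy (Prod.ext (abs_eq_zero.1 (by linarith)) (abs_eq_zero.1 (by linarith)))
  have htop : radialMoment H z < ⊤ :=
    (radialMoment_le (growth_smul hgrow _ _ _)).trans_lt (lintegral_mul_exp_neg_lt_top hpos C)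
  have hint : ∫ r in Ioi (0 : ℝ), r * Real.exp (-(suppFn p K (r • y))) =
      (radialMoment H z).toReal := by
    simp only [hsz]
    rw [integral_eq_lintegral_of_nonneg_ae]
    · rfl
    · filter_upwards [ae_restrict_mem measurableSet_Ioi] with r hr
      exact mul_nonneg (le_of_lt hr) (Real.exp_pos _).le
    · exact (continuous_id.mul (Real.continuous_exp.comp
        (hHc.comp (continuous_id.smul continuous_const)).neg)).aestronglyMeasurable
  have hJ : 0 < (radialMoment H z).toReal :=
    ENNReal.toReal_pos (radialMoment_pos hHc z).ne' htop.ne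
  rw [hint, Real.rpow_neg hJ.le, ← Real.sqrt_eq_rpow, inv_le_one₀ (Real.sqrt_pos.2 hJ),
    Real.one_le_sqrt, ← ENNReal.toReal_one, ENNReal.toReal_le_toReal ENNReal.one_ne_top htop.ne]

section Laplace

/-- The Laplace transform at scale `p` of a measure on `ℝ³`. -/
noncomputable def laplaceTransform (p : ℝ) (ν : Measure (ℝ × ℝ × ℝ)) (z : ℝ × ℝ × ℝ) : ENNReal :=
  ∫⁻ ξ, ENNReal.ofReal (Real.exp (p * (ξ.1 * z.1 + ξ.2.1 * z.2.1 + ξ.2.2 * z.2.2))) ∂ν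

/-- The `L^p`-support function of a measure on `ℝ³`. -/
noncomputable def logLaplace (p : ℝ) (ν : Measure (ℝ × ℝ × ℝ)) (z : ℝ × ℝ × ℝ) : ℝ :=
  (1 / p) * Real.log ((laplaceTransform p ν z).toReal / (laplaceTransform p ν 0).toReal)

theorem laplaceTransform_add (p : ℝ) (μ ν : Measure (ℝ × ℝ × ℝ)) (z : ℝ × ℝ × ℝ) :
    laplaceTransform p (μ + ν) z = laplaceTransform p μ z + laplaceTransform p ν z :=
  lintegral_add_measure _ _ _

theorem measurable_laplaceIntegrand (p : ℝ) (z : ℝ × ℝ × ℝ) :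
    Measurable fun ξ : ℝ × ℝ × ℝ =>
      ENNReal.ofReal (Real.exp (p * (ξ.1 * z.1 + ξ.2.1 * z.2.1 + ξ.2.2 * z.2.2))) := by
  fun_prop

theorem laplaceTransform_neg (p : ℝ) {ν : Measure (ℝ × ℝ × ℝ)} (hν : ν.map (fun ξ => -ξ) = ν)
    (z : ℝ × ℝ × ℝ) : laplaceTransform p ν (-z) = laplaceTransform p ν z := by
  rw [laplaceTransform, laplaceTransform]
  conv_rhs => rw [← hν]
  rw [lintegral_map (measurable_laplaceIntegrand p z) measurable_neg]
  refine lintegral_congr fun ξ => ?_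
  simp

theorem laplaceTransform_combo_le (p : ℝ) (ν : Measure (ℝ × ℝ × ℝ)) (x y : ℝ × ℝ × ℝ) {a b : ℝ}
    (ha : 0 ≤ a) (hb : 0 ≤ b) (hab : a + b = 1) :
    laplaceTransform p ν (a • x + b • y) ≤
      laplaceTransform p ν x ^ a * laplaceTransform p ν y ^ b := by
  refine le_trans (le_of_eq ?_) (ENNReal.lintegral_mul_norm_pow_le
    (measurable_laplaceIntegrand p x).aemeasurable (measurable_laplaceIntegrand p y).aemeasurable
    ha hb hab)
  refine lintegral_congr fun ξ => ?_
  rw [ENNReal.ofReal_rpow_of_pos (Real.exp_pos _), ENNReal.ofReal_rpow_of_pos (Real.exp_pos _),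
    ← ENNReal.ofReal_mul (by positivity), ← Real.exp_mul, ← Real.exp_mul, ← Real.exp_add]
  congr 2
  simp
  ring

theorem convexOn_logLaplace {p : ℝ} (hp : 0 < p) {ν : Measure (ℝ × ℝ × ℝ)}
    (hpos : ∀ z, 0 < laplaceTransform p ν z) (htop : ∀ z, laplaceTransform p ν z < ⊤) :
    ConvexOn ℝ univ (logLaplace p ν) := by
  refine ⟨convex_univ, fun x _ y _ a b ha hb hab => ?_⟩
  have hr : ∀ z, 0 < (laplaceTransform p ν z).toReal := fun z =>
    ENNReal.toReal_pos (hpos z).ne' (htop z).ne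
  have h := ENNReal.toReal_mono
    (ENNReal.mul_ne_top (ENNReal.rpow_ne_top_of_nonneg ha (htop x).ne)
      (ENNReal.rpow_ne_top_of_nonneg hb (htop y).ne))
    (laplaceTransform_combo_le p ν x y ha hb hab)
  rw [ENNReal.toReal_mul, ← ENNReal.toReal_rpow, ← ENNReal.toReal_rpow] at h
  have hlog := Real.log_le_log (hr _) h
  rw [Real.log_mul (Real.rpow_pos_of_pos (hr x) _).ne' (Real.rpow_pos_of_pos (hr y) _).ne',
    Real.log_rpow (hr x), Real.log_rpow (hr y)] at hlog
  simp only [logLaplace, Real.log_div (hr _).ne' (hr 0).ne', smul_eq_mul]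
  set l := Real.log (laplaceTransform p ν 0).toReal
  have e : a * (1 / p * (Real.log (laplaceTransform p ν x).toReal - l)) +
      b * (1 / p * (Real.log (laplaceTransform p ν y).toReal - l)) =
      1 / p * (a * Real.log (laplaceTransform p ν x).toReal +
        b * Real.log (laplaceTransform p ν y).toReal - l) := by
    linear_combination (-(l / p)) * hab
  rw [e]
  gcongr

theorem growth_logLaplace {p : ℝ} (hp : 0 < p) {ν : Measure (ℝ × ℝ × ℝ)}
    (htop : ∀ z, laplaceTransform p ν z < ⊤) {m ε : ℝ} (hm : 0 < m)
    (hlow : ∀ u s v : ℝ, ENNReal.ofReal (m * Real.exp (p * (ε * (|u| + |v|)))) ≤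
      laplaceTransform p ν (u, s, v)) (u s v : ℝ) :
    ε * (|u| + |v|) - (1 / p) * (Real.log (laplaceTransform p ν 0).toReal - Real.log m) ≤
      logLaplace p ν (u, s, v) := by
  have h1 := (ENNReal.ofReal_le_iff_le_toReal (htop _).ne).1 (hlow u s v)
  have h0 := (ENNReal.ofReal_le_iff_le_toReal (htop _).ne).1 (hlow 0 0 0)
  have hpos0 : 0 < (laplaceTransform p ν 0).toReal := lt_of_lt_of_le (by positivity) h0
  have hpos1 : 0 < m * Real.exp (p * (ε * (|u| + |v|))) := by positivity
  have h2 := Real.log_le_log hpos1 h1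
  rw [Real.log_mul hm.ne' (Real.exp_pos _).ne', Real.log_exp] at h2
  rw [logLaplace, Real.log_div (hpos1.trans_le h1).ne' hpos0.ne']
  calc _ = 1 / p * (Real.log m + p * (ε * (|u| + |v|)) -
        Real.log (laplaceTransform p ν 0).toReal) := by field_simp; ring
    _ ≤ _ := by gcongr

/-- If the projection of `ν` along the direction of slope `t` is the uniform measure on `K`, then
the `L^p`-support function of `K` is a plane section of that of `ν`. -/
theorem suppFn_eq_logLaplace (p : ℝ) {ν : Measure (ℝ × ℝ × ℝ)} {K : Set (ℝ × ℝ)} {t : ℝ}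
    (hν : ν.map (fun ξ => (ξ.1 + t * ξ.2.1, ξ.2.2)) = volume.restrict K) (y : ℝ × ℝ) :
    suppFn p K y = logLaplace p ν (y.1, t * y.1, y.2) := by
  have hK : ∀ y : ℝ × ℝ,
      ∫⁻ x in K, ENNReal.ofReal (Real.exp (p * (x.1 * y.1 + x.2 * y.2))) =
        laplaceTransform p ν (y.1, t * y.1, y.2) := by
    intro y
    rw [← hν, lintegral_map (by fun_prop) (by fun_prop), laplaceTransform]
    refine lintegral_congr fun ξ => ?_
    congr 3
    ring
  have h0 : volume K = laplaceTransform p ν 0 := by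
    have h := hK 0
    have e : (((0 : ℝ × ℝ).1, t * (0 : ℝ × ℝ).1, (0 : ℝ × ℝ).2) : ℝ × ℝ × ℝ) = 0 := by
      ext <;> simp
    rw [e] at h
    rw [← h]
    simp
  rw [suppFn, logLaplace, h0, ← hK y, integral_eq_lintegral_of_nonneg_ae]
  · exact .of_forall fun x => (Real.exp_pos _).le
  · exact Continuous.aestronglyMeasurable (by fun_prop)

theorem laplaceTransform_map_restrict_lt_top (p : ℝ) {K : Set (ℝ × ℝ)} (hK : IsCompact K)
    {f : ℝ × ℝ → ℝ × ℝ × ℝ} (hf : Continuous f) (z : ℝ × ℝ × ℝ) :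
    laplaceTransform p ((volume.restrict K).map f) z < ⊤ := by
  rw [laplaceTransform, lintegral_map (measurable_laplaceIntegrand p z) hf.measurable]
  have hc : Continuous fun x => Real.exp (p * ((f x).1 * z.1 + (f x).2.1 * z.2.1 +
      (f x).2.2 * z.2.2)) := by fun_prop
  exact (hc.continuousOn.integrableOn_compact hK).lintegral_lt_top

theorem le_laplaceTransform_map_restrict {p : ℝ} (hp : 0 < p) {K : Set (ℝ × ℝ)} {ε : ℝ}
    (hε : 0 < ε) (hK : Metric.closedBall 0 (3 * ε) ⊆ K) (u s v : ℝ) :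
    ENNReal.ofReal ((2 * ε) ^ 2 * Real.exp (p * (ε * (|u| + |v|)))) ≤
      laplaceTransform p ((volume.restrict K).map fun x => (x.1, 0, x.2)) (u, s, v) := by
  rw [laplaceTransform, lintegral_map (measurable_laplaceIntegrand p _) (by fun_prop)]
  have key : ∀ w : ℝ, ∃ e : ℝ, |e| ≤ 2 * ε ∧ ∀ x : ℝ, |x - e| ≤ ε → ε * |w| ≤ x * w := by
    intro w
    rcases abs_cases w with ⟨h, hw⟩ | ⟨h, hw⟩
    · refine ⟨2 * ε, by rw [abs_of_pos (by linarith)], fun x hx => ?_⟩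
      rw [h]
      have := (abs_le.1 hx).1
      nlinarith
    · refine ⟨-(2 * ε), by rw [abs_neg, abs_of_pos (by linarith)], fun x hx => ?_⟩
      rw [h]
      have := (abs_le.1 hx).2
      nlinarith
  obtain ⟨e, he, hu⟩ := key u
  obtain ⟨f, hf, hv⟩ := key v
  have hsub : Metric.closedBall (e, f) ε ⊆ K := by
    refine (Metric.closedBall_subset_closedBall' ?_).trans hK
    rw [dist_zero_right, Prod.norm_def, Real.norm_eq_abs, Real.norm_eq_abs]
    have := max_le he hf
    simp only
    linarith
  have hvol : volume (Metric.closedBall ((e, f) : ℝ × ℝ) ε) = ENNReal.ofReal ((2 * ε) ^ 2) := by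
    rw [← closedBall_prod_same, Measure.volume_eq_prod, Measure.prod_prod, Real.volume_closedBall,
      Real.volume_closedBall, ← ENNReal.ofReal_mul (by positivity), pow_two]
  calc ENNReal.ofReal ((2 * ε) ^ 2 * Real.exp (p * (ε * (|u| + |v|))))
      = ∫⁻ _ in Metric.closedBall ((e, f) : ℝ × ℝ) ε,
          ENNReal.ofReal (Real.exp (p * (ε * (|u| + |v|)))) := by
        rw [setLIntegral_const, hvol, ← ENNReal.ofReal_mul (by positivity), mul_comm]
    _ ≤ ∫⁻ x in Metric.closedBall ((e, f) : ℝ × ℝ) ε,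
          ENNReal.ofReal (Real.exp (p * (x.1 * u + 0 * s + x.2 * v))) := by
        refine setLIntegral_mono' measurableSet_closedBall fun x hx => ?_
        rw [← closedBall_prod_same] at hx
        have h1 := hu _ (by simpa [Real.dist_eq] using hx.1)
        have h2 := hv _ (by simpa [Real.dist_eq] using hx.2)
        gcongr
        linarith
    _ ≤ _ := lintegral_mono_set hsub

end Laplace

theorem aedisjoint_of_interior_inter_eq_empty {A B : Set (ℝ × ℝ)} (hA : Convex ℝ A)
    (hB : Convex ℝ B) (h : interior A ∩ interior B = ∅) : AEDisjoint volume A B := by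
  refine measure_mono_null (t := frontier A ∪ frontier B) ?_
    (measure_union_null (hA.addHaar_frontier _) (hB.addHaar_frontier _))
  rintro x ⟨hxA, hxB⟩
  by_contra hx
  rw [mem_union, not_or] at hx
  have h1 : x ∈ interior A := by
    by_contra h'
    exact hx.1 ⟨subset_closure hxA, h'⟩
  have h2 : x ∈ interior B := by
    by_contra h'
    exact hx.2 ⟨subset_closure hxB, h'⟩
  exact (h ▸ (⟨h1, h2⟩ : x ∈ interior A ∩ interior B) : x ∈ (∅ : Set (ℝ × ℝ)))

/-- Sliding the apex of a triangle horizontally is a shear, which preserves area. -/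
theorem map_shear_restrict_triangle {x₁ x₃ y₁ y₂ : ℝ} (hy : y₁ < y₂) (t : ℝ) :
    (volume.restrict (convexHull ℝ ({(x₁, y₁), (0, y₂), (x₃, y₁)} : Set (ℝ × ℝ)))).map
      (fun x => (x.1 + t * ((x.2 - y₁) / (y₂ - y₁)), x.2)) =
    volume.restrict (convexHull ℝ ({(x₁, y₁), (t, y₂), (x₃, y₁)} : Set (ℝ × ℝ))) := by
  set sh : ℝ → ℝ × ℝ → ℝ × ℝ := fun t x => (x.1 + t * ((x.2 - y₁) / (y₂ - y₁)), x.2) with hsh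
  have hsub : y₂ - y₁ ≠ 0 := (sub_pos.2 hy).ne'
  have hcont : ∀ t, Continuous (sh t) := fun t => by fun_prop
  have hmp : MeasurePreserving (sh t) volume volume := by
    have h := MeasurePreserving.skew_product (μa := (volume : Measure ℝ)) (μc := (volume : Measure ℝ))
      (μd := (volume : Measure ℝ)) (MeasurePreserving.id volume)
      (g := fun v u => u + t * ((v - y₁) / (y₂ - y₁))) (by fun_prop)
      (.of_forall fun v => (measurePreserving_add_right volume _).map_eq)
    exact (Measure.measurePreserving_swap.comp h).comp Measure.measurePreserving_swap
  have hlin : ∀ (s : ℝ) (x y : ℝ × ℝ) (a b : ℝ), a + b = 1 →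
      sh s (a • x + b • y) = a • sh s x + b • sh s y := by
    intro s x y a b hab
    ext
    · have hb : b = 1 - a := by linarith
      simp only [hsh, Prod.fst_add, Prod.smul_fst, Prod.snd_add, Prod.smul_snd, smul_eq_mul]
      subst hb
      field_simp
      ring
    · simp [hsh]
  have hmaps : ∀ r s : ℝ, convexHull ℝ ({(x₁, y₁), (r, y₂), (x₃, y₁)} : Set (ℝ × ℝ)) ⊆
      sh s ⁻¹' convexHull ℝ {(x₁, y₁), (r + s, y₂), (x₃, y₁)} := by
    intro r s
    refine convexHull_min ?_ ?_
    · rintro x (rfl | rfl | rfl)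
      · exact subset_convexHull ℝ _ (by simp [hsh])
      · exact subset_convexHull ℝ _ (by simp [hsh, div_self hsub])
      · exact subset_convexHull ℝ _ (by simp [hsh])
    · intro x hx y hy a b ha hb hab
      rw [mem_preimage, hlin s x y a b hab]
      exact convex_convexHull ℝ _ hx hy ha hb hab
  have hpre : convexHull ℝ ({(x₁, y₁), (0, y₂), (x₃, y₁)} : Set (ℝ × ℝ)) =
      sh t ⁻¹' convexHull ℝ {(x₁, y₁), (t, y₂), (x₃, y₁)} := by
    refine Subset.antisymm (by simpa using hmaps 0 t) fun x hx => ?_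
    have h := hmaps t (-t) hx
    have e : sh (-t) (sh t x) = x := by
      ext <;> simp [hsh]
    rw [mem_preimage, e, add_neg_cancel] at h
    exact h
  have hcl : MeasurableSet (convexHull ℝ ({(x₁, y₁), (t, y₂), (x₃, y₁)} : Set (ℝ × ℝ))) :=
    ((toFinite _).isCompact_convexHull ℝ).measurableSet
  rw [hpre]
  exact (hmp.restrict_preimage hcl).map_eq

theorem map_neg_restrict_volume (A : Set (ℝ × ℝ)) (hA : MeasurableSet A) :
    (volume.restrict A).map (fun x => -x) = volume.restrict (-A) := by
  have h := (Measure.measurePreserving_neg (volume : Measure (ℝ × ℝ))).restrict_preimage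
    (s := -A) hA.neg
  have e : (fun x : ℝ × ℝ => -x) ⁻¹' (-A) = A := by ext x; simp
  rw [← h.map_eq]
  congr 2
  exact e.symm

/-- For a symmetric Mahler sliding family, the inverse area of the `L^p`-polar bodies is a convex
function of the sliding parameter. -/
theorem sym_sliding_lemma (p : ℝ) (hp : 0 < p)
    (x1 x3 y1 y2 : ℝ) (hx : x3 < x1) (hy : y1 < y2)
    (Shat : Set (ℝ × ℝ)) (hScomp : IsCompact Shat) (hSconv : Convex ℝ Shat)
    (hSint : (interior Shat).Nonempty) (hSsym : Shat = -Shat)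
    (hseg : segment ℝ ((x3 : ℝ), y1) ((x1 : ℝ), y1) ⊆ Shat)
    (I : Set ℝ) (hI : Convex ℝ I)
    (Δ : ℝ → Set (ℝ × ℝ))
    (hΔ : ∀ t, Δ t = convexHull ℝ ({(x1, y1), (t, y2), (x3, y1)} : Set (ℝ × ℝ)))
    (S : ℝ → Set (ℝ × ℝ))
    (hS : ∀ t, S t = convexHull ℝ (Shat ∪ ({(t, y2), (-t, -y2)} : Set (ℝ × ℝ))))
    (hdecomp : ∀ t ∈ I, S t = Shat ∪ Δ t ∪ (-Δ t) ∧
      interior Shat ∩ interior (Δ t) = ∅ ∧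
      interior Shat ∩ interior (-Δ t) = ∅ ∧
      interior (Δ t) ∩ interior (-Δ t) = ∅) :
    ConvexOn ℝ I (fun t => 1 / (volume (lpPolar p (S t))).toReal) := by
  have hΔcomp : ∀ t, IsCompact (Δ t) := fun t => by
    rw [hΔ]; exact (toFinite _).isCompact_convexHull ℝ
  have hΔconv : ∀ t, Convex ℝ (Δ t) := fun t => by rw [hΔ]; exact convex_convexHull ℝ _
  obtain ⟨ε, hε, hball⟩ : ∃ ε : ℝ, 0 < ε ∧ Metric.closedBall 0 (3 * ε) ⊆ Shat := by
    have h0 : (0 : ℝ × ℝ) ∈ interior Shat := by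
      obtain ⟨x, hx⟩ := hSint
      have hnx : -x ∈ Shat := by
        rw [hSsym]
        simpa using interior_subset hx
      have h := hSconv.combo_interior_self_mem_interior hx hnx (a := 1 / 2) (b := 1 / 2)
        (by norm_num) (by norm_num) (by norm_num)
      simpa using h
    obtain ⟨r, hr, hsub⟩ := Metric.nhds_basis_closedBall.mem_iff.1 (mem_interior_iff_mem_nhds.1 h0)
    exact ⟨r / 3, by positivity, by rwa [mul_div_cancel₀ r three_ne_zero]⟩
  set f₁ : ℝ × ℝ → ℝ × ℝ × ℝ := fun x => (x.1, 0, x.2) with hf₁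
  set f₂ : ℝ × ℝ → ℝ × ℝ × ℝ := fun x => (x.1, (x.2 - y1) / (y2 - y1), x.2) with hf₂
  have hf₁c : Continuous f₁ := by fun_prop
  have hf₂c : Continuous f₂ := by fun_prop
  set ν₁ := (volume.restrict Shat).map f₁ with hν₁
  set ν₂ := (volume.restrict (Δ 0)).map f₂ with hν₂
  set ν₃ := ν₂.map (fun ξ => -ξ) with hν₃
  have hν₃' : ν₃ = (volume.restrict (Δ 0)).map (fun x => -f₂ x) := by
    rw [hν₃, hν₂, Measure.map_map measurable_neg hf₂c.measurable]
    rfl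
  set ν := ν₁ + (ν₂ + ν₃) with hν
  have hνneg : ν.map (fun ξ => -ξ) = ν := by
    have h1 : ν₁.map (fun ξ => -ξ) = ν₁ := by
      have h := map_neg_restrict_volume Shat hScomp.measurableSet
      rw [← hSsym] at h
      conv_rhs => rw [hν₁, ← h]
      rw [hν₁, Measure.map_map measurable_neg hf₁c.measurable,
        Measure.map_map hf₁c.measurable measurable_neg]
      congr 1
      ext x <;> simp [hf₁]
    have h3 : ν₃.map (fun ξ => -ξ) = ν₂ := by
      rw [hν₃, Measure.map_map measurable_neg measurable_neg]
      have : ((fun ξ : ℝ × ℝ × ℝ => -ξ) ∘ fun ξ => -ξ) = id := by ext ξ <;> simp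
      rw [this, Measure.map_id]
    rw [hν, Measure.map_add _ _ measurable_neg, Measure.map_add _ _ measurable_neg, h1, h3, ← hν₃,
      add_comm ν₃]
  have htop : ∀ z, laplaceTransform p ν z < ⊤ := by
    intro z
    rw [hν, laplaceTransform_add, laplaceTransform_add, hν₃']
    exact ENNReal.add_lt_top.2 ⟨laplaceTransform_map_restrict_lt_top p hScomp hf₁c z,
      ENNReal.add_lt_top.2 ⟨laplaceTransform_map_restrict_lt_top p (hΔcomp 0) hf₂c z,
        laplaceTransform_map_restrict_lt_top p (hΔcomp 0) hf₂c.neg z⟩⟩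
  have hlow : ∀ u s v : ℝ, ENNReal.ofReal ((2 * ε) ^ 2 * Real.exp (p * (ε * (|u| + |v|)))) ≤
      laplaceTransform p ν (u, s, v) := by
    intro u s v
    rw [hν, laplaceTransform_add]
    exact (le_laplaceTransform_map_restrict hp hε hball u s v).trans le_self_add
  have hpos : ∀ z, 0 < laplaceTransform p ν z := fun z =>
    lt_of_lt_of_le (ENNReal.ofReal_pos.2 (by positivity)) (hlow z.1 z.2.1 z.2.2)
  have hproj : ∀ t ∈ I, ν.map (fun ξ => (ξ.1 + t * ξ.2.1, ξ.2.2)) = volume.restrict (S t) := by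
    intro t ht
    obtain ⟨hSt, hd₁, hd₂, hd₃⟩ := hdecomp t ht
    set P : ℝ × ℝ × ℝ → ℝ × ℝ := fun ξ => (ξ.1 + t * ξ.2.1, ξ.2.2) with hP
    have hPm : Measurable P := by fun_prop
    have h1 : ν₁.map P = volume.restrict Shat := by
      rw [hν₁, Measure.map_map hPm hf₁c.measurable]
      have : P ∘ f₁ = id := by ext x <;> simp [hP, hf₁]
      rw [this, Measure.map_id]
    have h2 : ν₂.map P = volume.restrict (Δ t) := by
      rw [hν₂, Measure.map_map hPm hf₂c.measurable, hΔ, hΔ]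
      exact map_shear_restrict_triangle hy t
    have h3 : ν₃.map P = volume.restrict (-Δ t) := by
      rw [← map_neg_restrict_volume _ (hΔcomp t).measurableSet, ← h2, hν₃,
        Measure.map_map hPm measurable_neg, Measure.map_map measurable_neg hPm]
      congr 1
      ext ξ
      · simp [hP]; ring
      · simp [hP]
    have hdis : AEDisjoint volume (Shat ∪ Δ t) (-Δ t) :=
      AEDisjoint.union_left
        (aedisjoint_of_interior_inter_eq_empty hSconv (hΔconv t).neg hd₂)
        (aedisjoint_of_interior_inter_eq_empty (hΔconv t) (hΔconv t).neg hd₃)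
    rw [hν, Measure.map_add _ _ hPm, Measure.map_add _ _ hPm, h1, h2, h3, hSt,
      Measure.restrict_union₀ hdis (hΔcomp t).measurableSet.neg.nullMeasurableSet,
      Measure.restrict_union₀ (aedisjoint_of_interior_inter_eq_empty hSconv (hΔconv t) hd₁)
        (hΔcomp t).measurableSet.nullMeasurableSet, add_assoc]
  have hconv := convexOn_logLaplace hp hpos htop
  have hgrow := growth_logLaplace hp htop (m := (2 * ε) ^ 2) (by positivity) hlow
  have hcont : Continuous (logLaplace p ν) :=
    continuousOn_univ.1 (hconv.continuousOn isOpen_univ)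
  have heven : ∀ z, logLaplace p ν (-z) = logLaplace p ν z := fun z => by
    rw [logLaplace, logLaplace, laplaceTransform_neg p hνneg]
  refine ((convexOn_inv_volume_momentSection hconv heven hε hgrow).subset (subset_univ I)
    hI).congr fun t ht => ?_
  simp only
  rw [lpPolar_eq_momentSection hcont hε hgrow (suppFn_eq_logLaplace p (hproj t ht))]
end
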